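/- Let d ≥ 2, 1 < p < ∞, C₀ > 0 and R > 0. Let V be a locally bounded measurable function on B_{2R} \ {0} ⊆ ℝ^d which is spherically symmetric (V(x) depends only on ‖x‖) and satisfies ‖x‖^p |V(x)| ≤ C₀ for almost every x, and let u be a positive C¹ weak solution of -Δ_p w + V|w|^{p-2}w = 0 in B_{2R} \ {0}. Then there exist a spherically symmetric positive C¹ weak solution ũ of the same equation in B_R \ {0} and constants C ≥ 1 and ε ∈ (0, R) such that C^{-1} ũ(x) ≤ u(x) ≤ C ũ(x) for all 0 < ‖x‖ < ε. -/

import Mathlib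

open MeasureTheory Metric Filter Topology Set
open scoped RealInnerProductSpace

noncomputable section

/-- `u` is a positive `C¹` weak solution of `-Δ_p u + V|u|^{p-2}u = 0` in the open set `Ω`. -/
def IsPosWeakSol {d : ℕ} (p : ℝ) (V : EuclideanSpace ℝ (Fin d) → ℝ)
    (Ω : Set (EuclideanSpace ℝ (Fin d))) (u : EuclideanSpace ℝ (Fin d) → ℝ) : Prop :=
  ContDiffOn ℝ 1 u Ω ∧ (∀ x ∈ Ω, 0 < u x) ∧
  ∀ φ : EuclideanSpace ℝ (Fin d) → ℝ, ContDiff ℝ (⊤ : ℕ∞) φ → HasCompactSupport φ →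
    tsupport φ ⊆ Ω →
    ∫ x in Ω, (‖gradient u x‖ ^ (p - 2) * ⟪gradient u x, gradient φ x⟫ +
      V x * |u x| ^ (p - 2) * u x * φ x) = 0

abbrev Euc (d : ℕ) := EuclideanSpace ℝ (Fin d)

section Gradients

variable {d : ℕ}

theorem hasGradientAt_comp_real {f : Euc d → ℝ} {f' x : Euc d} {G : ℝ → ℝ} {G' : ℝ}
    (hG : HasDerivAt G G' (f x)) (hf : HasGradientAt f f' x) :
    HasGradientAt (fun y => G (f y)) (G' • f') x := by
  rw [hasGradientAt_iff_hasFDerivAt] at hf ⊢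
  rw [map_smul]
  exact hG.comp_hasFDerivAt x hf

theorem hasGradientAt_mul_real {f g : Euc d → ℝ} {f' g' x : Euc d}
    (hf : HasGradientAt f f' x) (hg : HasGradientAt g g' x) :
    HasGradientAt (fun y => f y * g y) (f x • g' + g x • f') x := by
  rw [hasGradientAt_iff_hasFDerivAt] at hf hg ⊢
  rw [map_add, map_smul, map_smul]
  exact hf.mul hg

theorem hasGradientAt_sub_real {f g : Euc d → ℝ} {f' g' x : Euc d}
    (hf : HasGradientAt f f' x) (hg : HasGradientAt g g' x) :
    HasGradientAt (fun y => f y - g y) (f' - g') x := by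
  rw [hasGradientAt_iff_hasFDerivAt] at hf hg ⊢
  rw [map_sub]
  exact hf.sub hg

theorem norm_gradient_eq_norm_fderiv (f : Euc d → ℝ) (x : Euc d) :
    ‖gradient f x‖ = ‖fderiv ℝ f x‖ := by
  simp [gradient]

theorem gradient_eq_zero_of_notMem_tsupport {f : Euc d → ℝ} {x : Euc d} (hx : x ∉ tsupport f) :
    gradient f x = 0 := by
  have h : f =ᶠ[𝓝 x] fun _ => 0 := notMem_tsupport_iff_eventuallyEq.1 hx
  rw [h.gradient_eq]
  simp

theorem continuousOn_gradient {f : Euc d → ℝ} {Ω : Set (Euc d)} (hΩ : IsOpen Ω)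
    (hf : ContDiffOn ℝ 1 f Ω) : ContinuousOn (gradient f) Ω :=
  (InnerProductSpace.toDual ℝ (Euc d)).symm.continuous.comp_continuousOn
    (hf.continuousOn_fderiv_of_isOpen hΩ le_rfl)

theorem continuous_gradient {f : Euc d → ℝ} (hf : ContDiff ℝ 1 f) : Continuous (gradient f) :=
  (InnerProductSpace.toDual ℝ (Euc d)).symm.continuous.comp (hf.continuous_fderiv one_ne_zero)

theorem ContDiffOn.hasGradientAt_of_isOpen {f : Euc d → ℝ} {Ω : Set (Euc d)} (hΩ : IsOpen Ω)
    (hf : ContDiffOn ℝ 1 f Ω) {x : Euc d} (hx : x ∈ Ω) : HasGradientAt f (gradient f x) x :=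
  ((hf.differentiableOn one_ne_zero).differentiableAt (hΩ.mem_nhds hx)).hasGradientAt

theorem ContDiff.hasGradientAt_one {f : Euc d → ℝ} (hf : ContDiff ℝ 1 f) (x : Euc d) :
    HasGradientAt f (gradient f x) x :=
  (hf.differentiable one_ne_zero x).hasGradientAt

theorem contDiff_mul_of_tsupport_subset {f φ : Euc d → ℝ} {Ω : Set (Euc d)} (hΩ : IsOpen Ω)
    (hf : ContDiffOn ℝ 1 f Ω) (hφ : ContDiff ℝ 1 φ) (hs : tsupport φ ⊆ Ω) :
    ContDiff ℝ 1 (fun x => f x * φ x) := by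
  rw [contDiff_iff_contDiffAt]
  intro x
  by_cases hx : x ∈ Ω
  · exact (hf.contDiffAt (hΩ.mem_nhds hx)).mul hφ.contDiffAt
  · have h : φ =ᶠ[𝓝 x] fun _ => 0 := notMem_tsupport_iff_eventuallyEq.1 fun h => hx (hs h)
    refine (contDiffAt_const (c := (0 : ℝ))).congr_of_eventuallyEq ?_
    filter_upwards [h] with y hy
    simp [hy]

/-- The vector field `ξ ↦ |ξ|^{p-2} ξ`. -/
def pFlux (p : ℝ) (ξ : Euc d) : Euc d := ‖ξ‖ ^ (p - 2) • ξ

theorem norm_pFlux {p : ℝ} (hp : 1 < p) (ξ : Euc d) : ‖pFlux p ξ‖ = ‖ξ‖ ^ (p - 1) := by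
  rcases eq_or_ne ξ 0 with rfl | h
  · simp [pFlux, Real.zero_rpow (by linarith : p - 1 ≠ 0)]
  · have h0 : 0 < ‖ξ‖ := norm_pos_iff.2 h
    rw [pFlux, norm_smul, Real.norm_of_nonneg (by positivity)]
    conv_lhs => rw [← Real.rpow_one ‖ξ‖, ← Real.rpow_mul h0.le, one_mul, ← Real.rpow_add h0]
    congr 1; ring

theorem continuous_pFlux {p : ℝ} (hp : 1 < p) : Continuous (pFlux p : Euc d → Euc d) := by
  rw [continuous_iff_continuousAt]
  intro ξ
  rcases eq_or_ne ξ 0 with rfl | h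
  · rw [ContinuousAt, tendsto_iff_norm_sub_tendsto_zero]
    have h0 : pFlux p (0 : Euc d) = 0 := by simp [pFlux]
    simp_rw [h0, sub_zero, norm_pFlux hp]
    have : ContinuousAt (fun ξ : Euc d => ‖ξ‖ ^ (p - 1)) 0 :=
      continuous_norm.continuousAt.rpow_const (Or.inr (by linarith))
    simpa [ContinuousAt, Real.zero_rpow (by linarith : p - 1 ≠ 0)] using this
  · exact (continuous_norm.continuousAt.rpow_const (Or.inl (norm_ne_zero_iff.2 h))).smul
      continuousAt_id

theorem inner_pFlux (p : ℝ) (ξ w : Euc d) : ⟪pFlux p ξ, w⟫ = ‖ξ‖ ^ (p - 2) * ⟪ξ, w⟫ := by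
  rw [pFlux, real_inner_smul_left]

theorem inner_pFlux_self {p : ℝ} (hp : 1 < p) (ξ : Euc d) : ⟪pFlux p ξ, ξ⟫ = ‖ξ‖ ^ p := by
  rw [inner_pFlux]
  rcases eq_or_ne ξ 0 with rfl | h
  · simp [Real.zero_rpow (by linarith : p ≠ 0)]
  · have h0 : 0 < ‖ξ‖ := norm_pos_iff.2 h
    rw [real_inner_self_eq_norm_sq, ← Real.rpow_natCast, ← Real.rpow_add h0]
    congr 1; norm_num

theorem pFlux_smul {p t : ℝ} (ht : 0 < t) (ξ : Euc d) :
    pFlux p (t • ξ) = t ^ (p - 1) • pFlux p ξ := by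
  rw [pFlux, pFlux, norm_smul, Real.norm_of_nonneg ht.le, Real.mul_rpow ht.le (norm_nonneg _),
    smul_smul, smul_smul]
  congr 1
  rw [show p - 1 = (p - 2) + 1 by ring, Real.rpow_add ht, Real.rpow_one]
  ring

theorem abs_inner_pFlux_le {p : ℝ} (hp : 1 < p) (ξ w : Euc d) :
    |⟪pFlux p ξ, w⟫| ≤ ‖ξ‖ ^ (p - 1) * ‖w‖ := by
  rw [← norm_pFlux hp]
  exact abs_real_inner_le_norm _ _

end Gradients

section Mollification

variable {d : ℕ}

theorem exists_smooth_approx {ψ : Euc d → ℝ} (hψ : ContDiff ℝ 1 ψ) (hc : HasCompactSupport ψ)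
    {δ ε : ℝ} (hδ : 0 < δ) (hε : 0 < ε) :
    ∃ φ : Euc d → ℝ, ContDiff ℝ (⊤ : ℕ∞) φ ∧ tsupport φ ⊆ cthickening δ (tsupport ψ) ∧
      ∀ x, |ψ x - φ x| ≤ ε ∧ ‖gradient ψ x - gradient φ x‖ ≤ ε := by
  have hu1 : UniformContinuous ψ := hc.uniformContinuous_of_continuous hψ.continuous
  have hcd : HasCompactSupport (fderiv ℝ ψ) := hc.fderiv ℝ
  have hcont : Continuous (fderiv ℝ ψ) := hψ.continuous_fderiv one_ne_zero
  have hu2 : UniformContinuous (fderiv ℝ ψ) := hcd.uniformContinuous_of_continuous hcont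
  rw [Metric.uniformContinuous_iff] at hu1 hu2
  obtain ⟨δ₁, hδ₁, h1⟩ := hu1 ε hε
  obtain ⟨δ₂, hδ₂, h2⟩ := hu2 ε hε
  set r := min δ (min δ₁ δ₂) with hr
  have hr0 : 0 < r := by positivity
  let b : ContDiffBump (0 : Euc d) := ⟨r / 2, r, by positivity, by linarith⟩
  have hbr : b.rOut = r := rfl
  refine ⟨convolution (b.normed volume) ψ (ContinuousLinearMap.lsmul ℝ ℝ) volume, ?_, ?_, ?_⟩
  · exact b.hasCompactSupport_normed.contDiff_convolution_left _ b.contDiff_normed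
      hψ.continuous.locallyIntegrable
  · refine closure_minimal ?_ isClosed_cthickening
    refine (support_convolution_subset _).trans ?_
    rw [b.support_normed_eq, hbr]
    rintro _ ⟨y, hy, z, hz, rfl⟩
    refine mem_cthickening_of_dist_le _ z _ _ (subset_closure hz) ?_
    simp only [mem_ball, dist_zero_right] at hy
    simp only [dist_eq_norm, add_sub_cancel_right]
    exact hy.le.trans (min_le_left _ _)
  · intro x
    constructor
    · rw [abs_sub_comm, ← Real.dist_eq]
      refine b.dist_normed_convolution_le hψ.continuous.aestronglyMeasurable ?_
      intro y hy
      exact (h1 (lt_of_lt_of_le hy ((min_le_right _ _).trans (min_le_left _ _)))).le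
    · have hd := hc.hasFDerivAt_convolution_right (μ := volume) (ContinuousLinearMap.lsmul ℝ ℝ)
        (b.continuous_normed (μ := volume)).locallyIntegrable hψ x
      have : gradient ψ x - gradient (convolution (b.normed volume) ψ
          (ContinuousLinearMap.lsmul ℝ ℝ) volume) x = (InnerProductSpace.toDual ℝ (Euc d)).symm
          (fderiv ℝ ψ x - (convolution (b.normed volume) (fderiv ℝ ψ)
          (ContinuousLinearMap.lsmul ℝ ℝ) volume) x) := by
        rw [map_sub, gradient, gradient, hd.fderiv]
        congr 2
      rw [this, LinearIsometryEquiv.norm_map, ← dist_eq_norm, dist_comm]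
      refine b.dist_normed_convolution_le hcont.aestronglyMeasurable ?_
      intro y hy
      exact (h2 (lt_of_lt_of_le hy ((min_le_right _ _).trans (min_le_right _ _)))).le

theorem integral_C1_test_eq_zero {Ω : Set (Euc d)} (hΩ : IsOpen Ω) {F : Euc d → Euc d}
    {h : Euc d → ℝ} (hF : ∀ K, IsCompact K → K ⊆ Ω → IntegrableOn F K)
    (hh : ∀ K, IsCompact K → K ⊆ Ω → IntegrableOn h K)
    (H : ∀ φ : Euc d → ℝ, ContDiff ℝ (⊤ : ℕ∞) φ → HasCompactSupport φ → tsupport φ ⊆ Ω →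
      ∫ x in Ω, (⟪F x, gradient φ x⟫ + h x * φ x) = 0)
    {ψ : Euc d → ℝ} (hψ : ContDiff ℝ 1 ψ) (hc : HasCompactSupport ψ) (hs : tsupport ψ ⊆ Ω) :
    ∫ x, (⟪F x, gradient ψ x⟫ + h x * ψ x) = 0 := by
  obtain ⟨δ, hδ, hδs⟩ := hc.isCompact.exists_cthickening_subset_open hΩ hs
  set K := cthickening δ (tsupport ψ) with hK
  have hKc : IsCompact K := hc.isCompact.cthickening
  have key : ∀ χ : Euc d → ℝ, ContDiff ℝ 1 χ → tsupport χ ⊆ K →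
      IntegrableOn (fun x => ⟪F x, gradient χ x⟫ + h x * χ x) K ∧
      (∀ x, x ∉ K → ⟪F x, gradient χ x⟫ + h x * χ x = 0) := by
    intro χ hχ hχs
    have hcs : HasCompactSupport χ := hKc.of_isClosed_subset (isClosed_tsupport _) hχs
    refine ⟨?_, ?_⟩
    · refine Integrable.add ?_ ?_
      · obtain ⟨M, hM⟩ := hKc.exists_bound_of_continuousOn (continuous_gradient hχ).continuousOn
        refine Integrable.mono' ((hF K hKc hδs).norm.mul_const M)
          ((hF K hKc hδs).aestronglyMeasurable.inner
            (continuous_gradient hχ).aestronglyMeasurable) ?_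
        filter_upwards [ae_restrict_mem hKc.measurableSet] with x hx
        exact (norm_inner_le_norm _ _).trans (by gcongr; exact hM x hx)
      · obtain ⟨M, hM⟩ := hKc.exists_bound_of_continuousOn hχ.continuous.continuousOn
        refine Integrable.mono' ((hh K hKc hδs).norm.mul_const M)
          ((hh K hKc hδs).aestronglyMeasurable.mul hχ.continuous.aestronglyMeasurable) ?_
        filter_upwards [ae_restrict_mem hKc.measurableSet] with x hx
        rw [norm_mul]
        gcongr
        exact hM x hx
    · intro x hx
      have hx' : x ∉ tsupport χ := fun h => hx (hχs h)
      rw [gradient_eq_zero_of_notMem_tsupport hx', image_eq_zero_of_notMem_tsupport hx']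
      simp
  have hψK : tsupport ψ ⊆ K := self_subset_cthickening _
  obtain ⟨hi, hz⟩ := key ψ hψ hψK
  set B := ∫ x in K, (‖F x‖ + ‖h x‖) with hB
  have hB0 : 0 ≤ B := integral_nonneg fun x => by positivity
  have hBi : IntegrableOn (fun x => ‖F x‖ + ‖h x‖) K := (hF K hKc hδs).norm.add (hh K hKc hδs).norm
  rw [← setIntegral_eq_integral_of_forall_compl_eq_zero hz, ← norm_le_zero_iff]
  refine le_of_forall_pos_le_add fun ε hε => ?_
  obtain ⟨φ, hφ, hφs, hφa⟩ := exists_smooth_approx hψ hc hδ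
    (ε := ε / (B + 1)) (by positivity)
  have hφ1 : ContDiff ℝ 1 φ := hφ.of_le (by exact_mod_cast le_top)
  obtain ⟨hi', hz'⟩ := key φ hφ1 hφs
  have h0 : ∫ x in K, (⟪F x, gradient φ x⟫ + h x * φ x) = 0 := by
    rw [← H φ hφ (hKc.of_isClosed_subset (isClosed_tsupport _) hφs) (hφs.trans hδs),
      setIntegral_eq_integral_of_forall_compl_eq_zero hz',
      setIntegral_eq_integral_of_forall_compl_eq_zero]
    exact fun x hx => hz' x fun h => hx (hδs h)
  have he : ∫ x in K, (⟪F x, gradient ψ x⟫ + h x * ψ x) =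
      ∫ x in K, (⟪F x, gradient ψ x⟫ + h x * ψ x - (⟪F x, gradient φ x⟫ + h x * φ x)) := by
    rw [integral_sub hi hi', h0, sub_zero]
  rw [he]
  calc ‖∫ x in K, (⟪F x, gradient ψ x⟫ + h x * ψ x - (⟪F x, gradient φ x⟫ + h x * φ x))‖
      ≤ ∫ x in K, (‖F x‖ + ‖h x‖) * (ε / (B + 1)) := by
        refine norm_integral_le_of_norm_le (hBi.mul_const _) (ae_of_all _ fun x => ?_)
        have : ⟪F x, gradient ψ x⟫ + h x * ψ x - (⟪F x, gradient φ x⟫ + h x * φ x) =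
          ⟪F x, gradient ψ x - gradient φ x⟫ + h x * (ψ x - φ x) := by
          rw [inner_sub_right]; ring
        rw [this, add_mul]
        refine (norm_add_le _ _).trans (add_le_add ?_ ?_)
        · exact (norm_inner_le_norm _ _).trans (by gcongr; exact (hφa x).2)
        · rw [norm_mul]; gcongr; exact (hφa x).1
    _ = B * (ε / (B + 1)) := by rw [integral_mul_const]
    _ ≤ 0 + ε := by
        rw [zero_add, mul_div_assoc', div_le_iff₀ (by positivity)]
        nlinarith

end Mollification

section LogForm

variable {d : ℕ}

/-- The weak form, tested with compactly supported `C¹` functions, of the equation satisfied by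
`L = log u` when `u` is a positive solution of `-Δ_p u + V u^{p-1} = 0`. -/
def LogSol (p : ℝ) (V : Euc d → ℝ) (Ω : Set (Euc d)) (L : Euc d → ℝ) : Prop :=
  ContDiffOn ℝ 1 L Ω ∧ ∀ ψ : Euc d → ℝ, ContDiff ℝ 1 ψ → HasCompactSupport ψ → tsupport ψ ⊆ Ω →
    ∫ x, (⟪pFlux p (gradient L x), gradient ψ x⟫ +
      (V x - (p - 1) * ‖gradient L x‖ ^ p) * ψ x) = 0

/-- Boundedness on the compact subsets of `Ω`. -/
def BddOnCompacts (V : Euc d → ℝ) (Ω : Set (Euc d)) : Prop :=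
  ∀ K, IsCompact K → K ⊆ Ω → ∃ M : ℝ, ∀ x ∈ K, |V x| ≤ M

theorem LogSol.mono {p : ℝ} {V L : Euc d → ℝ} {Ω Ω' : Set (Euc d)} (h : LogSol p V Ω L)
    (hs : Ω' ⊆ Ω) : LogSol p V Ω' L :=
  ⟨h.1.mono hs, fun ψ h1 h2 h3 => h.2 ψ h1 h2 (h3.trans hs)⟩

theorem integrableOn_mul_of_bdd {V g : Euc d → ℝ} (hV : Measurable V) {K : Set (Euc d)}
    (hK : IsCompact K) (hb : ∃ M : ℝ, ∀ x ∈ K, |V x| ≤ M) (hg : ContinuousOn g K) :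
    IntegrableOn (fun x => V x * g x) K := by
  obtain ⟨M, hM⟩ := hb
  refine Integrable.mono' ((hg.norm.integrableOn_compact hK).const_mul M)
    (hV.aestronglyMeasurable.mul (hg.aestronglyMeasurable hK.measurableSet)) ?_
  filter_upwards [ae_restrict_mem hK.measurableSet] with x hx
  rw [norm_mul]
  gcongr
  exact hM x hx

theorem logSol_of_isPosWeakSol {p : ℝ} (hp : 1 < p) {V u : Euc d → ℝ} {Ω : Set (Euc d)}
    (hΩ : IsOpen Ω) (hV : Measurable V) (hVb : BddOnCompacts V Ω) (hu : IsPosWeakSol p V Ω u) :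
    LogSol p V Ω (fun x => Real.log (u x)) := by
  obtain ⟨huc, hpos, hw⟩ := hu
  refine ⟨huc.log fun x hx => (hpos x hx).ne', ?_⟩
  intro ψ hψ hc hs
  have hpow : ContDiffOn ℝ 1 (fun x => u x ^ (1 - p)) Ω :=
    huc.rpow_const_of_ne fun x hx => (hpos x hx).ne'
  have hφ := contDiff_mul_of_tsupport_subset hΩ hpow hψ hs
  have hφs : tsupport (fun x => u x ^ (1 - p) * ψ x) ⊆ tsupport ψ := tsupport_mul_subset_right
  have hgc := continuousOn_gradient hΩ huc
  have key := integral_C1_test_eq_zero hΩ (F := fun x => pFlux p (gradient u x))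
    (h := fun x => V x * (|u x| ^ (p - 2) * u x)) ?_ ?_ ?_ hφ
    (hc.of_isClosed_subset (isClosed_tsupport _) hφs) (hφs.trans hs)
  · rw [← key]
    congr 1
    ext x
    by_cases hx : x ∈ Ω
    · have h0 := hpos x hx
      have hg := huc.hasGradientAt_of_isOpen hΩ hx
      rw [(hasGradientAt_comp_real (Real.hasDerivAt_log h0.ne') hg).gradient,
        (hasGradientAt_mul_real (hasGradientAt_comp_real
          (Real.hasDerivAt_rpow_const (p := 1 - p) (Or.inl h0.ne')) hg)
          (hψ.hasGradientAt_one x)).gradient, pFlux_smul (inv_pos.2 h0), norm_smul,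
        Real.norm_of_nonneg (inv_pos.2 h0).le, Real.mul_rpow (inv_pos.2 h0).le (norm_nonneg _),
        inner_add_right, real_inner_smul_left, real_inner_smul_right, real_inner_smul_right,
        real_inner_smul_right, inner_pFlux_self hp, abs_of_pos h0, Real.inv_rpow h0.le,
        Real.inv_rpow h0.le, ← Real.rpow_neg h0.le, ← Real.rpow_neg h0.le]
      have e1 : u x ^ (-(p - 1)) = u x ^ (1 - p) := by congr 1; ring
      have e2 : u x ^ (1 - p - 1) = u x ^ (-p) := by congr 1; ring
      have e3 : u x ^ (p - 2) * u x * u x ^ (1 - p) = 1 := by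
        rw [← Real.rpow_add_one h0.ne', ← Real.rpow_add h0]
        rw [show p - 2 + 1 + (1 - p) = 0 by ring, Real.rpow_zero]
      rw [e1, e2]
      linear_combination (-(V x * ψ x)) * e3
    · have hx' : x ∉ tsupport ψ := fun h => hx (hs h)
      rw [gradient_eq_zero_of_notMem_tsupport hx', image_eq_zero_of_notMem_tsupport hx',
        gradient_eq_zero_of_notMem_tsupport fun h => hx' (hφs h)]
      simp
  · intro K hK hKs
    exact ((continuous_pFlux hp).comp_continuousOn (hgc.mono hKs)).integrableOn_compact hK
  · intro K hK hKs
    refine integrableOn_mul_of_bdd hV hK (hVb K hK hKs) ?_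
    have hc := (huc.continuousOn.mono hKs)
    exact (hc.abs.rpow_const fun x hx => Or.inl (abs_pos.2 (hpos x (hKs hx)).ne').ne').mul hc
  · intro φ h1 h2 h3
    rw [← hw φ h1 h2 h3]
    congr 1
    ext x
    rw [inner_pFlux]
    ring

theorem isPosWeakSol_of_logSol {p : ℝ} (hp : 1 < p) {V L : Euc d → ℝ} {Ω : Set (Euc d)}
    (hΩ : IsOpen Ω) (hL : LogSol p V Ω L) :
    IsPosWeakSol p V Ω (fun x => Real.exp (L x)) := by
  obtain ⟨hLc, hw⟩ := hL
  refine ⟨hLc.exp, fun x _ => Real.exp_pos _, ?_⟩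
  intro φ hφ hc hs
  have hφ1 : ContDiff ℝ 1 φ := hφ.of_le (by exact_mod_cast le_top)
  have hpow : ContDiffOn ℝ 1 (fun x => Real.exp ((p - 1) * L x)) Ω :=
    (contDiffOn_const.mul hLc).exp
  have hψ := contDiff_mul_of_tsupport_subset hΩ hpow hφ1 hs
  have hψs : tsupport (fun x => Real.exp ((p - 1) * L x) * φ x) ⊆ tsupport φ :=
    tsupport_mul_subset_right
  rw [← hw _ hψ (hc.of_isClosed_subset (isClosed_tsupport _) hψs) (hψs.trans hs),
    setIntegral_eq_integral_of_forall_compl_eq_zero]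
  · congr 1
    ext x
    by_cases hx : x ∈ Ω
    · have hg := hLc.hasGradientAt_of_isOpen hΩ hx
      have h0 := Real.exp_pos (L x)
      have hd : HasDerivAt (fun t => Real.exp ((p - 1) * t))
          (Real.exp ((p - 1) * L x) * (p - 1)) (L x) := by
        simpa using ((hasDerivAt_id (L x)).const_mul (p - 1)).exp
      rw [(hasGradientAt_comp_real (Real.hasDerivAt_exp (L x)) hg).gradient,
        (hasGradientAt_mul_real (hasGradientAt_comp_real hd hg)
          (hφ1.hasGradientAt_one x)).gradient, ← inner_pFlux, pFlux_smul h0, real_inner_smul_left,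
        inner_add_right, real_inner_smul_right, real_inner_smul_right,
        real_inner_smul_right, inner_pFlux_self hp, abs_of_pos h0]
      have e1 : Real.exp (L x) ^ (p - 1) = Real.exp ((p - 1) * L x) := by
        rw [← Real.exp_mul, mul_comm]
      have e2 : Real.exp (L x) ^ (p - 2) * Real.exp (L x) = Real.exp ((p - 1) * L x) := by
        rw [← Real.rpow_add_one h0.ne', ← e1]; congr 1; ring
      rw [e1]
      linear_combination (V x * φ x) * e2
    · have hx' : x ∉ tsupport φ := fun h => hx (hs h)
      rw [gradient_eq_zero_of_notMem_tsupport hx', image_eq_zero_of_notMem_tsupport hx',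
        gradient_eq_zero_of_notMem_tsupport fun h => hx' (hψs h)]
      simp
  · intro x hx
    have hx' : x ∉ tsupport φ := fun h => hx (hs h)
    rw [gradient_eq_zero_of_notMem_tsupport hx', image_eq_zero_of_notMem_tsupport hx']
    simp

theorem hasGradientAt_comp_affine {f : Euc d → ℝ} {f' x x₀ : Euc d} {ρ : ℝ}
    (hf : HasGradientAt f f' (x₀ + ρ • x)) :
    HasGradientAt (fun y => f (x₀ + ρ • y)) (ρ • f') x := by
  rw [hasGradientAt_iff_hasFDerivAt] at hf ⊢
  have h : HasFDerivAt (fun y : Euc d => x₀ + ρ • y) (ρ • ContinuousLinearMap.id ℝ (Euc d)) x :=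
    ((hasFDerivAt_id x).const_smul ρ).const_add x₀
  have e : InnerProductSpace.toDual ℝ (Euc d) (ρ • f') =
      (InnerProductSpace.toDual ℝ (Euc d) f').comp (ρ • ContinuousLinearMap.id ℝ (Euc d)) := by
    ext y
    simp
  rw [e]
  exact hf.comp x h

theorem integral_comp_affine (f : Euc d → ℝ) (x₀ : Euc d) {ρ : ℝ} (hρ : 0 < ρ) :
    ∫ x, f (x₀ + ρ • x) = (ρ ^ d)⁻¹ * ∫ x, f x := by
  rw [Measure.integral_comp_smul volume (fun x => f (x₀ + x)) ρ,
    integral_add_left_eq_self (fun x => f x) x₀, finrank_euclideanSpace_fin,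
    abs_of_pos (by positivity), smul_eq_mul]

theorem LogSol.comp_affine {p : ℝ} {V L : Euc d → ℝ} {Ω : Set (Euc d)}
    (hΩ : IsOpen Ω) (h : LogSol p V Ω L) (x₀ : Euc d) {ρ : ℝ} (hρ : 0 < ρ) :
    LogSol p (fun x => ρ ^ p * V (x₀ + ρ • x)) ((fun x => x₀ + ρ • x) ⁻¹' Ω)
      (fun x => L (x₀ + ρ • x)) := by
  have hT : ContDiff ℝ 1 (fun x : Euc d => x₀ + ρ • x) :=
    contDiff_const.add (contDiff_id.const_smul ρ)
  refine ⟨h.1.comp hT.contDiffOn fun x hx => hx, ?_⟩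
  intro ψ hψ hc hs
  let e : Euc d ≃ₜ Euc d :=
    (Homeomorph.smulOfNeZero ρ hρ.ne').trans (Homeomorph.addLeft x₀)
  have he : ∀ x, e x = x₀ + ρ • x := fun x => rfl
  have hes : ∀ x, e.symm x = -(ρ⁻¹ • x₀) + ρ⁻¹ • x := by
    intro x
    rw [Homeomorph.symm_apply_eq, he]
    simp [smul_smul, hρ.ne']
  set χ : Euc d → ℝ := fun x => ψ (-(ρ⁻¹ • x₀) + ρ⁻¹ • x) with hχ
  have hχe : χ = ψ ∘ e.symm := by ext x; simp [hχ, hes]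
  have hχ1 : ContDiff ℝ 1 χ := hψ.comp (contDiff_const.add (contDiff_id.const_smul ρ⁻¹))
  have hχc : HasCompactSupport χ := by rw [hχe]; exact hc.comp_homeomorph _
  have hχs : tsupport χ ⊆ Ω := by
    rw [hχe, tsupport_comp_eq_preimage]
    intro x hx
    have := hs hx
    simpa [← he] using this
  have h2 := h.2 χ hχ1 hχc hχs
  have key := integral_comp_affine (fun x => ⟪pFlux p (gradient L x), gradient χ x⟫ +
      (V x - (p - 1) * ‖gradient L x‖ ^ p) * χ x) x₀ hρ
  rw [h2, mul_zero] at key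
  rw [← mul_zero (ρ ^ p), ← key, ← integral_const_mul]
  congr 1
  ext x
  have hinv : -(ρ⁻¹ • x₀) + ρ⁻¹ • (x₀ + ρ • x) = x := by simp [smul_smul, hρ.ne']
  by_cases hx : x₀ + ρ • x ∈ Ω
  · have hχx : χ (x₀ + ρ • x) = ψ x := by rw [hχ]; simp only [hinv]
    have hg : gradient χ (x₀ + ρ • x) = ρ⁻¹ • gradient ψ x := by
      refine (hasGradientAt_comp_affine ?_).gradient
      rw [hinv]
      exact hψ.hasGradientAt_one x
    rw [(hasGradientAt_comp_affine (h.1.hasGradientAt_of_isOpen hΩ hx)).gradient, hχx, hg,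
      pFlux_smul hρ, norm_smul, Real.norm_of_nonneg hρ.le, Real.mul_rpow hρ.le (norm_nonneg _),
      real_inner_smul_left, real_inner_smul_right]
    have : ρ ^ (p - 1) = ρ ^ p * ρ⁻¹ := by rw [Real.rpow_sub_one hρ.ne']; rfl
    rw [this]
    ring
  · have hx' : x ∉ tsupport ψ := fun h => hx (hs h)
    have hx2 : x₀ + ρ • x ∉ tsupport χ := fun h => hx (hχs h)
    rw [gradient_eq_zero_of_notMem_tsupport hx', image_eq_zero_of_notMem_tsupport hx',
      gradient_eq_zero_of_notMem_tsupport hx2, image_eq_zero_of_notMem_tsupport hx2]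
    simp

end LogForm

section Caccioppoli

variable {d : ℕ}

theorem integrable_of_continuousOn_of_eq_zero {f : Euc d → ℝ} {K : Set (Euc d)}
    (hK : IsCompact K) (hf : ContinuousOn f K) (h0 : ∀ x, x ∉ K → f x = 0) : Integrable f :=
  (integrableOn_iff_integrable_of_support_subset fun x hx => by
    by_contra h
    exact hx (h0 x h)).1 (hf.integrableOn_compact hK)

theorem young_absorb {p lam a b : ℝ} (hp : 1 < p) (hlam : 0 < lam) (ha : 0 ≤ a) (hb : 0 ≤ b) :
    p * a ^ (p - 1) * b ≤ lam / 2 * a ^ p + p * (2 * p / lam) ^ (p - 1) * b ^ p := by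
  have hp0 : 0 < p := by linarith
  have hsplit : ∀ t : ℝ, 0 ≤ t → t ^ p = t ^ (p - 1) * t := fun t ht => by
    rcases ht.eq_or_lt with rfl | h
    · simp [Real.zero_rpow hp0.ne']
    · rw [← Real.rpow_add_one h.ne']; congr 1; ring
  rcases le_total b (lam / (2 * p) * a) with h | h
  · have : p * a ^ (p - 1) * b ≤ lam / 2 * a ^ p := by
      calc p * a ^ (p - 1) * b ≤ p * a ^ (p - 1) * (lam / (2 * p) * a) := by gcongr
        _ = lam / 2 * a ^ p := by rw [hsplit a ha]; field_simp
    have h2 : 0 ≤ p * (2 * p / lam) ^ (p - 1) * b ^ p := by positivity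
    linarith
  · have ha' : a ≤ 2 * p / lam * b := by
      rw [div_mul_eq_mul_div, div_le_iff₀ (by positivity)] at h
      rw [div_mul_eq_mul_div, le_div_iff₀ hlam]
      linarith
    have : p * a ^ (p - 1) * b ≤ p * (2 * p / lam) ^ (p - 1) * b ^ p := by
      calc p * a ^ (p - 1) * b ≤ p * (2 * p / lam * b) ^ (p - 1) * b := by
            gcongr
        _ = p * (2 * p / lam) ^ (p - 1) * b ^ p := by
            rw [Real.mul_rpow (by positivity) hb, hsplit b hb]; ring
    have h2 : 0 ≤ lam / 2 * a ^ p := by positivity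
    linarith

theorem rpow_sub_one_mul_le {p a b : ℝ} (hp : 1 < p) (ha : 0 ≤ a) (hb : 0 ≤ b) :
    a ^ (p - 1) * b ≤ a ^ p + b ^ p := by
  have hp0 : 0 < p := by linarith
  have hsplit : ∀ t : ℝ, 0 ≤ t → t ^ p = t ^ (p - 1) * t := fun t ht => by
    rcases ht.eq_or_lt with rfl | h
    · simp [Real.zero_rpow hp0.ne']
    · rw [← Real.rpow_add_one h.ne']; congr 1; ring
  have h1 : 0 ≤ a ^ p := by positivity
  have h2 : 0 ≤ b ^ p := by positivity
  rcases le_total a b with h | h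
  · have : a ^ (p - 1) * b ≤ b ^ (p - 1) * b := by
      gcongr
    rw [← hsplit b hb] at this; linarith
  · have : a ^ (p - 1) * b ≤ a ^ (p - 1) * a := by gcongr
    rw [← hsplit a ha] at this; linarith

theorem le_one_add_rpow {p a : ℝ} (hp : 1 < p) (ha : 0 ≤ a) : a ≤ 1 + a ^ p := by
  rcases le_total a 1 with h | h
  · have : 0 ≤ a ^ p := by positivity
    linarith
  · have : a ^ (1 : ℝ) ≤ a ^ p := Real.rpow_le_rpow_of_exponent_le h hp.le
    rw [Real.rpow_one] at this; linarith

theorem contDiff_rpow_of_nonneg {p : ℝ} (hp : 1 < p) {η : Euc d → ℝ} (hη : ContDiff ℝ 1 η) :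
    ContDiff ℝ 1 (fun x => η x ^ p) := by
  have := Real.contDiff_rpow_const_of_le (p := p) (n := 1) (by exact_mod_cast hp.le)
  exact this.comp hη

theorem hasGradientAt_rpow {p : ℝ} (hp : 1 < p) {η : Euc d → ℝ} (hη : ContDiff ℝ 1 η)
    (x : Euc d) : HasGradientAt (fun x => η x ^ p) ((p * η x ^ (p - 1)) • gradient η x) x :=
  hasGradientAt_comp_real (G := fun t => t ^ p)
    (Real.hasDerivAt_rpow_const (Or.inr hp.le)) (hη.hasGradientAt_one x)

theorem tsupport_rpow_subset {p : ℝ} (hp : 1 < p) (η : Euc d → ℝ) :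
    tsupport (fun x => η x ^ p) ⊆ tsupport η := by
  refine closure_mono fun x hx => ?_
  simp only [Function.mem_support] at hx ⊢
  intro h
  exact hx (by rw [h, Real.zero_rpow (by linarith)])

/-- The constant in the Caccioppoli inequality. -/
def caccConst (p lam Lam : ℝ) : ℝ := 2 / lam * (p * (2 * p / lam) ^ (p - 1) + Lam)

theorem LogSol.caccioppoli {p lam Lam : ℝ} (hp : 1 < p) (hlam : 0 < lam) (hLam : 0 ≤ Lam)
    {V L : Euc d → ℝ} {Ω : Set (Euc d)} (hΩ : IsOpen Ω) (h : LogSol p V Ω L) (hV : Measurable V)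
    (hVb : ∀ᵐ x ∂(volume.restrict Ω), |V x| ≤ Lam) {G : ℝ → ℝ} (hG : ContDiff ℝ 1 G)
    (hG0 : ∀ t, 0 ≤ G t)
    (hcond : (∀ t, (p - 1 + lam) * G t ≤ deriv G t) ∨ (∀ t, deriv G t ≤ (p - 1 - lam) * G t))
    {η : Euc d → ℝ} (hη : ContDiff ℝ 1 η) (hη0 : ∀ x, 0 ≤ η x) (hc : HasCompactSupport η)
    (hs : tsupport η ⊆ Ω) :
    ∫ x, ‖gradient L x‖ ^ p * G (L x) * η x ^ p ≤
      caccConst p lam Lam * ∫ x, G (L x) * (η x ^ p + ‖gradient η x‖ ^ p) := by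
  have hp0 : 0 < p := by linarith
  have hLc := h.1.continuousOn.mono hs
  have hgL := (continuousOn_gradient hΩ h.1).mono hs
  have hgη := continuous_gradient hη
  have hK : IsCompact (tsupport η) := hc.isCompact
  have hGL : ContinuousOn (fun x => G (L x)) (tsupport η) := hG.continuous.comp_continuousOn hLc
  have hGdL : ContinuousOn (fun x => deriv G (L x)) (tsupport η) :=
    (hG.continuous_deriv le_rfl).comp_continuousOn hLc
  have hηp : Continuous (fun x => η x ^ p) :=
    hη.continuous.rpow_const fun _ => Or.inr hp0.le
  have hηp1 : Continuous (fun x => η x ^ (p - 1)) :=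
    hη.continuous.rpow_const fun _ => Or.inr (by linarith)
  have hgLp : ContinuousOn (fun x => ‖gradient L x‖ ^ p) (tsupport η) :=
    hgL.norm.rpow_const fun _ _ => Or.inr hp0.le
  have hη_out : ∀ x, x ∉ tsupport η → η x = 0 ∧ gradient η x = 0 := fun x hx =>
    ⟨image_eq_zero_of_notMem_tsupport hx, gradient_eq_zero_of_notMem_tsupport hx⟩
  have hX : Integrable (fun x => ‖gradient L x‖ ^ p * G (L x) * η x ^ p) :=
    integrable_of_continuousOn_of_eq_zero hK ((hgLp.mul hGL).mul hηp.continuousOn) fun x hx => by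
      rw [(hη_out x hx).1, Real.zero_rpow hp0.ne', mul_zero]
  have hY : Integrable (fun x => G (L x) * (η x ^ p + ‖gradient η x‖ ^ p)) :=
    integrable_of_continuousOn_of_eq_zero hK (hGL.mul (hηp.continuousOn.add
      (hgη.norm.continuousOn.rpow_const fun _ _ => Or.inr hp0.le))) fun x hx => by
      rw [(hη_out x hx).1, (hη_out x hx).2, norm_zero, Real.zero_rpow hp0.ne', add_zero, mul_zero]
  set ψ : Euc d → ℝ := fun x => G (L x) * η x ^ p with hψ
  have hGL1 : ContDiffOn ℝ 1 (fun x => G (L x)) Ω := hG.comp_contDiffOn h.1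
  have hψ1 : ContDiff ℝ 1 ψ := contDiff_mul_of_tsupport_subset hΩ hGL1
    (contDiff_rpow_of_nonneg hp hη) ((tsupport_rpow_subset hp η).trans hs)
  have hψs : tsupport ψ ⊆ tsupport η :=
    tsupport_mul_subset_right.trans (tsupport_rpow_subset hp η)
  have hψg : ∀ x ∈ Ω, gradient ψ x = (deriv G (L x) * η x ^ p) • gradient L x +
      (G (L x) * (p * η x ^ (p - 1))) • gradient η x := by
    intro x hx
    rw [(hasGradientAt_mul_real (hasGradientAt_comp_real
      ((hG.differentiable one_ne_zero).differentiableAt.hasDerivAt)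
      (h.1.hasGradientAt_of_isOpen hΩ hx)) (hasGradientAt_rpow hp hη x)).gradient, smul_smul,
      smul_smul, add_comm, mul_comm (η x ^ p)]
  have hweak := h.2 ψ hψ1 (hc.of_isClosed_subset (isClosed_tsupport _) hψs) (hψs.trans hs)
  set I : Euc d → ℝ := fun x => ⟪pFlux p (gradient L x), gradient ψ x⟫ +
      (V x - (p - 1) * ‖gradient L x‖ ^ p) * ψ x with hI
  have hIeq : ∀ x ∈ Ω, I x = (deriv G (L x) - (p - 1) * G (L x)) * ‖gradient L x‖ ^ p * η x ^ p +
      p * η x ^ (p - 1) * G (L x) * ⟪pFlux p (gradient L x), gradient η x⟫ +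
      V x * (G (L x) * η x ^ p) := by
    intro x hx
    have hψx : ψ x = G (L x) * η x ^ p := rfl
    change ⟪pFlux p (gradient L x), gradient ψ x⟫ +
      (V x - (p - 1) * ‖gradient L x‖ ^ p) * ψ x = _
    rw [hψg x hx, inner_add_right, real_inner_smul_right, real_inner_smul_right,
      inner_pFlux_self hp, hψx]
    ring
  have hVψ : Integrable (fun x => V x * ψ x) := by
    have hψi : Integrable ψ := hψ1.continuous.integrable_of_hasCompactSupport
      (hc.of_isClosed_subset (isClosed_tsupport _) hψs)
    refine Integrable.mono' (hψi.norm.const_mul Lam)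
      (hV.aestronglyMeasurable.mul hψ1.continuous.aestronglyMeasurable) ?_
    filter_upwards [(ae_restrict_iff' hΩ.measurableSet).1 hVb] with x hx
    by_cases hxΩ : x ∈ Ω
    · rw [norm_mul]
      gcongr
      exact hx hxΩ
    · have : ψ x = 0 := image_eq_zero_of_notMem_tsupport fun h => hxΩ (hs (hψs h))
      simp [this]
  have hIi : Integrable I := by
    have : I = fun x => (⟪pFlux p (gradient L x), gradient ψ x⟫ -
      ((p - 1) * ‖gradient L x‖ ^ p) * ψ x) + V x * ψ x := by
      ext x; rw [hI]; ring
    rw [this]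
    refine Integrable.add (integrable_of_continuousOn_of_eq_zero hK ?_ fun x hx => ?_) hVψ
    · exact (((continuous_pFlux hp).comp_continuousOn hgL).inner
        (continuous_gradient hψ1).continuousOn).sub
        ((continuousOn_const.mul hgLp).mul hψ1.continuous.continuousOn)
    · have hx' : x ∉ tsupport ψ := fun h => hx (hψs h)
      rw [gradient_eq_zero_of_notMem_tsupport hx', image_eq_zero_of_notMem_tsupport hx']
      simp
  obtain ⟨s, hs'⟩ : ∃ s : ℝ, (s = 1 ∧ ∀ t, (p - 1 + lam) * G t ≤ deriv G t) ∨
      (s = -1 ∧ ∀ t, deriv G t ≤ (p - 1 - lam) * G t) :=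
    hcond.elim (fun h => ⟨1, Or.inl ⟨rfl, h⟩⟩) fun h => ⟨-1, Or.inr ⟨rfl, h⟩⟩
  have hpt : ∀ᵐ x, lam / 2 * (‖gradient L x‖ ^ p * G (L x) * η x ^ p) -
      (p * (2 * p / lam) ^ (p - 1) + Lam) * (G (L x) * (η x ^ p + ‖gradient η x‖ ^ p)) ≤
      s * I x := by
    filter_upwards [(ae_restrict_iff' hΩ.measurableSet).1 hVb] with x hx
    by_cases hxΩ : x ∈ Ω
    · rw [hIeq x hxΩ]
      have hVx := abs_le.1 (hx hxΩ)
      have hg0 := hG0 (L x)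
      have he0 : 0 ≤ η x ^ p := Real.rpow_nonneg (hη0 x) _
      have he1 : 0 ≤ η x ^ (p - 1) := Real.rpow_nonneg (hη0 x) _
      have hl0 : 0 ≤ ‖gradient L x‖ ^ p := by positivity
      have hb0 : 0 ≤ ‖gradient η x‖ ^ p := by positivity
      have hA := abs_le.1 (abs_inner_pFlux_le hp (gradient L x) (gradient η x))
      have hY := young_absorb hp hlam (mul_nonneg (norm_nonneg (gradient L x)) (hη0 x))
        (norm_nonneg (gradient η x))
      rw [Real.mul_rpow (norm_nonneg _) (hη0 x), Real.mul_rpow (norm_nonneg _) (hη0 x)] at hY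
      have hY' := mul_le_mul_of_nonneg_left hY hg0
      have hC : 0 ≤ p * (2 * p / lam) ^ (p - 1) := by positivity
      have hm : 0 ≤ p * η x ^ (p - 1) * G (L x) := by positivity
      have hA1 := mul_le_mul_of_nonneg_left hA.1 hm
      have hA2 := mul_le_mul_of_nonneg_left hA.2 hm
      have hge : 0 ≤ G (L x) * η x ^ p := mul_nonneg hg0 he0
      have hV1 := mul_le_mul_of_nonneg_right hVx.1 hge
      have hV2 := mul_le_mul_of_nonneg_right hVx.2 hge
      have hLg : 0 ≤ Lam * (G (L x) * ‖gradient η x‖ ^ p) := by positivity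
      have hCg : 0 ≤ p * (2 * p / lam) ^ (p - 1) * (G (L x) * η x ^ p) := by positivity
      have hle : 0 ≤ ‖gradient L x‖ ^ p * η x ^ p := mul_nonneg hl0 he0
      rcases hs' with ⟨rfl, hif⟩ | ⟨rfl, hif⟩
      · have h1 := mul_le_mul_of_nonneg_right (hif (L x)) hle
        linarith
      · have h1 := mul_le_mul_of_nonneg_right (hif (L x)) hle
        linarith
    · have hx' : x ∉ tsupport η := fun h => hxΩ (hs h)
      have hx2 : x ∉ tsupport ψ := fun h => hx' (hψs h)
      rw [hI]
      simp only [(hη_out x hx').1, (hη_out x hx').2, gradient_eq_zero_of_notMem_tsupport hx2,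
        image_eq_zero_of_notMem_tsupport hx2]
      simp [Real.zero_rpow hp0.ne']
  have hmono : ∫ x, (lam / 2 * (‖gradient L x‖ ^ p * G (L x) * η x ^ p) -
      (p * (2 * p / lam) ^ (p - 1) + Lam) * (G (L x) * (η x ^ p + ‖gradient η x‖ ^ p))) ≤
      ∫ x, s * I x := integral_mono_ae ((hX.const_mul _).sub (hY.const_mul _)) (hIi.const_mul _) hpt
  rw [integral_const_mul, hweak, mul_zero, integral_sub (hX.const_mul _) (hY.const_mul _),
    integral_const_mul, integral_const_mul] at hmono
  rw [caccConst, mul_assoc, div_mul_eq_mul_div, le_div_iff₀ hlam]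
  linarith

end Caccioppoli

section Sobolev

variable {d : ℕ}

/-- The Sobolev exponent `d / (d - 1)`. -/
def sobExp (d : ℕ) : ℝ := (d : ℝ) / (d - 1)

theorem holderConjugate_sobExp (hd : 2 ≤ d) : Real.HolderConjugate (d : ℝ) (sobExp d) := by
  have h : (2 : ℝ) ≤ d := by exact_mod_cast hd
  rw [Real.holderConjugate_iff_eq_conjExponent (by linarith)]
  rfl

theorem one_lt_sobExp (hd : 2 ≤ d) : 1 < sobExp d := (holderConjugate_sobExp hd).symm.lt

theorem exists_sobolev_const (hd : 2 ≤ d) : ∃ S : ℝ, 0 ≤ S ∧ ∀ v : Euc d → ℝ, ContDiff ℝ 1 v →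
    HasCompactSupport v → (∀ x, 0 ≤ v x) →
    ∫ x, v x ^ sobExp d ≤ (S * ∫ x, ‖gradient v x‖) ^ sobExp d := by
  have hκ := one_lt_sobExp hd
  have hκ0 : 0 < sobExp d := by linarith
  set c := lintegralPowLePowLIntegralFDerivConst (volume : Measure (Euc d)) (sobExp d)
  refine ⟨(c : ℝ) ^ (sobExp d)⁻¹, by positivity, fun v hv hc hv0 => ?_⟩
  have h := lintegral_pow_le_pow_lintegral_fderiv (volume : Measure (Euc d)) hv hc
    (p := sobExp d) (by rw [finrank_euclideanSpace_fin]; exact holderConjugate_sobExp hd)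
  have hi : Integrable (fun x => fderiv ℝ v x) :=
    (hv.continuous_fderiv one_ne_zero).integrable_of_hasCompactSupport (hc.fderiv ℝ)
  have hg : 0 ≤ ∫ x, ‖gradient v x‖ := integral_nonneg fun _ => norm_nonneg _
  rw [Real.mul_rpow (by positivity) hg, ← Real.rpow_mul (by positivity), inv_mul_cancel₀ hκ0.ne',
    Real.rpow_one]
  have e1 : ∫ x, v x ^ sobExp d = (∫⁻ x, ‖v x‖ₑ ^ sobExp d).toReal := by
    rw [integral_eq_lintegral_of_nonneg_ae (Eventually.of_forall fun x =>
      Real.rpow_nonneg (hv0 x) _) (hv.continuous.rpow_const fun _ =>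
      Or.inr hκ0.le).aestronglyMeasurable]
    congr 1
    refine lintegral_congr fun x => ?_
    rw [Real.enorm_of_nonneg (hv0 x), ENNReal.ofReal_rpow_of_nonneg (hv0 x) hκ0.le]
  have e2 : ∫ x, ‖gradient v x‖ = (∫⁻ x, ‖fderiv ℝ v x‖ₑ).toReal := by
    rw [← integral_norm_eq_lintegral_enorm hi.aestronglyMeasurable]
    simp_rw [norm_gradient_eq_norm_fderiv]
  have hfin : (∫⁻ x, ‖fderiv ℝ v x‖ₑ) ≠ ⊤ := hi.2.ne
  rw [e1, e2, ENNReal.toReal_rpow, ← ENNReal.coe_toReal c, ← ENNReal.toReal_mul]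
  exact ENNReal.toReal_mono (ENNReal.mul_ne_top ENNReal.coe_ne_top
    (ENNReal.rpow_ne_top_of_nonneg hκ0.le hfin)) h

theorem exists_bound_deriv_smoothTransition :
    ∃ M : ℝ, 0 < M ∧ ∀ t, |deriv Real.smoothTransition t| ≤ M := by
  have hc : Continuous (deriv Real.smoothTransition) :=
    (Real.smoothTransition.contDiff (n := 1)).continuous_deriv le_rfl
  obtain ⟨M, hM⟩ := (isCompact_Icc (a := (0 : ℝ)) (b := 1)).exists_bound_of_continuousOn
    hc.continuousOn
  refine ⟨|M| + 1, by positivity, fun t => ?_⟩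
  by_cases ht : t ∈ Icc (0 : ℝ) 1
  · have := hM t ht
    rw [Real.norm_eq_abs] at this
    linarith [le_abs_self M]
  · have h0 : deriv Real.smoothTransition t = 0 := by
      rw [mem_Icc, not_and_or, not_le, not_le] at ht
      rcases ht with h | h
      · have : Real.smoothTransition =ᶠ[𝓝 t] fun _ => 0 := by
          filter_upwards [gt_mem_nhds h] with s hs
          exact Real.smoothTransition.zero_of_nonpos hs.le
        rw [this.deriv_eq, deriv_const]
      · have : Real.smoothTransition =ᶠ[𝓝 t] fun _ => 1 := by
          filter_upwards [lt_mem_nhds h] with s hs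
          exact Real.smoothTransition.one_of_one_le hs.le
        rw [this.deriv_eq, deriv_const]
    rw [h0, abs_zero]; positivity

theorem exists_cutoff : ∃ M : ℝ, 0 < M ∧ ∀ (d : ℕ) (r' r : ℝ), 0 < r' → r' < r →
    ∃ η : Euc d → ℝ, ContDiff ℝ 1 η ∧ (∀ x, 0 ≤ η x) ∧ (∀ x, η x ≤ 1) ∧
      (∀ x ∈ closedBall 0 r', η x = 1) ∧ tsupport η ⊆ closedBall 0 r ∧
      ∀ x, ‖gradient η x‖ ≤ M / (r - r') := by
  obtain ⟨M, hM0, hM⟩ := exists_bound_deriv_smoothTransition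
  refine ⟨2 * M, by positivity, fun d r' r hr' hr => ?_⟩
  have hq : 0 < r ^ 2 - r' ^ 2 := by nlinarith
  set q : Euc d → ℝ := fun x => (r ^ 2 - ‖x‖ ^ 2) / (r ^ 2 - r' ^ 2) with hqd
  have hqc : ContDiff ℝ 1 q := by
    have := contDiff_norm_sq ℝ (E := Euc d) (n := 1)
    exact (contDiff_const.sub this).div_const _
  have hts : tsupport (fun x => Real.smoothTransition (q x)) ⊆ closedBall 0 r := by
    refine closure_minimal (fun x hx => ?_) isClosed_closedBall
    by_contra h
    rw [mem_closedBall_zero_iff, not_le] at h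
    refine hx (Real.smoothTransition.zero_of_nonpos ?_)
    exact div_nonpos_of_nonpos_of_nonneg (by nlinarith) hq.le
  refine ⟨fun x => Real.smoothTransition (q x), Real.smoothTransition.contDiff.comp hqc,
    fun x => Real.smoothTransition.nonneg _, fun x => Real.smoothTransition.le_one _,
    fun x hx => ?_, hts, fun x => ?_⟩
  · refine Real.smoothTransition.one_of_one_le ?_
    rw [mem_closedBall_zero_iff] at hx
    rw [hqd, le_div_iff₀ hq]
    nlinarith [norm_nonneg x]
  · by_cases hx : x ∈ tsupport (fun x => Real.smoothTransition (q x))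
    · have hxr := mem_closedBall_zero_iff.1 (hts hx)
      have hg : HasGradientAt q ((-2 / (r ^ 2 - r' ^ 2)) • x) x := by
        rw [hasGradientAt_iff_hasFDerivAt]
        have h1 := ((hasStrictFDerivAt_norm_sq x).hasFDerivAt.const_sub (r ^ 2)).mul_const
          (r ^ 2 - r' ^ 2)⁻¹
        have e : InnerProductSpace.toDual ℝ (Euc d) ((-2 / (r ^ 2 - r' ^ 2)) • x) =
            (r ^ 2 - r' ^ 2)⁻¹ • -(2 • (innerSL ℝ) x) := by
          ext y
          simp
          ring
        rw [e]
        simpa only [hqd, div_eq_mul_inv] using h1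
      have hG := hasGradientAt_comp_real
        ((Real.smoothTransition.contDiff (n := 1)).differentiable one_ne_zero
          (q x)).hasDerivAt hg
      rw [hG.gradient, norm_smul, norm_smul, Real.norm_eq_abs, Real.norm_eq_abs, abs_div,
        abs_of_pos hq]
      calc |deriv Real.smoothTransition (q x)| * (|-2| / (r ^ 2 - r' ^ 2) * ‖x‖)
          ≤ M * (|-2| / (r ^ 2 - r' ^ 2) * r) := by gcongr; exact hM _
        _ ≤ 2 * M / (r - r') := by
          rw [show |(-2 : ℝ)| = 2 by norm_num, show r ^ 2 - r' ^ 2 = (r - r') * (r + r') by ring]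
          have : 0 < r - r' := by linarith
          have h0r : 0 < r := by linarith
          rw [div_mul_eq_mul_div, mul_div_assoc', div_le_div_iff₀ (by positivity) (by positivity)]
          have : 0 ≤ M * (r - r') * r' := by positivity
          nlinarith
    · rw [gradient_eq_zero_of_notMem_tsupport hx, norm_zero]
      have : 0 < r - r' := by linarith
      positivity

theorem exists_moser_step_const (hd : 2 ≤ d) {p lam Lam : ℝ} (hp : 1 < p) (hlam : 0 < lam)
    (hLam : 0 ≤ Lam) : ∃ C : ℝ, 0 < C ∧ ∀ (V L : Euc d → ℝ) (Ω : Set (Euc d)), IsOpen Ω →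
    closedBall 0 1 ⊆ Ω → LogSol p V Ω L → Measurable V →
    (∀ᵐ x ∂(volume.restrict Ω), |V x| ≤ Lam) → ∀ (G : ℝ → ℝ) (β : ℝ), ContDiff ℝ 1 G →
    (∀ t, 0 ≤ G t) → 1 ≤ β → (∀ t, |deriv G t| ≤ β * G t) →
    ((∀ t, (p - 1 + lam) * G t ≤ deriv G t) ∨ (∀ t, deriv G t ≤ (p - 1 - lam) * G t)) →
    ∀ r' r : ℝ, 0 < r' → r' < r → r ≤ 1 →
    ∫ x in closedBall 0 r', G (L x) ^ sobExp d ≤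
      (C * β * (r - r') ^ (-p) * ∫ x in closedBall 0 r, G (L x)) ^ sobExp d := by
  obtain ⟨S, hS, hSob⟩ := exists_sobolev_const hd
  obtain ⟨M, hM, hcut⟩ := exists_cutoff
  have hp0 : 0 < p := by linarith
  have hκ := one_lt_sobExp hd
  have hκ0 : 0 < sobExp d := by linarith
  have hcc : 0 ≤ caccConst p lam Lam := by unfold caccConst; positivity
  refine ⟨(S + 1) * ((1 + caccConst p lam Lam + p) * (1 + M ^ p)), by positivity, ?_⟩
  intro V L Ω hΩ hB h hV hVb G β hG hG0 hβ hGβ hcond r' r hr' hr hr1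
  obtain ⟨η, hη, hη0, hη1, hηe, hηs, hηg⟩ := hcut d r' r hr' hr
  have hc : HasCompactSupport η :=
    (isCompact_closedBall (0 : Euc d) r).of_isClosed_subset (isClosed_tsupport _) hηs
  have hsΩ : tsupport η ⊆ Ω := hηs.trans ((closedBall_subset_closedBall hr1).trans hB)
  have hcac := h.caccioppoli hp hlam hLam hΩ hV hVb hG hG0 hcond hη hη0 hc hsΩ
  have hK : IsCompact (tsupport η) := hc.isCompact
  have hLc := h.1.continuousOn.mono hsΩ
  have hgL := (continuousOn_gradient hΩ h.1).mono hsΩ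
  have hgη := continuous_gradient hη
  have hGL : ContinuousOn (fun x => G (L x)) (tsupport η) := hG.continuous.comp_continuousOn hLc
  have hηp : Continuous (fun x => η x ^ p) :=
    hη.continuous.rpow_const fun _ => Or.inr hp0.le
  have hgLp : ContinuousOn (fun x => ‖gradient L x‖ ^ p) (tsupport η) :=
    hgL.norm.rpow_const fun _ _ => Or.inr hp0.le
  have hη_out : ∀ x, x ∉ tsupport η → η x = 0 ∧ gradient η x = 0 := fun x hx =>
    ⟨image_eq_zero_of_notMem_tsupport hx, gradient_eq_zero_of_notMem_tsupport hx⟩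
  have hX : Integrable (fun x => ‖gradient L x‖ ^ p * G (L x) * η x ^ p) :=
    integrable_of_continuousOn_of_eq_zero hK ((hgLp.mul hGL).mul hηp.continuousOn) fun x hx => by
      rw [(hη_out x hx).1, Real.zero_rpow hp0.ne', mul_zero]
  have hY : Integrable (fun x => G (L x) * (η x ^ p + ‖gradient η x‖ ^ p)) :=
    integrable_of_continuousOn_of_eq_zero hK (hGL.mul (hηp.continuousOn.add
      (hgη.norm.continuousOn.rpow_const fun _ _ => Or.inr hp0.le))) fun x hx => by
      rw [(hη_out x hx).1, (hη_out x hx).2, norm_zero, Real.zero_rpow hp0.ne', add_zero, mul_zero]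
  set v : Euc d → ℝ := fun x => G (L x) * η x ^ p with hv
  have hv1 : ContDiff ℝ 1 v := contDiff_mul_of_tsupport_subset hΩ (hG.comp_contDiffOn h.1)
    (contDiff_rpow_of_nonneg hp hη) ((tsupport_rpow_subset hp η).trans hsΩ)
  have hvs : tsupport v ⊆ tsupport η :=
    tsupport_mul_subset_right.trans (tsupport_rpow_subset hp η)
  have hvc : HasCompactSupport v := hc.of_isClosed_subset (isClosed_tsupport _) hvs
  have hv0 : ∀ x, 0 ≤ v x := fun x => mul_nonneg (hG0 _) (Real.rpow_nonneg (hη0 x) _)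
  have hvg : ∀ x ∈ Ω, gradient v x = (deriv G (L x) * η x ^ p) • gradient L x +
      (G (L x) * (p * η x ^ (p - 1))) • gradient η x := by
    intro x hx
    rw [(hasGradientAt_mul_real (hasGradientAt_comp_real
      ((hG.differentiable one_ne_zero).differentiableAt.hasDerivAt)
      (h.1.hasGradientAt_of_isOpen hΩ hx)) (hasGradientAt_rpow hp hη x)).gradient, smul_smul,
      smul_smul, add_comm, mul_comm (η x ^ p)]
  have hpt : ∀ x, ‖gradient v x‖ ≤ β * (‖gradient L x‖ ^ p * G (L x) * η x ^ p) +
      β * (1 + p) * (G (L x) * (η x ^ p + ‖gradient η x‖ ^ p)) := by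
    intro x
    have hg0 := hG0 (L x)
    have he0 : 0 ≤ η x ^ p := Real.rpow_nonneg (hη0 x) _
    have hb0 : 0 ≤ ‖gradient η x‖ ^ p := by positivity
    by_cases hx : x ∈ tsupport η
    · rw [hvg x (hsΩ hx)]
      refine (norm_add_le _ _).trans ?_
      rw [norm_smul, norm_smul, Real.norm_eq_abs, Real.norm_eq_abs, abs_mul, abs_of_nonneg he0,
        abs_of_nonneg (mul_nonneg hg0 (mul_nonneg hp0.le (Real.rpow_nonneg (hη0 x) _)))]
      have h1 := le_one_add_rpow hp (norm_nonneg (gradient L x))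
      have h2 := rpow_sub_one_mul_le hp (hη0 x) (norm_nonneg (gradient η x))
      have h3 : |deriv G (L x)| * η x ^ p * ‖gradient L x‖ ≤
          β * G (L x) * η x ^ p * (1 + ‖gradient L x‖ ^ p) := by
        gcongr
        exact hGβ _
      have h4 := mul_le_mul_of_nonneg_left h2 (mul_nonneg hp0.le hg0)
      have h5 : p * G (L x) * (η x ^ p + ‖gradient η x‖ ^ p) ≤
          β * (p * G (L x) * (η x ^ p + ‖gradient η x‖ ^ p)) :=
        le_mul_of_one_le_left (by positivity) hβ
      have h6 : 0 ≤ β * G (L x) * ‖gradient η x‖ ^ p := by positivity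
      linarith
    · rw [gradient_eq_zero_of_notMem_tsupport fun h => hx (hvs h), norm_zero]
      positivity
  have hint : ∫ x, ‖gradient v x‖ ≤
      β * (1 + caccConst p lam Lam + p) * ∫ x, G (L x) * (η x ^ p + ‖gradient η x‖ ^ p) := by
    have hgi : Integrable (fun x => ‖gradient v x‖) :=
      integrable_of_continuousOn_of_eq_zero hvc.isCompact
        (continuous_gradient hv1).norm.continuousOn fun x hx => by
        rw [gradient_eq_zero_of_notMem_tsupport hx, norm_zero]
    have := integral_mono hgi ((hX.const_mul β).add (hY.const_mul (β * (1 + p)))) hpt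
    rw [integral_add' (hX.const_mul β) (hY.const_mul (β * (1 + p))), integral_const_mul,
      integral_const_mul] at this
    have h2 := mul_le_mul_of_nonneg_left hcac (by linarith : 0 ≤ β)
    linarith
  have hGi : IntegrableOn (fun x => G (L x)) (closedBall 0 r) :=
    (hG.continuous.comp_continuousOn (h.1.continuousOn.mono
      ((closedBall_subset_closedBall hr1).trans hB))).integrableOn_compact (isCompact_closedBall _ _)
  have hYb : ∫ x, G (L x) * (η x ^ p + ‖gradient η x‖ ^ p) ≤
      (1 + M ^ p) * (r - r') ^ (-p) * ∫ x in closedBall 0 r, G (L x) := by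
    have hrr : 0 < r - r' := by linarith
    rw [← integral_const_mul, ← integral_indicator isClosed_closedBall.measurableSet]
    refine integral_mono hY ((integrable_indicator_iff
      isClosed_closedBall.measurableSet).2 (Integrable.const_mul hGi _)) fun x => ?_
    by_cases hx : x ∈ closedBall (0 : Euc d) r
    · rw [indicator_of_mem hx, mul_comm]
      refine mul_le_mul_of_nonneg_right ?_ (hG0 _)
      have h1 : η x ^ p ≤ 1 := Real.rpow_le_one (hη0 x) (hη1 x) hp0.le
      have h2 : ‖gradient η x‖ ^ p ≤ M ^ p * (r - r') ^ (-p) := by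
        rw [Real.rpow_neg hrr.le, ← div_eq_mul_inv, ← Real.div_rpow hM.le hrr.le]
        exact Real.rpow_le_rpow (norm_nonneg _) (hηg x) hp0.le
      have h3 : 1 ≤ (r - r') ^ (-p) :=
        Real.one_le_rpow_of_pos_of_le_one_of_nonpos hrr (by linarith) (by linarith)
      linarith
    · rw [indicator_of_notMem hx, (hη_out x fun h => hx (hηs h)).1,
        (hη_out x fun h => hx (hηs h)).2, norm_zero, Real.zero_rpow hp0.ne', add_zero, mul_zero]
  have hGi0 : 0 ≤ ∫ x in closedBall 0 r, G (L x) := integral_nonneg fun _ => hG0 _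
  have hleft : ∫ x in closedBall 0 r', G (L x) ^ sobExp d ≤ ∫ x, v x ^ sobExp d := by
    rw [← integral_indicator isClosed_closedBall.measurableSet]
    have hvi : Integrable (fun x => v x ^ sobExp d) :=
      integrable_of_continuousOn_of_eq_zero hvc.isCompact
        (hv1.continuous.rpow_const fun _ => Or.inr hκ0.le).continuousOn fun x hx => by
        rw [image_eq_zero_of_notMem_tsupport hx, Real.zero_rpow hκ0.ne']
    refine integral_mono_of_nonneg (Eventually.of_forall fun x =>
      indicator_nonneg (fun y _ => Real.rpow_nonneg (hG0 _) _) x) hvi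
      (Eventually.of_forall fun x => ?_)
    by_cases hx : x ∈ closedBall (0 : Euc d) r'
    · simp only [indicator_of_mem hx, hv, hηe x hx, Real.one_rpow, mul_one, le_refl]
    · simp only [indicator_of_notMem hx]
      exact Real.rpow_nonneg (hv0 x) _
  refine hleft.trans ((hSob v hv1 hvc hv0).trans ?_)
  have hgn : 0 ≤ ∫ x, ‖gradient v x‖ := integral_nonneg fun _ => norm_nonneg _
  refine Real.rpow_le_rpow (mul_nonneg hS hgn) ?_ hκ0.le
  have hrr : 0 ≤ (r - r') ^ (-p) := Real.rpow_nonneg (by linarith) _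
  calc S * ∫ x, ‖gradient v x‖ ≤ (S + 1) * (β * (1 + caccConst p lam Lam + p) *
        ((1 + M ^ p) * (r - r') ^ (-p) * ∫ x in closedBall 0 r, G (L x))) := by
        gcongr
        · linarith
        · exact hint.trans (by gcongr)
    _ = _ := by ring

end Sobolev

section Moser

variable {d : ℕ}

theorem exists_moser_const (hd : 2 ≤ d) {p K : ℝ} (hp : 0 < p) (hK : 0 ≤ K) :
    ∃ A : ℝ, 0 < A ∧ ∀ Q : Euc d → ℝ, ContinuousOn Q (closedBall 0 1) → (∀ x, 0 ≤ Q x) →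
      (∀ (j : ℕ) (r' r : ℝ), 0 < r' → r' < r → r ≤ 1 →
        ∫ x in closedBall 0 r', Q x ^ (sobExp d ^ (j + 1)) ≤
          (K * sobExp d ^ j * (r - r') ^ (-p) *
            ∫ x in closedBall 0 r, Q x ^ (sobExp d ^ j)) ^ sobExp d) →
      ∀ x ∈ ball (0 : Euc d) (1 / 2), Q x ≤ A * ∫ x in closedBall 0 1, Q x := by
  set κ := sobExp d with hκd
  have hκ : 1 < κ := one_lt_sobExp hd
  have hκ0 : 0 < κ := by linarith
  set A := max K 2 * 4 ^ p * κ with hA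
  have hmax : 1 < max K 2 := lt_of_lt_of_le (by norm_num) (le_max_right _ _)
  have h4 : (1 : ℝ) < 4 ^ p := Real.one_lt_rpow (by norm_num) hp
  have hA1 : 1 < A := by
    have : 1 < max K 2 * 4 ^ p := one_lt_mul_of_lt_of_le hmax h4.le
    exact one_lt_mul_of_lt_of_le this hκ.le
  have hA0 : 0 < A := by linarith
  set s := κ / (κ - 1) with hs
  have hκ1 : 0 < κ - 1 := by linarith
  have hs0 : 0 < s := by positivity
  have hsκ : s * (κ - 1) = κ := by rw [hs]; field_simp
  set t := (κ + s) / (κ - 1) with ht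
  have htκ : t * (κ - 1) = κ + s := by rw [ht]; field_simp
  refine ⟨A ^ t, by positivity, fun Q hQ hQ0 hstep x₀ hx₀ => ?_⟩
  by_contra hcon
  rw [not_le] at hcon
  obtain ⟨m, hm1, hm2⟩ := exists_between hcon
  have hJ0 : 0 ≤ ∫ x in closedBall 0 1, Q x := integral_nonneg hQ0
  have hm0 : 0 < m := lt_of_le_of_lt (by positivity) hm1
  set r : ℕ → ℝ := fun j => 1 / 2 + (1 / 2) ^ (j + 1) with hr
  have hrd : ∀ j, r j - r (j + 1) = (1 / 2) ^ (j + 2) := fun j => by simp only [hr]; ring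
  have hr1 : ∀ j, r j ≤ 1 := fun j => by
    have : ((1 : ℝ) / 2) ^ (j + 1) ≤ (1 / 2) ^ 1 :=
      pow_le_pow_of_le_one (by norm_num) (by norm_num) (by omega)
    simp only [hr]; linarith
  have hrh : ∀ j, 1 / 2 < r j := fun j => by
    have : (0 : ℝ) < (1 / 2) ^ (j + 1) := by positivity
    simp only [hr]; linarith
  set J : ℕ → ℝ := fun j => ∫ x in closedBall 0 (r j), Q x ^ (κ ^ j) with hJ
  have hJn : ∀ j, 0 ≤ J j := fun j => integral_nonneg fun x => Real.rpow_nonneg (hQ0 x) _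
  have hfac : ∀ j : ℕ, K * κ ^ j * (r j - r (j + 1)) ^ (-p) ≤ A ^ (j + 1) := by
    intro j
    have e : (r j - r (j + 1)) ^ (-p) ≤ (4 ^ p) ^ (j + 1) := by
      rw [hrd, ← Real.rpow_natCast, ← Real.rpow_mul (by norm_num), one_div,
        Real.inv_rpow (by norm_num), ← Real.rpow_neg (by norm_num), ← Real.rpow_natCast (4 ^ p),
        ← Real.rpow_mul (by norm_num), show (4 : ℝ) = 2 ^ (2 : ℝ) by norm_num,
        ← Real.rpow_mul (by norm_num)]
      refine Real.rpow_le_rpow_of_exponent_le (by norm_num) ?_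
      push_cast
      nlinarith [(Nat.cast_nonneg j : (0 : ℝ) ≤ j)]
    have h1 : K ≤ max K 2 ^ (j + 1) :=
      (le_max_left K 2).trans (le_self_pow₀ hmax.le (by omega))
    have h2 : κ ^ j ≤ κ ^ (j + 1) := pow_le_pow_right₀ hκ.le (by omega)
    have h3 : 0 ≤ (r j - r (j + 1)) ^ (-p) := Real.rpow_nonneg (by rw [hrd]; positivity) _
    calc K * κ ^ j * (r j - r (j + 1)) ^ (-p)
        ≤ max K 2 ^ (j + 1) * κ ^ (j + 1) * (4 ^ p) ^ (j + 1) := by gcongr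
      _ = A ^ (j + 1) := by rw [hA]; ring
  have hJs : ∀ j, J (j + 1) ≤ (A ^ (j + 1) * J j) ^ κ := by
    intro j
    have := hstep j (r (j + 1)) (r j) (by linarith [hrh (j + 1)])
      (by have := hrd j; have h : (0 : ℝ) < (1 / 2) ^ (j + 2) := by positivity
          linarith) (hr1 j)
    refine this.trans ?_
    exact Real.rpow_le_rpow (mul_nonneg (mul_nonneg (by positivity)
      (Real.rpow_nonneg (by rw [hrd]; positivity) _)) (hJn j))
      (mul_le_mul_of_nonneg_right (hfac j) (hJn j)) hκ0.le
  have hclaim : ∀ j : ℕ, J j ≤ m ^ (κ ^ j) * A ^ (-(s * j) - t) := by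
    intro j
    induction j with
    | zero =>
      have e : J 0 = ∫ x in closedBall 0 1, Q x := by
        simp only [hJ, hr]; norm_num
      rw [e, pow_zero, Real.rpow_one, Nat.cast_zero, mul_zero, neg_zero, zero_sub,
        Real.rpow_neg hA0.le, ← div_eq_mul_inv, le_div_iff₀ (by positivity)]
      linarith
    | succ j ih =>
      refine (hJs j).trans ?_
      calc (A ^ (j + 1) * J j) ^ κ
          ≤ (A ^ (j + 1) * (m ^ (κ ^ j) * A ^ (-(s * j) - t))) ^ κ := by
            refine Real.rpow_le_rpow (mul_nonneg (by positivity) (hJn j)) (by gcongr) hκ0.le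
        _ = m ^ (κ ^ (j + 1)) * A ^ (((j + 1 : ℕ) + (-(s * j) - t)) * κ) := by
            rw [← Real.rpow_natCast A, mul_left_comm, ← Real.rpow_add hA0,
              Real.mul_rpow (by positivity) (by positivity), ← Real.rpow_mul hm0.le,
              ← Real.rpow_mul hA0.le, pow_succ]
        _ ≤ _ := by
            gcongr
            · exact hA1.le
            · push_cast
              have : ((j : ℝ) + 1 + (-(s * j) - t)) * κ =
                -(s * (j + 1)) - t + (j * (κ - s * (κ - 1)) + (κ + s - t * (κ - 1))) := by ring
              rw [this, hsκ, htκ]; linarith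
  set U := ball (0 : Euc d) (1 / 2) ∩ Q ⁻¹' Ioi m with hU
  have hUo : IsOpen U := (hQ.mono ((ball_subset_ball (by norm_num)).trans
    ball_subset_closedBall)).isOpen_inter_preimage isOpen_ball isOpen_Ioi
  have hUpos : 0 < volume U := hUo.measure_pos _ ⟨x₀, hx₀, hm2⟩
  have hUfin : volume U ≠ ⊤ :=
    ((measure_mono inter_subset_left).trans_lt measure_ball_lt_top).ne
  have hUr : 0 < volume.real U := ENNReal.toReal_pos hUpos.ne' hUfin
  have hlow : ∀ j : ℕ, m ^ (κ ^ j) * volume.real U ≤ J j := by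
    intro j
    have hsub : U ⊆ closedBall 0 (r j) := fun x hx =>
      ball_subset_closedBall (ball_subset_ball (hrh j).le hx.1)
    have hi : IntegrableOn (fun x => Q x ^ (κ ^ j)) (closedBall 0 (r j)) :=
      ((hQ.mono (closedBall_subset_closedBall (hr1 j))).rpow_const fun _ _ =>
        Or.inr (by positivity)).integrableOn_compact (isCompact_closedBall _ _)
    calc m ^ (κ ^ j) * volume.real U = ∫ x in U, m ^ (κ ^ j) := by
          rw [setIntegral_const, smul_eq_mul, mul_comm]
      _ ≤ ∫ x in U, Q x ^ (κ ^ j) :=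
          setIntegral_mono_on (integrableOn_const hUfin) (hi.mono_set hsub) hUo.measurableSet
            fun x hx => Real.rpow_le_rpow hm0.le hx.2.le (by positivity)
      _ ≤ J j := setIntegral_mono_set hi (Eventually.of_forall fun x =>
          Real.rpow_nonneg (hQ0 x) _) hsub.eventuallyLE
  have hle : ∀ j : ℕ, volume.real U ≤ A ^ (-t) * (A ^ (-s)) ^ j := by
    intro j
    have := (hlow j).trans (hclaim j)
    have h2 := le_of_mul_le_mul_left this (by positivity)
    refine h2.trans (le_of_eq ?_)
    rw [← Real.rpow_natCast, ← Real.rpow_mul hA0.le, ← Real.rpow_add hA0]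
    congr 1; ring
  have hlim : Tendsto (fun j : ℕ => A ^ (-t) * (A ^ (-s)) ^ j) atTop (𝓝 (A ^ (-t) * 0)) :=
    (tendsto_pow_atTop_nhds_zero_of_lt_one (by positivity)
      (Real.rpow_lt_one_of_one_lt_of_neg hA1 (by linarith))).const_mul _
  rw [mul_zero] at hlim
  exact absurd (ge_of_tendsto' hlim hle) (not_le.2 hUr)

end Moser

section Poincare

variable {d : ℕ}

theorem lintegral_smul_add_le (h : Euc d → ENNReal) (hh : Measurable h) (b : Euc d) {c : ℝ}
    (hc : 1 / 2 ≤ c) : ∫⁻ x, h (c • x + b) ≤ ENNReal.ofReal (2 ^ d) * ∫⁻ x, h x := by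
  have hc0 : 0 < c := by linarith
  have h1 : ∫⁻ x, h (c • x + b) = ∫⁻ y, h (y + b) ∂(Measure.map (c • ·) volume) :=
    (lintegral_map (f := fun y => h (y + b)) (hh.comp (measurable_add_const b))
      (measurable_const_smul c)).symm
  rw [h1, Measure.map_addHaar_smul _ hc0.ne', lintegral_smul_measure,
    lintegral_add_right_eq_self h b, smul_eq_mul, finrank_euclideanSpace_fin]
  gcongr
  rw [abs_of_pos (by positivity), inv_le_comm₀ (by positivity) (by positivity), ← inv_pow]
  gcongr
  linarith

theorem enorm_sub_le_lintegral {f : Euc d → ℝ} {Ω : Set (Euc d)} (hΩ : IsOpen Ω)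
    (hf : ContDiffOn ℝ 1 f Ω) {x y : Euc d} (hxy : segment ℝ x y ⊆ Ω) (hn : ‖y - x‖ ≤ 2) :
    ‖f y - f x‖ₑ ≤ 2 * ∫⁻ t in Ioc (0 : ℝ) 1, ‖gradient f (x + t • (y - x))‖ₑ := by
  have hmem : ∀ t ∈ Icc (0 : ℝ) 1, x + t • (y - x) ∈ Ω := fun t ht => hxy (by
    rw [segment_eq_image']; exact ⟨t, ht, rfl⟩)
  have hline : ∀ t : ℝ, HasDerivAt (fun t : ℝ => x + t • (y - x)) (y - x) t := fun t => by
    simpa using ((hasDerivAt_id t).smul_const (y - x)).const_add x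
  have hcont : ContinuousOn (fun t : ℝ => gradient f (x + t • (y - x))) (Icc 0 1) :=
    (continuousOn_gradient hΩ hf).comp (by fun_prop) hmem
  have hc2 : ContinuousOn (fun t : ℝ => ⟪gradient f (x + t • (y - x)), y - x⟫) (Icc 0 1) :=
    hcont.inner continuousOn_const
  have hFTC : ∫ t in (0 : ℝ)..1, ⟪gradient f (x + t • (y - x)), y - x⟫ = f y - f x := by
    rw [intervalIntegral.integral_eq_sub_of_hasDerivAt (f := fun t : ℝ => f (x + t • (y - x)))]
    · simp
    · intro t ht
      rw [uIcc_of_le zero_le_one] at ht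
      have := (hf.hasGradientAt_of_isOpen hΩ (hmem t ht)).hasFDerivAt
      have h2 : HasDerivAt (fun t : ℝ => f (x + t • (y - x)))
        (InnerProductSpace.toDual ℝ (Euc d) (gradient f (x + t • (y - x))) (y - x)) t :=
        this.comp_hasDerivAt t (hline t)
      simpa using h2
    · exact hc2.intervalIntegrable_of_Icc zero_le_one
  rw [← hFTC, intervalIntegral.integral_of_le zero_le_one, ← lintegral_const_mul' _ _ (by simp)]
  refine (enorm_integral_le_lintegral_enorm _).trans (lintegral_mono fun t => ?_)
  have h2 : 2 * ‖gradient f (x + t • (y - x))‖ₑ =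
      ENNReal.ofReal (2 * ‖gradient f (x + t • (y - x))‖) := by
    rw [ENNReal.ofReal_mul (by norm_num), ofReal_norm]; simp
  rw [h2, ← ofReal_norm]
  refine ENNReal.ofReal_le_ofReal ((norm_inner_le_norm _ _).trans ?_)
  rw [mul_comm]
  gcongr

theorem poincare_of_zero_set {f : Euc d → ℝ} {Ω : Set (Euc d)} (hΩ : IsOpen Ω)
    (hB : closedBall 0 1 ⊆ Ω) (hf : ContDiffOn ℝ 1 f Ω) {S : Set (Euc d)} (hS : S ⊆ closedBall 0 1)
    (hSm : MeasurableSet S) (h0 : ∀ x ∈ S, f x = 0) :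
    volume.real S * ∫ x in closedBall 0 1, |f x| ≤
      2 ^ (d + 1) * volume.real (closedBall (0 : Euc d) 1) *
        ∫ x in closedBall 0 1, ‖gradient f x‖ := by
  set B := closedBall (0 : Euc d) 1 with hBd
  have hBm : MeasurableSet B := isClosed_closedBall.measurableSet
  have hBc : IsCompact B := isCompact_closedBall _ _
  have hBf : volume B ≠ ⊤ := hBc.measure_lt_top.ne
  have hSf : volume S ≠ ⊤ := ((measure_mono hS).trans_lt hBc.measure_lt_top).ne
  have hgc : ContinuousOn (gradient f) B := (continuousOn_gradient hΩ hf).mono hB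
  set g : Euc d → ENNReal := B.indicator fun x => ‖gradient f x‖ₑ with hg
  have hgm : Measurable g := by
    have h1 : Measurable (B.indicator (gradient f)) := by
      classical
      rw [← piecewise_eq_indicator]
      exact hgc.measurable_piecewise continuousOn_const hBm
    have : g = fun x => ‖B.indicator (gradient f) x‖ₑ := by
      ext x
      by_cases hx : x ∈ B <;> simp [hg, hx]
    rw [this]
    exact h1.enorm
  have hpt : ∀ x ∈ B, ∀ y ∈ S, ‖f x‖ₑ ≤ 2 * ∫⁻ t in Ioc (0 : ℝ) 1, g (x + t • (y - x)) := by
    intro x hx y hy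
    have hseg : segment ℝ x y ⊆ B := (convex_closedBall _ _).segment_subset hx (hS hy)
    have hn : ‖y - x‖ ≤ 2 := by
      have h1 := mem_closedBall_zero_iff.1 hx
      have h2 := mem_closedBall_zero_iff.1 (hS hy)
      linarith [norm_sub_le y x]
    have := enorm_sub_le_lintegral hΩ hf (hseg.trans hB) hn
    rw [h0 y hy, zero_sub, enorm_neg] at this
    refine this.trans (le_of_eq ?_)
    congr 1
    refine setLIntegral_congr_fun measurableSet_Ioc fun t ht => ?_
    have hm : x + t • (y - x) ∈ B := hseg (by
      rw [segment_eq_image']; exact ⟨t, ⟨ht.1.le, ht.2⟩, rfl⟩)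
    simp [hg, hm]
  have hslice : ∀ t ∈ Ioc (0 : ℝ) 1, ∫⁻ x in B, ∫⁻ y in B, g (x + t • (y - x)) ≤
      ENNReal.ofReal (2 ^ d) * (∫⁻ x, g x) * volume B := by
    intro t ht
    have hconst : ∀ a : ENNReal, ∫⁻ _ in B, a = a * volume B := fun a => by
      rw [lintegral_const, Measure.restrict_apply_univ]
    rcases le_total (1 / 2) t with h | h
    · rw [← hconst]
      refine lintegral_mono fun x => (setLIntegral_le_lintegral _ _).trans ?_
      refine le_trans (le_of_eq ?_) (lintegral_smul_add_le g hgm ((1 - t) • x) h)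
      refine lintegral_congr fun y => congrArg g ?_
      module
    · rw [lintegral_lintegral_swap, ← hconst]
      · refine lintegral_mono fun y => (setLIntegral_le_lintegral _ _).trans ?_
        refine le_trans (le_of_eq ?_) (lintegral_smul_add_le g hgm (t • y)
          (by linarith : 1 / 2 ≤ 1 - t))
        refine lintegral_congr fun x => congrArg g ?_
        module
      · exact (hgm.comp (by fun_prop :
          Measurable fun z : Euc d × Euc d => z.1 + t • (z.2 - z.1))).aemeasurable
  have hmain : volume S * ∫⁻ x in B, ‖f x‖ₑ ≤
      2 * (ENNReal.ofReal (2 ^ d) * (∫⁻ x, g x) * volume B) := by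
    have hmeas3 : Measurable fun z : (Euc d × ℝ) × Euc d => g (z.1.1 + z.1.2 • (z.2 - z.1.1)) :=
      hgm.comp (by fun_prop)
    calc volume S * ∫⁻ x in B, ‖f x‖ₑ = ∫⁻ x in B, ∫⁻ _ in S, ‖f x‖ₑ := by
          rw [← lintegral_const_mul' _ _ hSf]
          refine lintegral_congr fun x => ?_
          rw [lintegral_const, Measure.restrict_apply_univ, mul_comm]
      _ ≤ ∫⁻ x in B, ∫⁻ y in S, 2 * ∫⁻ t in Ioc (0 : ℝ) 1, g (x + t • (y - x)) :=
          setLIntegral_mono' hBm fun x hx => setLIntegral_mono' hSm fun y hy => hpt x hx y hy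
      _ ≤ ∫⁻ x in B, ∫⁻ y in B, 2 * ∫⁻ t in Ioc (0 : ℝ) 1, g (x + t • (y - x)) :=
          lintegral_mono fun x => lintegral_mono_set hS
      _ = 2 * ∫⁻ x in B, ∫⁻ y in B, ∫⁻ t in Ioc (0 : ℝ) 1, g (x + t • (y - x)) := by
          rw [← lintegral_const_mul' _ _ (by simp)]
          refine lintegral_congr fun x => ?_
          rw [← lintegral_const_mul' _ _ (by simp)]
      _ = 2 * ∫⁻ x in B, ∫⁻ t in Ioc (0 : ℝ) 1, ∫⁻ y in B, g (x + t • (y - x)) := by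
          congr 1
          refine lintegral_congr fun x => ?_
          exact lintegral_lintegral_swap (hgm.comp (by fun_prop :
            Measurable fun z : Euc d × ℝ => x + z.2 • (z.1 - x))).aemeasurable
      _ = 2 * ∫⁻ t in Ioc (0 : ℝ) 1, ∫⁻ x in B, ∫⁻ y in B, g (x + t • (y - x)) := by
          congr 1
          exact lintegral_lintegral_swap (Measurable.lintegral_prod_right' (ν := volume.restrict B)
            hmeas3).aemeasurable
      _ ≤ 2 * ∫⁻ t in Ioc (0 : ℝ) 1, ENNReal.ofReal (2 ^ d) * (∫⁻ x, g x) * volume B := by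
          gcongr 2 * ?_
          exact setLIntegral_mono' measurableSet_Ioc hslice
      _ = _ := by
          rw [lintegral_const, Measure.restrict_apply_univ]
          simp
  have hgi : IntegrableOn (fun x => ‖gradient f x‖) B := hgc.norm.integrableOn_compact hBc
  have e1 : ∫ x in B, |f x| = (∫⁻ x in B, ‖f x‖ₑ).toReal := by
    rw [← integral_norm_eq_lintegral_enorm
      ((hf.continuousOn.mono hB).aestronglyMeasurable hBm)]
    rfl
  have e2 : ∫ x in B, ‖gradient f x‖ = (∫⁻ x, g x).toReal := by
    rw [integral_norm_eq_lintegral_enorm (hgc.aestronglyMeasurable hBm), hg,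
      lintegral_indicator hBm]
  have hfin : (∫⁻ x, g x) ≠ ⊤ := by
    rw [hg, lintegral_indicator hBm]
    have := hgi.2.ne
    simpa using this
  have := ENNReal.toReal_mono (by finiteness) hmain
  rw [ENNReal.toReal_mul, ENNReal.toReal_mul, ENNReal.toReal_mul, ENNReal.toReal_mul,
    ENNReal.toReal_ofReal (by positivity), ← e1, ← e2] at this
  rw [Measure.real, Measure.real, pow_succ]
  simp only [ENNReal.toReal_ofNat] at this
  linarith

end Poincare

section LocalBounds

variable {d : ℕ}

theorem hasDerivAt_max_sq (t : ℝ) : HasDerivAt (fun t : ℝ => max t 0 ^ 2) (2 * max t 0) t := by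
  rcases lt_trichotomy t 0 with h | rfl | h
  · rw [max_eq_right h.le, mul_zero]
    refine (hasDerivAt_const t (0 : ℝ)).congr_of_eventuallyEq ?_
    filter_upwards [gt_mem_nhds h] with s hs
    rw [max_eq_right hs.le]; norm_num
  · rw [max_self, mul_zero]
    have h2 : HasDerivAt (fun t : ℝ => t ^ 2) 0 0 := by simpa using hasDerivAt_pow 2 (0 : ℝ)
    rw [hasDerivAt_iff_isLittleO] at h2 ⊢
    refine (Asymptotics.IsBigO.of_bound 1 (Eventually.of_forall fun t => ?_)).trans_isLittleO h2
    simp only [max_self, smul_zero, sub_zero, ne_eq, OfNat.ofNat_ne_zero, not_false_eq_true,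
      zero_pow, one_mul, norm_pow, Real.norm_eq_abs]
    have : |max t 0| ≤ |t| := abs_max_le_max_abs_abs.trans (by simp)
    gcongr
  · rw [max_eq_left h.le]
    have h2 : HasDerivAt (fun t : ℝ => t ^ 2) (2 * t) t := by simpa using hasDerivAt_pow 2 t
    refine h2.congr_of_eventuallyEq ?_
    filter_upwards [lt_mem_nhds h] with s hs
    rw [max_eq_left hs.le]

/-- A `C¹` regularization of `t ↦ max 1 (k - t)`. -/
def dampFun (k t : ℝ) : ℝ := √(1 + max (k - t) 0 ^ 2)

theorem one_le_dampFun (k t : ℝ) : 1 ≤ dampFun k t := by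
  rw [dampFun, Real.one_le_sqrt]; nlinarith [sq_nonneg (max (k - t) 0)]

theorem sub_le_dampFun (k t : ℝ) : k - t ≤ dampFun k t := by
  refine (le_max_left _ 0).trans (Real.le_sqrt_of_sq_le ?_)
  linarith

theorem dampFun_of_le {k t : ℝ} (h : k ≤ t) : dampFun k t = 1 := by
  rw [dampFun, max_eq_right (by linarith)]; norm_num

theorem hasDerivAt_dampFun (k t : ℝ) :
    HasDerivAt (dampFun k) (-(max (k - t) 0 / dampFun k t)) t := by
  have h1 : HasDerivAt (fun t => 1 + max (k - t) 0 ^ 2) (2 * max (k - t) 0 * (-1)) t :=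
    ((hasDerivAt_max_sq (k - t)).comp t ((hasDerivAt_id t).const_sub k)).const_add 1
  have hp : 0 < 1 + max (k - t) 0 ^ 2 := by positivity
  have h2 := h1.sqrt hp.ne'
  have e : 2 * max (k - t) 0 * (-1) / (2 * √(1 + max (k - t) 0 ^ 2)) =
      -(max (k - t) 0 / dampFun k t) := by
    rw [dampFun]; field_simp
  rw [e] at h2
  exact h2

theorem continuous_dampFun (k : ℝ) : Continuous (dampFun k) := by
  unfold dampFun; fun_prop

theorem contDiff_dampFun (k : ℝ) : ContDiff ℝ 1 (dampFun k) := by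
  rw [contDiff_one_iff_deriv]
  refine ⟨fun t => (hasDerivAt_dampFun k t).differentiableAt, ?_⟩
  have : deriv (dampFun k) = fun t => -(max (k - t) 0 / dampFun k t) :=
    funext fun t => (hasDerivAt_dampFun k t).deriv
  rw [this]
  refine Continuous.neg (Continuous.div (by fun_prop) (continuous_dampFun k) fun t => ?_)
  linarith [one_le_dampFun k t]

theorem deriv_dampFun_nonpos (k t : ℝ) : deriv (dampFun k) t ≤ 0 := by
  rw [(hasDerivAt_dampFun k t).deriv]
  have := one_le_dampFun k t
  have : 0 ≤ max (k - t) 0 / dampFun k t := div_nonneg (le_max_right _ _) (by linarith)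
  linarith

theorem abs_deriv_dampFun_le (k t : ℝ) : |deriv (dampFun k) t| ≤ 1 := by
  have h1 := one_le_dampFun k t
  rw [(hasDerivAt_dampFun k t).deriv, abs_neg, abs_div, abs_of_nonneg (le_max_right _ _),
    abs_of_pos (by linarith), div_le_one (by linarith)]
  exact max_le (sub_le_dampFun k t) (by linarith)

/-- Local upper bound for `exp (p L)` by its mean. -/
theorem exists_sup_const (hd : 2 ≤ d) {p Lam : ℝ} (hp : 1 < p) (hLam : 0 ≤ Lam) :
    ∃ C : ℝ, 0 < C ∧ ∀ (V L : Euc d → ℝ) (Ω : Set (Euc d)), IsOpen Ω →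
    closedBall 0 1 ⊆ Ω → LogSol p V Ω L → Measurable V →
    (∀ᵐ x ∂(volume.restrict Ω), |V x| ≤ Lam) →
    ∀ x ∈ ball (0 : Euc d) (1 / 2),
      Real.exp (p * L x) ≤ C * ∫ x in closedBall 0 1, Real.exp (p * L x) := by
  obtain ⟨K, hK, hstep⟩ := exists_moser_step_const hd hp one_pos hLam
  have hp0 : 0 < p := by linarith
  have hκ := one_lt_sobExp hd
  have hκ0 : 0 < sobExp d := by linarith
  obtain ⟨A, hA, hmos⟩ := exists_moser_const hd hp0 (K := K * p) (by positivity)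
  refine ⟨A, hA, fun V L Ω hΩ hB h hV hVb => ?_⟩
  refine hmos (fun x => Real.exp (p * L x))
    (((h.1.continuousOn.mono hB).const_smul p).rexp) (fun x => (Real.exp_pos _).le) ?_
  intro j r' r hr' hr hr1
  have e1 : ∀ (a : ℝ) (x : Euc d), Real.exp (p * L x) ^ a = Real.exp (p * a * L x) := fun a x => by
    rw [← Real.exp_mul]; congr 1; ring
  have hκj : 1 ≤ sobExp d ^ j := one_le_pow₀ hκ.le
  have hpj : p ≤ p * sobExp d ^ j := le_mul_of_one_le_right hp0.le hκj
  have hder : ∀ t, deriv (fun t => Real.exp (p * sobExp d ^ j * t)) t =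
      p * sobExp d ^ j * Real.exp (p * sobExp d ^ j * t) := fun t => by
    have : HasDerivAt (fun t => Real.exp (p * sobExp d ^ j * t))
      (Real.exp (p * sobExp d ^ j * t) * (p * sobExp d ^ j * 1)) t :=
      ((hasDerivAt_id t).const_mul _).exp
    rw [this.deriv]; ring
  have := hstep V L Ω hΩ hB h hV hVb (fun t => Real.exp (p * sobExp d ^ j * t))
    (p * sobExp d ^ j) (by fun_prop) (fun t => (Real.exp_pos _).le) (by linarith)
    (fun t => by rw [hder, abs_of_nonneg (by positivity)])
    (Or.inl fun t => by
      rw [hder]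
      exact mul_le_mul_of_nonneg_right (by linarith) (Real.exp_pos _).le) r' r hr' hr hr1
  simp only [e1]
  convert this using 3
  · rw [← Real.exp_mul, pow_succ]; congr 1; ring
  · ring

theorem exists_integral_gradient_const {p Lam : ℝ} (d : ℕ) (hp : 1 < p) (hLam : 0 ≤ Lam) :
    ∃ C : ℝ, 0 < C ∧ ∀ (V L : Euc d → ℝ) (Ω : Set (Euc d)), IsOpen Ω →
    closedBall 0 2 ⊆ Ω → LogSol p V Ω L → Measurable V →
    (∀ᵐ x ∂(volume.restrict Ω), |V x| ≤ Lam) →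
    ∫ x in closedBall 0 1, ‖gradient L x‖ ≤ C := by
  obtain ⟨M, hM, hcut⟩ := exists_cutoff
  obtain ⟨η, hη, hη0, hη1, hηe, hηs, hηg⟩ := hcut d 1 2 one_pos one_lt_two
  have hp0 : 0 < p := by linarith
  have hc : HasCompactSupport η :=
    (isCompact_closedBall (0 : Euc d) 2).of_isClosed_subset (isClosed_tsupport _) hηs
  have hY0 : 0 ≤ ∫ x, (η x ^ p + ‖gradient η x‖ ^ p) := integral_nonneg fun x =>
    add_nonneg (Real.rpow_nonneg (hη0 x) _) (Real.rpow_nonneg (norm_nonneg _) _)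
  have hcc : 0 ≤ caccConst p (p - 1) Lam := by
    have : 0 < p - 1 := by linarith
    unfold caccConst; positivity
  refine ⟨volume.real (closedBall (0 : Euc d) 1) +
    caccConst p (p - 1) Lam * (∫ x, (η x ^ p + ‖gradient η x‖ ^ p)) + 1, by positivity, ?_⟩
  intro V L Ω hΩ hB h hV hVb
  have hsΩ : tsupport η ⊆ Ω := hηs.trans hB
  have hcac := h.caccioppoli hp (lam := p - 1) (by linarith) hLam hΩ hV hVb (G := fun _ => 1)
    contDiff_const (fun _ => zero_le_one) (Or.inr fun t => by simp) hη hη0 hc hsΩ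
  simp only [mul_one, one_mul] at hcac
  have hgL := (continuousOn_gradient hΩ h.1).mono hsΩ
  have hX : Integrable (fun x => ‖gradient L x‖ ^ p * η x ^ p) :=
    integrable_of_continuousOn_of_eq_zero hc.isCompact ((hgL.norm.rpow_const fun _ _ =>
      Or.inr hp0.le).mul (hη.continuous.rpow_const fun _ => Or.inr hp0.le).continuousOn)
      fun x hx => by
      rw [image_eq_zero_of_notMem_tsupport hx, Real.zero_rpow hp0.ne', mul_zero]
  have hB1 : closedBall (0 : Euc d) 1 ⊆ Ω := (closedBall_subset_closedBall one_le_two).trans hB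
  have hgi : IntegrableOn (fun x => ‖gradient L x‖) (closedBall 0 1) :=
    ((continuousOn_gradient hΩ h.1).mono hB1).norm.integrableOn_compact (isCompact_closedBall _ _)
  have hb1 : volume (closedBall (0 : Euc d) 1) ≠ ⊤ := measure_closedBall_lt_top.ne
  calc ∫ x in closedBall 0 1, ‖gradient L x‖
      ≤ ∫ x in closedBall 0 1, (1 + ‖gradient L x‖ ^ p * η x ^ p) := by
        refine setIntegral_mono_on hgi ((integrableOn_const hb1).add hX.integrableOn)
          isClosed_closedBall.measurableSet fun x hx => ?_
        rw [hηe x hx, Real.one_rpow, mul_one]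
        exact le_one_add_rpow hp (norm_nonneg _)
    _ = volume.real (closedBall (0 : Euc d) 1) +
        ∫ x in closedBall 0 1, ‖gradient L x‖ ^ p * η x ^ p := by
        rw [integral_add (f := fun _ => (1 : ℝ)) (integrableOn_const hb1) hX.integrableOn,
          setIntegral_const]
        simp
    _ ≤ _ := by
        have := setIntegral_le_integral (s := closedBall 0 1) hX (Eventually.of_forall fun x =>
          mul_nonneg (Real.rpow_nonneg (norm_nonneg _) _) (Real.rpow_nonneg (hη0 x) _))
        linarith

/-- If `L ≥ k` on a set of positive proportion, then `L` is not much smaller than `k`. -/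
theorem exists_inf_const (hd : 2 ≤ d) {p Lam ν : ℝ} (hp : 1 < p) (hLam : 0 ≤ Lam) (hν : 0 < ν) :
    ∃ c : ℝ, 0 < c ∧ ∀ (V L : Euc d → ℝ) (Ω : Set (Euc d)), IsOpen Ω →
    closedBall 0 2 ⊆ Ω → LogSol p V Ω L → Measurable V →
    (∀ᵐ x ∂(volume.restrict Ω), |V x| ≤ Lam) → ∀ k : ℝ,
    ν ≤ volume.real (closedBall 0 1 ∩ {x | k ≤ L x}) →
    ∀ x ∈ ball (0 : Euc d) (1 / 2), k - c ≤ L x := by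
  have hp1 : 0 < p - 1 := by linarith
  obtain ⟨K, hK, hstep⟩ := exists_moser_step_const hd hp hp1 hLam
  obtain ⟨D, hD, hgrad⟩ := exists_integral_gradient_const d hp hLam
  have hp0 : 0 < p := by linarith
  have hκ := one_lt_sobExp hd
  have hκ0 : 0 < sobExp d := by linarith
  obtain ⟨A, hA, hmos⟩ := exists_moser_const hd hp0 (K := K) hK.le
  set b := volume.real (closedBall (0 : Euc d) 1)
  have hb0 : 0 ≤ b := measureReal_nonneg
  refine ⟨A * (b + 2 ^ (d + 1) * b * D / ν) + 1, by positivity, ?_⟩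
  intro V L Ω hΩ hB h hV hVb k hk x hx
  have hB1 : closedBall (0 : Euc d) 1 ⊆ Ω := (closedBall_subset_closedBall one_le_two).trans hB
  have hLc := h.1.continuousOn.mono hB1
  have hW0 : ∀ x, 0 < dampFun k (L x) := fun x => by linarith [one_le_dampFun k (L x)]
  have hQc : ContinuousOn (fun x => dampFun k (L x)) (closedBall 0 1) :=
    (continuous_dampFun k).comp_continuousOn hLc
  have h1 := hmos (fun x => dampFun k (L x)) hQc (fun x => (hW0 x).le) (by
    intro j r' r hr' hr hr1
    have hκj : 1 ≤ sobExp d ^ j := one_le_pow₀ hκ.le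
    have hd0 : ∀ t, 0 < dampFun k t := fun t => by linarith [one_le_dampFun k t]
    have hder : ∀ t, deriv (fun t => dampFun k t ^ (sobExp d ^ j)) t =
        deriv (dampFun k) t * sobExp d ^ j * dampFun k t ^ (sobExp d ^ j - 1) := fun t =>
      (((contDiff_dampFun k).differentiable one_ne_zero t).hasDerivAt.rpow_const
        (Or.inl (hd0 t).ne')).deriv
    have := hstep V L Ω hΩ hB1 h hV hVb (fun t => dampFun k t ^ (sobExp d ^ j)) (sobExp d ^ j)
      ((contDiff_dampFun k).rpow_const_of_ne fun t => (hd0 t).ne')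
      (fun t => Real.rpow_nonneg (hd0 t).le _) hκj
      (fun t => by
        have h2 : 0 ≤ dampFun k t ^ (sobExp d ^ j - 1) := Real.rpow_nonneg (hd0 t).le _
        rw [hder, abs_mul, abs_mul, abs_of_nonneg h2,
          abs_of_nonneg (by positivity : 0 ≤ sobExp d ^ j)]
        have h3 : dampFun k t ^ (sobExp d ^ j - 1) ≤ dampFun k t ^ (sobExp d ^ j) :=
          Real.rpow_le_rpow_of_exponent_le (one_le_dampFun k t) (by linarith)
        calc |deriv (dampFun k) t| * sobExp d ^ j * dampFun k t ^ (sobExp d ^ j - 1)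
            ≤ 1 * sobExp d ^ j * dampFun k t ^ (sobExp d ^ j) := by
              gcongr
              exact abs_deriv_dampFun_le k t
          _ = _ := by ring)
      (Or.inr fun t => by
        rw [hder, sub_self, zero_mul]
        exact mul_nonpos_of_nonpos_of_nonneg (mul_nonpos_of_nonpos_of_nonneg
          (deriv_dampFun_nonpos k t) (by positivity)) (Real.rpow_nonneg (hd0 t).le _))
      r' r hr' hr hr1
    convert this using 3
    · rw [← Real.rpow_mul (hW0 _).le, pow_succ]) x hx
  have hS : MeasurableSet (closedBall (0 : Euc d) 1 ∩ {x | k ≤ L x}) := by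
    have : IsClosed (closedBall (0 : Euc d) 1 ∩ L ⁻¹' Ici k) :=
      hLc.preimage_isClosed_of_isClosed isClosed_closedBall isClosed_Ici
    exact this.measurableSet
  have hfc : ContDiffOn ℝ 1 (fun x => dampFun k (L x) - 1) Ω :=
    ((contDiff_dampFun k).comp_contDiffOn h.1).sub contDiffOn_const
  have hpo := poincare_of_zero_set hΩ hB1 hfc inter_subset_left hS fun x hx => by
    rw [dampFun_of_le hx.2, sub_self]
  have hg1 : ∫ x in closedBall 0 1, ‖gradient (fun x => dampFun k (L x) - 1) x‖ ≤ D := by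
    refine le_trans ?_ (hgrad V L Ω hΩ hB h hV hVb)
    refine setIntegral_mono_on
      (((continuousOn_gradient hΩ hfc).mono hB1).norm.integrableOn_compact
        (isCompact_closedBall _ _))
      (((continuousOn_gradient hΩ h.1).mono hB1).norm.integrableOn_compact
        (isCompact_closedBall _ _)) isClosed_closedBall.measurableSet fun x hx => ?_
    have := hasGradientAt_comp_real (G := fun t => dampFun k t - 1)
      ((((contDiff_dampFun k).differentiable one_ne_zero (L x)).hasDerivAt).sub_const 1)
      (h.1.hasGradientAt_of_isOpen hΩ (hB1 hx))
    rw [this.gradient, norm_smul, Real.norm_eq_abs]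
    exact mul_le_of_le_one_left (norm_nonneg _) (abs_deriv_dampFun_le k _)
  have hi1 : ∫ x in closedBall 0 1, |dampFun k (L x) - 1| ≤ 2 ^ (d + 1) * b * D / ν := by
    rw [le_div_iff₀ hν]
    have h3 : 0 ≤ ∫ x in closedBall 0 1, |dampFun k (L x) - 1| :=
      integral_nonneg fun _ => abs_nonneg _
    calc _ ≤ volume.real (closedBall 0 1 ∩ {x | k ≤ L x}) *
          ∫ x in closedBall 0 1, |dampFun k (L x) - 1| := by
          rw [mul_comm]; gcongr
      _ ≤ _ := hpo.trans (by gcongr)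
  have hi2 : ∫ x in closedBall 0 1, dampFun k (L x) ≤ b + 2 ^ (d + 1) * b * D / ν := by
    have hb1 : volume (closedBall (0 : Euc d) 1) ≠ ⊤ := measure_closedBall_lt_top.ne
    have hai : IntegrableOn (fun x => |dampFun k (L x) - 1|) (closedBall 0 1) :=
      (hQc.sub continuousOn_const).abs.integrableOn_compact (isCompact_closedBall _ _)
    have e : ∫ x in closedBall 0 1, dampFun k (L x) =
        ∫ x in closedBall 0 1, (1 + |dampFun k (L x) - 1|) := by
      congr 1; ext x
      rw [abs_of_nonneg (by linarith [one_le_dampFun k (L x)])]; ring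
    rw [e, integral_add (f := fun _ => (1 : ℝ)) (integrableOn_const hb1) hai, setIntegral_const, smul_eq_mul, mul_one]
    linarith
  have := sub_le_dampFun k (L x)
  have h5 := mul_le_mul_of_nonneg_left hi2 hA.le
  linarith

end LocalBounds

section Harnack

variable {d : ℕ}

/-- `L` solves the logarithmic equation in the open set `Ω` for some potential bounded by `Lam`. -/
def BddLogSol (p Lam : ℝ) (Ω : Set (Euc d)) (L : Euc d → ℝ) : Prop :=
  IsOpen Ω ∧ ∃ V : Euc d → ℝ, Measurable V ∧ LogSol p V Ω L ∧
    ∀ᵐ x ∂(volume.restrict Ω), |V x| ≤ Lam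

theorem quasiMeasurePreserving_affine (x₀ : Euc d) {ρ : ℝ} (hρ : 0 < ρ) :
    Measure.QuasiMeasurePreserving (fun x : Euc d => x₀ + ρ • x) volume volume := by
  have h1 : Measure.QuasiMeasurePreserving (fun x : Euc d => ρ • x) volume volume := by
    refine ⟨measurable_const_smul ρ, ?_⟩
    rw [Measure.map_addHaar_smul _ hρ.ne']
    exact Measure.smul_absolutelyContinuous
  exact (measurePreserving_add_left volume x₀).quasiMeasurePreserving.comp h1

theorem bddLogSol_comp_affine {p Lam : ℝ} {V L : Euc d → ℝ} {Ω : Set (Euc d)} (hΩ : IsOpen Ω)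
    (hV : Measurable V) (h : LogSol p V Ω L) (x₀ : Euc d) {ρ : ℝ} (hρ : 0 < ρ)
    (hb : ∀ᵐ x ∂(volume.restrict Ω), ρ ^ p * |V x| ≤ Lam) :
    BddLogSol p Lam ((fun x => x₀ + ρ • x) ⁻¹' Ω) (fun x => L (x₀ + ρ • x)) := by
  have hc : Continuous (fun x : Euc d => x₀ + ρ • x) := by fun_prop
  refine ⟨hΩ.preimage hc, _, ?_, h.comp_affine hΩ x₀ hρ, ?_⟩
  · exact (hV.comp hc.measurable).const_mul _
  · rw [ae_restrict_iff' hΩ.measurableSet] at hb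
    rw [ae_restrict_iff' (hΩ.preimage hc).measurableSet]
    filter_upwards [(quasiMeasurePreserving_affine x₀ hρ).ae hb] with x hx hxΩ
    rw [abs_mul, abs_of_nonneg (by positivity)]
    exact hx hxΩ

theorem BddLogSol.comp_affine {p Lam : ℝ} (hp : 1 < p) {L : Euc d → ℝ} {Ω : Set (Euc d)}
    (h : BddLogSol p Lam Ω L) (x₀ : Euc d) {ρ : ℝ} (hρ : 0 < ρ) (hρ1 : ρ ≤ 1) :
    BddLogSol p Lam ((fun x => x₀ + ρ • x) ⁻¹' Ω) (fun x => L (x₀ + ρ • x)) := by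
  obtain ⟨hΩ, V, hV, hL, hb⟩ := h
  refine bddLogSol_comp_affine hΩ hV hL x₀ hρ ?_
  filter_upwards [hb] with x hx
  have : ρ ^ p ≤ 1 := Real.rpow_le_one hρ.le hρ1 (by linarith)
  exact (mul_le_of_le_one_left (abs_nonneg _) this).trans hx

theorem closedBall_subset_preimage_affine {x₀ : Euc d} {ρ c : ℝ} (hρ : 0 < ρ) {Ω : Set (Euc d)}
    (h : closedBall x₀ (c * ρ) ⊆ Ω) : closedBall 0 c ⊆ (fun x => x₀ + ρ • x) ⁻¹' Ω := by
  intro x hx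
  refine h ?_
  rw [mem_closedBall_zero_iff] at hx
  rw [mem_closedBall_iff_norm, add_sub_cancel_left, norm_smul, Real.norm_of_nonneg hρ.le, mul_comm]
  gcongr

theorem exists_drop_const (hd : 2 ≤ d) {p Lam : ℝ} (hp : 1 < p) (hLam : 0 ≤ Lam) (τ : ℝ) :
    ∃ c : ℝ, 0 < c ∧ ∀ (L : Euc d → ℝ) (Ω : Set (Euc d)), BddLogSol p Lam Ω L →
    closedBall 0 2 ⊆ Ω → (∀ x ∈ closedBall 0 1, L x ≤ L 0 + τ) →
    ∀ x ∈ ball (0 : Euc d) (1 / 2), L 0 - c ≤ L x := by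
  obtain ⟨C, hC, hsup⟩ := exists_sup_const hd hp hLam
  have hp0 : 0 < p := by linarith
  set b := volume.real (closedBall (0 : Euc d) 1)
  have hb0 : 0 ≤ b := measureReal_nonneg
  set c₁ := Real.log (2 * (C * b + 1)) / p
  have hc₁ : Real.exp (p * -c₁) = (2 * (C * b + 1))⁻¹ := by
    have : p * -c₁ = -Real.log (2 * (C * b + 1)) := by simp only [c₁]; field_simp
    rw [this, Real.exp_neg, Real.exp_log (by positivity)]
  set ν := (2 * C * Real.exp (p * τ))⁻¹
  have hν : 0 < ν := by positivity
  obtain ⟨c, hc, hinf⟩ := exists_inf_const hd hp hLam hν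
  refine ⟨|c₁| + c, by positivity, fun L Ω ⟨hΩ, V, hV, h, hVb⟩ hB hτ x hx => ?_⟩
  have hB1 : closedBall (0 : Euc d) 1 ⊆ Ω := (closedBall_subset_closedBall one_le_two).trans hB
  have hLc := h.1.continuousOn.mono hB1
  set S := closedBall (0 : Euc d) 1 ∩ {x | L 0 - c₁ ≤ L x} with hSd
  have hS : MeasurableSet S := by
    have : IsClosed (closedBall (0 : Euc d) 1 ∩ L ⁻¹' Ici (L 0 - c₁)) :=
      hLc.preimage_isClosed_of_isClosed isClosed_closedBall isClosed_Ici
    exact this.measurableSet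
  have hSf : volume S ≠ ⊤ := ((measure_mono inter_subset_left).trans_lt
    measure_closedBall_lt_top).ne
  have hbf : volume (closedBall (0 : Euc d) 1) ≠ ⊤ := measure_closedBall_lt_top.ne
  have hk : ν ≤ volume.real S := by
    have h0 := hsup V L Ω hΩ hB1 h hV hVb 0 (mem_ball_self (by norm_num))
    have hE : Real.exp (p * (L 0 - c₁)) = Real.exp (p * L 0) * Real.exp (p * -c₁) := by
      rw [← Real.exp_add]; ring_nf
    have hE2 : Real.exp (p * (L 0 + τ)) = Real.exp (p * L 0) * Real.exp (p * τ) := by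
      rw [← Real.exp_add]; ring_nf
    have h1 : ∫ x in closedBall 0 1, Real.exp (p * L x) ≤ ∫ x in closedBall 0 1,
        (Real.exp (p * (L 0 - c₁)) + S.indicator (fun _ => Real.exp (p * (L 0 + τ))) x) := by
      refine setIntegral_mono_on ((hLc.const_smul p).rexp.integrableOn_compact
        (isCompact_closedBall _ _)) ((integrableOn_const hbf).add
        ((integrable_indicator_iff hS).2 (integrableOn_const hSf)).integrableOn)
        isClosed_closedBall.measurableSet fun y hy => ?_
      by_cases hyS : y ∈ S
      · rw [indicator_of_mem hyS]
        have : Real.exp (p * L y) ≤ Real.exp (p * (L 0 + τ)) :=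
          Real.exp_le_exp.2 (mul_le_mul_of_nonneg_left (hτ y hy) hp0.le)
        exact this.trans (le_add_of_nonneg_left (Real.exp_pos _).le)
      · rw [indicator_of_notMem hyS, add_zero]
        have : L y < L 0 - c₁ := by
          by_contra hcon
          exact hyS ⟨hy, not_lt.1 hcon⟩
        exact Real.exp_le_exp.2 (mul_le_mul_of_nonneg_left this.le hp0.le)
    rw [integral_add (f := fun _ => Real.exp (p * (L 0 - c₁))) (integrableOn_const hbf)
      ((integrable_indicator_iff hS).2 (integrableOn_const hSf)).integrableOn, setIntegral_const,
      setIntegral_indicator hS, setIntegral_const, inter_eq_right.2 inter_subset_left, smul_eq_mul,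
      smul_eq_mul, hE, hE2, hc₁] at h1
    have h2 := h0.trans (mul_le_mul_of_nonneg_left h1 hC.le)
    have hpos := Real.exp_pos (p * L 0)
    have h3 : 1 ≤ C * (b * (2 * (C * b + 1))⁻¹ + volume.real S * Real.exp (p * τ)) := by
      refine le_of_mul_le_mul_left ?_ hpos
      calc _ = Real.exp (p * L 0) := mul_one _
        _ ≤ _ := h2
        _ = _ := by ring
    have h4 : C * b * (2 * (C * b + 1))⁻¹ ≤ 1 / 2 := by
      rw [← div_eq_mul_inv, div_le_div_iff₀ (by positivity) (by norm_num)]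
      linarith
    rw [inv_le_iff_one_le_mul₀ (by positivity)]
    linarith
  have := hinf V L Ω hΩ hB h hV hVb (L 0 - c₁) hk x hx
  linarith [le_abs_self c₁]

theorem exists_expansion_const (hd : 2 ≤ d) {p Lam : ℝ} (hp : 1 < p) (hLam : 0 ≤ Lam) :
    ∃ c : ℝ, 0 < c ∧ ∀ (L : Euc d → ℝ) (Ω : Set (Euc d)), BddLogSol p Lam Ω L →
    ∀ (x₀ : Euc d) (s k : ℝ), 0 < s → s ≤ 1 / 8 → closedBall x₀ (16 * s) ⊆ Ω →
    (∀ x ∈ ball x₀ s, k ≤ L x) → ∀ x ∈ ball x₀ (4 * s), k - c ≤ L x := by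
  have hν : 0 < volume.real (ball (0 : Euc d) (1 / 8)) :=
    ENNReal.toReal_pos (measure_ball_pos _ _ (by norm_num)).ne' measure_ball_lt_top.ne
  obtain ⟨c, hc, hinf⟩ := exists_inf_const hd hp hLam hν
  refine ⟨c, hc, fun L Ω h x₀ s k hs hs1 hB hk x hx => ?_⟩
  have hρ : 0 < 8 * s := by linarith
  obtain ⟨hΩ', V', hV', h', hVb'⟩ := h.comp_affine hp x₀ hρ (by linarith)
  have hB' : closedBall (0 : Euc d) 2 ⊆ (fun x => x₀ + (8 * s) • x) ⁻¹' Ω :=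
    closedBall_subset_preimage_affine hρ (by convert hB using 2; ring)
  have := hinf V' _ _ hΩ' hB' h' hV' hVb' k (measureReal_mono (fun y hy => ?_)
    ((measure_mono inter_subset_left).trans_lt measure_closedBall_lt_top).ne)
    ((8 * s)⁻¹ • (x - x₀)) ?_
  · beta_reduce at this
    rwa [smul_smul, mul_inv_cancel₀ hρ.ne', one_smul, add_sub_cancel] at this
  · rw [mem_ball_zero_iff] at hy
    refine ⟨mem_closedBall_zero_iff.2 (by linarith), hk _ ?_⟩
    rw [mem_ball_iff_norm, add_sub_cancel_left, norm_smul, Real.norm_of_nonneg hρ.le]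
    nlinarith
  · rw [mem_ball_iff_norm] at hx
    rw [mem_ball_zero_iff, norm_smul, norm_inv, Real.norm_of_nonneg hρ.le, inv_mul_lt_iff₀ hρ]
    linarith

theorem exists_local_harnack_const (hd : 2 ≤ d) {p Lam : ℝ} (hp : 1 < p) (hLam : 0 ≤ Lam) :
    ∃ C : ℝ, 0 < C ∧ ∀ (L : Euc d → ℝ) (Ω : Set (Euc d)), BddLogSol p Lam Ω L →
    closedBall 0 3 ⊆ Ω → ∀ x ∈ ball (0 : Euc d) (1 / 16), L 0 ≤ L x + C := by
  obtain ⟨c₀, hc₀, hexp⟩ := exists_expansion_const hd hp hLam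
  have hlog4 : 0 < Real.log 4 := Real.log_pos (by norm_num)
  set γ := c₀ / Real.log 4 with hγ
  have hγ0 : 0 < γ := by positivity
  obtain ⟨c', hc', hdrop⟩ := exists_drop_const hd hp hLam (γ * Real.log 2)
  refine ⟨γ * Real.log 16 + c' + c₀, by positivity, fun L Ω h hB x hx => ?_⟩
  have hLc : ContinuousOn L (closedBall 0 3) := by
    obtain ⟨-, V, -, hL, -⟩ := h
    exact hL.1.continuousOn.mono hB
  have hsub : closedBall (0 : Euc d) (1 / 16) ⊆ closedBall 0 3 :=
    closedBall_subset_closedBall (by norm_num)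
  obtain ⟨x₀, hx₀, hmax⟩ := (isCompact_closedBall (0 : Euc d) (1 / 16)).exists_isMaxOn
    ⟨0, mem_closedBall_self (by norm_num)⟩
    (f := fun x => Real.exp (L x / γ) * (1 / 16 - ‖x‖))
    (((hLc.mono hsub).div_const γ).rexp.mul (by fun_prop))
  rw [mem_closedBall_zero_iff] at hx₀
  set δ := 1 / 16 - ‖x₀‖ with hδ
  have h0 : Real.exp (L 0 / γ) * (1 / 16) ≤ Real.exp (L x₀ / γ) * δ := by
    have := hmax (mem_closedBall_self (by norm_num))
    simp only [Set.mem_ofPred_eq, norm_zero, sub_zero] at this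
    exact this
  have hδ0 : 0 < δ := by
    have : 0 < Real.exp (L x₀ / γ) * δ := lt_of_lt_of_le (by positivity) h0
    exact pos_of_mul_pos_right this (Real.exp_pos _).le
  have hδ1 : δ ≤ 1 / 16 := by rw [hδ]; linarith [norm_nonneg x₀]
  have h0' : L 0 ≤ L x₀ + γ * (Real.log δ + Real.log 16) := by
    have h1 := Real.log_le_log (by positivity) h0
    rw [Real.log_mul (Real.exp_pos _).ne' (by norm_num), Real.log_mul (Real.exp_pos _).ne' hδ0.ne',
      Real.log_exp, Real.log_exp, one_div, Real.log_inv] at h1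
    have h2 : L 0 / γ ≤ L x₀ / γ + (Real.log δ + Real.log 16) := by linarith
    have h3 := mul_le_mul_of_nonneg_left h2 hγ0.le
    rw [mul_add, mul_div_cancel₀ _ hγ0.ne', mul_div_cancel₀ _ hγ0.ne'] at h3
    exact h3
  have hρ : 0 < δ / 2 := by positivity
  have h' := h.comp_affine hp x₀ hρ (by linarith)
  have hcb : closedBall x₀ (2 * (δ / 2)) ⊆ Ω := by
    refine Subset.trans ?_ hB
    refine closedBall_subset_closedBall' ?_
    rw [dist_zero_right]; linarith
  have hd1 := hdrop _ _ h' (closedBall_subset_preimage_affine hρ hcb) (fun y hy => by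
    rw [mem_closedBall_zero_iff] at hy
    simp only [smul_zero, add_zero]
    set z := x₀ + (δ / 2) • y
    have hzn : ‖z‖ ≤ ‖x₀‖ + δ / 2 := by
      refine (norm_add_le _ _).trans ?_
      rw [norm_smul, Real.norm_of_nonneg hρ.le]
      nlinarith
    have hz := hmax (mem_closedBall_zero_iff.2 (by linarith : ‖z‖ ≤ 1 / 16))
    simp only [Set.mem_ofPred_eq] at hz
    have h2 : Real.exp (L z / γ) * (δ / 2) ≤ Real.exp (L x₀ / γ) * δ :=
      (mul_le_mul_of_nonneg_left (by linarith) (Real.exp_pos _).le).trans hz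
    have h3 : Real.exp (L z / γ) ≤ Real.exp (L x₀ / γ) * 2 := by
      refine le_of_mul_le_mul_right ?_ hρ
      linarith
    have h4 := Real.log_le_log (Real.exp_pos _) h3
    rw [Real.log_mul (Real.exp_pos _).ne' (by norm_num), Real.log_exp, Real.log_exp] at h4
    have h5 := mul_le_mul_of_nonneg_left h4 hγ0.le
    rwa [mul_add, mul_div_cancel₀ _ hγ0.ne', mul_div_cancel₀ _ hγ0.ne'] at h5)
  simp only [smul_zero, add_zero] at hd1
  set s := δ / 4 with hs
  have hs0 : 0 < s := by positivity
  have hstart : ∀ y ∈ ball x₀ s, L x₀ - c' ≤ L y := by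
    intro y hy
    rw [mem_ball_iff_norm] at hy
    have := hd1 ((δ / 2)⁻¹ • (y - x₀)) (by
      rw [mem_ball_zero_iff, norm_smul, norm_inv, Real.norm_of_nonneg hρ.le, inv_mul_lt_iff₀ hρ]
      linarith)
    beta_reduce at this
    rwa [smul_smul, mul_inv_cancel₀ hρ.ne', one_smul, add_sub_cancel] at this
  have hiter : ∀ n : ℕ, (4 ^ n * s ≤ 1 / 2) →
      ∀ y ∈ ball x₀ (4 ^ n * s), L x₀ - c' - n * c₀ ≤ L y := by
    intro n
    induction n with
    | zero => intro _ y hy; simpa using hstart y (by simpa using hy)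
    | succ n ih =>
      intro hn y hy
      rw [pow_succ] at hn hy
      have h4 : 0 < 4 ^ n * s := by positivity
      have := hexp L Ω h x₀ (4 ^ n * s) (L x₀ - c' - n * c₀) h4 (by linarith)
        (Subset.trans (closedBall_subset_closedBall' (by rw [dist_zero_right]; linarith)) hB)
        (ih (by linarith)) y (by convert hy using 2; ring)
      push_cast; linarith
  obtain ⟨n, hn1, hn2⟩ := exists_nat_pow_near (x := 1 / (8 * s)) (y := (4 : ℝ))
    (by rw [le_div_iff₀ (by positivity)]; linarith) (by norm_num)
  rw [le_div_iff₀ (by positivity)] at hn1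
  rw [div_lt_iff₀ (by positivity)] at hn2
  have hx' : x ∈ ball x₀ (4 ^ (n + 1) * s) := by
    rw [mem_ball_zero_iff] at hx
    rw [mem_ball_iff_norm]
    have := norm_sub_le x x₀
    linarith
  have hfin := hiter (n + 1) (by rw [pow_succ]; linarith) x hx'
  have hnlog : n * c₀ ≤ -(γ * Real.log δ) := by
    have h1 := Real.log_le_log (by positivity) hn1
    rw [Real.log_one, show 4 ^ n * (8 * s) = 4 ^ n * (2 * δ) by rw [hs]; ring,
      Real.log_mul (by positivity) (by positivity), Real.log_mul (by norm_num) hδ0.ne',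
      Real.log_pow] at h1
    have h2 : c₀ = γ * Real.log 4 := by rw [hγ]; field_simp
    have h3 : 0 < Real.log 2 := Real.log_pos (by norm_num)
    have h4 : n * Real.log 4 ≤ - Real.log δ := by linarith
    have h5 := mul_le_mul_of_nonneg_left h4 hγ0.le
    rw [h2]; linarith
  push_cast at hfin
  linarith

end Harnack

section SphereHarnack

variable {d : ℕ}

theorem half_norm_le_norm_segment {x y : Euc d} {r t : ℝ} (hx : ‖x‖ = r) (hy : ‖y‖ = r)
    (hxy : 0 ≤ ⟪x, y⟫) (ht0 : 0 ≤ t) (ht1 : t ≤ 1) : r / 2 ≤ ‖x + t • (y - x)‖ := by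
  have hr : 0 ≤ r := hx ▸ norm_nonneg x
  have h : x + t • (y - x) = (1 - t) • x + t • y := by module
  rw [h]
  refine abs_le_of_sq_le_sq' ?_ (norm_nonneg _) |>.2
  rw [norm_add_sq_real, norm_smul, norm_smul, hx, hy, Real.norm_of_nonneg ht0,
    Real.norm_of_nonneg (by linarith : 0 ≤ 1 - t), real_inner_smul_left, real_inner_smul_right]
  have h1 : 0 ≤ (1 - t) * (t * ⟪x, y⟫) :=
    mul_nonneg (by linarith) (mul_nonneg ht0 hxy)
  nlinarith [mul_nonneg (sq_nonneg (1 - 2 * t)) (sq_nonneg r), sq_nonneg r]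

theorem exists_orthogonal_norm_eq (hd : 2 ≤ d) (x : Euc d) {r : ℝ} (hr : 0 ≤ r) :
    ∃ z : Euc d, ‖z‖ = r ∧ ⟪x, z⟫ = 0 := by
  have hne : (ℝ ∙ x)ᗮ ≠ ⊥ := by
    intro h
    have h1 := Submodule.finrank_add_finrank_orthogonal (ℝ ∙ x)
    rw [h, finrank_bot, finrank_euclideanSpace_fin] at h1
    have h2 := finrank_span_le_card (R := ℝ) ({x} : Set (Euc d))
    rw [Set.toFinset_card, Fintype.card_unique] at h2
    omega
  obtain ⟨z, hz, hz0⟩ := Submodule.exists_mem_ne_zero_of_ne_bot hne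
  refine ⟨(r * ‖z‖⁻¹) • z, ?_, ?_⟩
  · rw [norm_smul, norm_mul, norm_inv, norm_norm, Real.norm_of_nonneg hr, mul_assoc,
      inv_mul_cancel₀ (norm_ne_zero_iff.2 hz0), mul_one]
  · rw [real_inner_smul_right, Submodule.mem_orthogonal_singleton_iff_inner_right.1 hz, mul_zero]

/-- Harnack's inequality on spheres, in logarithmic form. -/
theorem exists_sphere_harnack_const (hd : 2 ≤ d) {p C₀ : ℝ} (hp : 1 < p) (hC₀ : 0 ≤ C₀) :
    ∃ K : ℝ, 0 < K ∧ ∀ (R : ℝ) (V L : Euc d → ℝ), Measurable V →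
    LogSol p V (ball 0 (2 * R) \ {0}) L →
    (∀ᵐ x ∂(volume.restrict (ball (0 : Euc d) (2 * R) \ {0})), ‖x‖ ^ p * |V x| ≤ C₀) →
    ∀ x y : Euc d, 0 < ‖x‖ → ‖x‖ ≤ R → ‖x‖ = ‖y‖ → L x ≤ L y + K := by
  obtain ⟨C, hC, hloc⟩ := exists_local_harnack_const hd hp hC₀
  refine ⟨2048 * C, by positivity, fun R V L hV hL hb => ?_⟩
  have hnear : ∀ x y : Euc d, 0 < ‖x‖ → ‖x‖ ≤ R → ‖y - x‖ < ‖x‖ / 128 → L x ≤ L y + C := by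
    intro x y hx hxR hxy
    have hlow : ∀ z ∈ ball x (7 / 16 * ‖x‖), ‖x‖ / 8 ≤ ‖z‖ := by
      intro z hz
      rw [mem_ball_iff_norm'] at hz
      have := norm_sub_norm_le x z
      linarith
    have hsub : ball x (7 / 16 * ‖x‖) ⊆ ball (0 : Euc d) (2 * R) \ {0} := by
      intro z hz
      have h1 := hlow z hz
      refine ⟨?_, ?_⟩
      · rw [mem_ball_iff_norm] at hz
        rw [mem_ball_zero_iff]
        have := norm_sub_norm_le z x
        linarith
      · rintro rfl
        rw [norm_zero] at h1
        linarith
    have hρ : 0 < ‖x‖ / 8 := by positivity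
    have hB := bddLogSol_comp_affine (Lam := C₀) isOpen_ball hV (hL.mono hsub) x hρ (by
      filter_upwards [ae_restrict_of_ae_restrict_of_subset hsub hb,
        ae_restrict_mem measurableSet_ball] with z hz hzb
      refine le_trans ?_ hz
      have h1 := Real.rpow_le_rpow hρ.le (hlow z hzb) (by linarith : 0 ≤ p)
      gcongr)
    have h := hloc _ _ hB (closedBall_subset_preimage_affine hρ
      (closedBall_subset_ball (by linarith))) ((‖x‖ / 8)⁻¹ • (y - x)) (by
        rw [mem_ball_zero_iff, norm_smul, norm_inv, Real.norm_of_nonneg hρ.le,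
          inv_mul_lt_iff₀ hρ]
        linarith)
    beta_reduce at h
    rwa [smul_smul, mul_inv_cancel₀ hρ.ne', one_smul, smul_zero, add_zero, add_sub_cancel] at h
  have hseg : ∀ x y : Euc d, 0 < ‖x‖ → ‖x‖ ≤ R → ‖x‖ = ‖y‖ → 0 ≤ ⟪x, y⟫ →
      L x ≤ L y + 1024 * C := by
    intro x y hx hxR hxy hin
    have hstep : ∀ n : ℕ, n ≤ 1024 → L x ≤ L (x + ((n : ℝ) / 1024) • (y - x)) + n * C := by
      intro n
      induction n with
      | zero => intro _; simp
      | succ n ih =>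
        intro hn
        have hn1 : (n : ℝ) + 1 ≤ 1024 := by exact_mod_cast hn
        have h0 : 0 ≤ (n : ℝ) / 1024 := by positivity
        have h1 : (n : ℝ) / 1024 ≤ 1 := by rw [div_le_one (by norm_num)]; linarith
        have hlo := half_norm_le_norm_segment rfl hxy.symm hin h0 h1
        have hup : ‖x + ((n : ℝ) / 1024) • (y - x)‖ ≤ ‖x‖ := by
          rw [show x + ((n : ℝ) / 1024) • (y - x) =
            (1 - (n : ℝ) / 1024) • x + ((n : ℝ) / 1024) • y by module]
          refine (norm_add_le _ _).trans ?_
          rw [norm_smul, norm_smul, ← hxy, Real.norm_of_nonneg h0,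
            Real.norm_of_nonneg (by linarith : 0 ≤ 1 - (n : ℝ) / 1024)]
          linarith
        have hn' := hnear (x + ((n : ℝ) / 1024) • (y - x))
          (x + (((n + 1 : ℕ) : ℝ) / 1024) • (y - x)) (by linarith) (by linarith) (by
          rw [show x + (((n + 1 : ℕ) : ℝ) / 1024) • (y - x) - (x + ((n : ℝ) / 1024) • (y - x)) =
            (1 / 1024 : ℝ) • (y - x) by push_cast; module, norm_smul]
          have := norm_sub_le y x
          norm_num
          linarith)
        have := ih (by omega)
        push_cast at hn' ⊢
        linarith
    have := hstep 1024 le_rfl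
    norm_num at this
    exact this
  intro x y hx hxR hxy
  obtain ⟨z, hz, hxz⟩ := exists_orthogonal_norm_eq hd x hx.le
  obtain ⟨z, hz, hxz, hzy⟩ : ∃ z : Euc d, ‖z‖ = ‖x‖ ∧ 0 ≤ ⟪x, z⟫ ∧ 0 ≤ ⟪z, y⟫ := by
    rcases le_total 0 ⟪z, y⟫ with h | h
    · exact ⟨z, hz, hxz.ge, h⟩
    · exact ⟨-z, by rwa [norm_neg], by rw [inner_neg_right, hxz, neg_zero],
        by rw [inner_neg_left]; linarith⟩
  have h1 := hseg x z hx hxR hz.symm hxz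
  have h2 := hseg z y (by linarith) (by linarith) (hz.trans hxy) hzy
  linarith

end SphereHarnack

section Comparison

variable {d : ℕ}

/-- A `C¹` approximation of the positive part. -/
def smoothPos (δ t : ℝ) : ℝ := √(max t 0 ^ 2 + δ ^ 2) - δ

/-- The derivative of `smoothPos δ`. -/
def smoothPosDeriv (δ t : ℝ) : ℝ := max t 0 / √(max t 0 ^ 2 + δ ^ 2)

theorem hasDerivAt_smoothPos {δ : ℝ} (hδ : 0 < δ) (t : ℝ) :
    HasDerivAt (smoothPos δ) (smoothPosDeriv δ t) t := by
  have h := (((hasDerivAt_max_sq t).add_const (δ ^ 2)).sqrt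
    (by positivity : max t 0 ^ 2 + δ ^ 2 ≠ 0)).sub_const δ
  rwa [mul_div_mul_left _ _ two_ne_zero] at h

theorem continuous_smoothPosDeriv {δ : ℝ} (hδ : 0 < δ) : Continuous (smoothPosDeriv δ) := by
  have : ∀ t : ℝ, √(max t 0 ^ 2 + δ ^ 2) ≠ 0 := fun t => (Real.sqrt_pos.2 (by positivity)).ne'
  unfold smoothPosDeriv
  fun_prop (disch := assumption)

theorem contDiff_smoothPos {δ : ℝ} (hδ : 0 < δ) : ContDiff ℝ 1 (smoothPos δ) := by
  refine contDiff_one_iff_deriv.2 ⟨fun t => (hasDerivAt_smoothPos hδ t).differentiableAt, ?_⟩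
  rw [show deriv (smoothPos δ) = smoothPosDeriv δ from
    funext fun t => (hasDerivAt_smoothPos hδ t).deriv]
  exact continuous_smoothPosDeriv hδ

theorem smoothPos_of_nonpos {δ t : ℝ} (hδ : 0 < δ) (ht : t ≤ 0) : smoothPos δ t = 0 := by
  rw [smoothPos, max_eq_right ht, zero_pow two_ne_zero, zero_add, Real.sqrt_sq hδ.le, sub_self]

theorem smoothPosDeriv_of_nonpos {δ t : ℝ} (ht : t ≤ 0) : smoothPosDeriv δ t = 0 := by
  rw [smoothPosDeriv, max_eq_right ht, zero_div]

theorem smoothPosDeriv_nonneg (δ t : ℝ) : 0 ≤ smoothPosDeriv δ t := by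
  unfold smoothPosDeriv; positivity

theorem smoothPosDeriv_pos {δ t : ℝ} (ht : 0 < t) : 0 < smoothPosDeriv δ t := by
  rw [smoothPosDeriv, max_eq_left ht.le]; positivity

theorem smoothPosDeriv_one_le {δ : ℝ} (hδ : 0 < δ) (hδ1 : δ ≤ 1) (t : ℝ) :
    smoothPosDeriv 1 t ≤ smoothPosDeriv δ t := by
  unfold smoothPosDeriv
  gcongr

theorem abs_smoothPosDeriv_mul_sub_le {δ : ℝ} (hδ : 0 < δ) (t : ℝ) :
    |smoothPosDeriv δ t * t - smoothPos δ t| ≤ δ := by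
  rcases le_or_gt t 0 with ht | ht
  · rw [smoothPosDeriv_of_nonpos ht, smoothPos_of_nonpos hδ ht]; simpa using hδ.le
  · rw [smoothPosDeriv, smoothPos, max_eq_left ht.le]
    have hS : 0 < √(t ^ 2 + δ ^ 2) := Real.sqrt_pos.2 (by positivity)
    have hS2 := Real.sq_sqrt (by positivity : 0 ≤ t ^ 2 + δ ^ 2)
    set S := √(t ^ 2 + δ ^ 2)
    have hSδ : δ ≤ S := by
      refine abs_le_of_sq_le_sq' ?_ hS.le |>.2
      nlinarith [sq_nonneg t]
    have e : t / S * t - (S - δ) = δ - δ * (δ / S) := by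
      field_simp
      nlinarith
    have h1 : δ / S ≤ 1 := (div_le_one hS).2 hSδ
    have h2 : 0 ≤ δ / S := by positivity
    rw [e, abs_le]
    constructor <;> nlinarith

/-- Picone's expression for the `p`-energy. -/
def piconeForm (p : ℝ) (a b : Euc d) : ℝ :=
  ‖a‖ ^ p - p * ⟪pFlux p b, a⟫ + (p - 1) * ‖b‖ ^ p

theorem continuousOn_piconeForm {p : ℝ} {f g : Euc d → Euc d} {s : Set (Euc d)} (hp : 1 < p)
    (hf : ContinuousOn f s) (hg : ContinuousOn g s) :
    ContinuousOn (fun x => piconeForm p (f x) (g x)) s := by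
  have h1 : ContinuousOn (fun x => ‖f x‖ ^ p) s :=
    hf.norm.rpow_const fun _ _ => Or.inr (by linarith)
  have h2 : ContinuousOn (fun x => ‖g x‖ ^ p) s :=
    hg.norm.rpow_const fun _ _ => Or.inr (by linarith)
  have h3 : ContinuousOn (fun x => ⟪pFlux p (g x), f x⟫) s :=
    ((continuous_pFlux hp).comp_continuousOn hg).inner hf
  unfold piconeForm
  fun_prop

theorem tangent_lt_rpow {p a b : ℝ} (hp : 1 < p) (ha : 0 ≤ a) (hb : 0 ≤ b) (hab : a ≠ b) :
    0 < a ^ p - p * (b ^ (p - 1) * a) + (p - 1) * b ^ p := by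
  rcases hb.eq_or_lt with rfl | hb
  · rw [Real.zero_rpow (by linarith), Real.zero_rpow (by linarith)]
    have := Real.rpow_pos_of_pos (lt_of_le_of_ne ha hab.symm) p
    linarith
  · have h := one_add_mul_self_lt_rpow_one_add (s := a / b - 1) (p := p)
      (by linarith [div_nonneg ha hb.le]) (by
        intro h
        exact hab ((div_eq_one_iff_eq hb.ne').1 (by linarith))) hp
    rw [add_sub_cancel, Real.div_rpow ha hb.le, lt_div_iff₀ (by positivity)] at h
    have e : b ^ p = b ^ (p - 1) * b := by
      rw [← Real.rpow_add_one hb.ne', sub_add_cancel]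
    have e2 : (1 + p * (a / b - 1)) * b ^ p = p * (b ^ (p - 1) * a) - (p - 1) * b ^ p := by
      rw [e]; field_simp; ring
    linarith

theorem tangent_le_rpow {p a b : ℝ} (hp : 1 < p) (ha : 0 ≤ a) (hb : 0 ≤ b) :
    0 ≤ a ^ p - p * (b ^ (p - 1) * a) + (p - 1) * b ^ p := by
  rcases eq_or_ne a b with rfl | hab
  · have e : a ^ p = a ^ (p - 1) * a := by
      rcases hb.eq_or_lt with rfl | h
      · rw [Real.zero_rpow (by linarith), mul_zero]
      · rw [← Real.rpow_add_one h.ne', sub_add_cancel]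
    rw [← e]
    linarith
  · exact (tangent_lt_rpow hp ha hb hab).le

theorem piconeForm_nonneg {p : ℝ} (hp : 1 < p) (a b : Euc d) : 0 ≤ piconeForm p a b := by
  have h1 := tangent_le_rpow hp (norm_nonneg a) (norm_nonneg b)
  have h2 := (le_abs_self _).trans (abs_inner_pFlux_le hp b a)
  rw [piconeForm]
  nlinarith

theorem eq_of_piconeForm_eq_zero {p : ℝ} (hp : 1 < p) {a b : Euc d} (h : piconeForm p a b = 0) :
    a = b := by
  have h2 := (le_abs_self _).trans (abs_inner_pFlux_le hp b a)
  rw [piconeForm] at h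
  have hn : ‖a‖ = ‖b‖ := by
    by_contra hne
    have h1 := tangent_lt_rpow hp (norm_nonneg a) (norm_nonneg b) hne
    nlinarith
  rcases eq_or_ne b 0 with rfl | hb
  · rwa [norm_zero, norm_eq_zero] at hn
  · have hb0 : 0 < ‖b‖ := norm_pos_iff.2 hb
    have e : ‖b‖ ^ p = ‖b‖ ^ (p - 2) * ‖b‖ ^ 2 := by
      rw [← Real.rpow_natCast, ← Real.rpow_add hb0]; norm_num
    rw [hn, inner_pFlux, e] at h
    have h3 : p * ‖b‖ ^ (p - 2) * (‖b‖ ^ 2 - ⟪b, a⟫) = 0 := by linarith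
    have h4 : ‖b‖ ^ 2 - ⟪b, a⟫ = 0 := by
      rcases mul_eq_zero.1 h3 with h5 | h5
      · exact absurd h5 (by positivity)
      · exact h5
    rw [← sub_eq_zero, ← norm_eq_zero, ← sq_eq_zero_iff, norm_sub_sq_real, real_inner_comm, hn]
    linarith

theorem contDiff_indicator_of_eq_zero {f : Euc d → ℝ} {Ω K : Set (Euc d)} (hΩ : IsOpen Ω)
    (hK : IsCompact K) (hKΩ : K ⊆ Ω) (hf : ContDiffOn ℝ 1 f Ω) (h0 : ∀ x ∈ Ω \ K, f x = 0) :
    ContDiff ℝ 1 (Ω.indicator f) ∧ tsupport (Ω.indicator f) ⊆ K := by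
  have hz : ∀ x, x ∉ K → Ω.indicator f x = 0 := fun x hx => by
    by_cases h : x ∈ Ω
    · rw [indicator_of_mem h, h0 x ⟨h, hx⟩]
    · exact indicator_of_notMem h _
  refine ⟨contDiff_iff_contDiffAt.2 fun x => ?_, closure_minimal (fun x hx => ?_) hK.isClosed⟩
  · by_cases h : x ∈ Ω
    · refine (hf.contDiffAt (hΩ.mem_nhds h)).congr_of_eventuallyEq ?_
      filter_upwards [hΩ.mem_nhds h] with y hy
      exact indicator_of_mem hy _
    · refine (contDiffAt_const (c := (0 : ℝ))).congr_of_eventuallyEq ?_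
      filter_upwards [hK.isClosed.isOpen_compl.mem_nhds (fun hx => h (hKΩ hx))] with y hy
      exact hz y hy
  · by_contra h
    exact hx (hz x h)

/-- The difference `u ^ p - v ^ p` in terms of `w = log u` and `g = log v`. -/
def expGap (p : ℝ) (w g : Euc d → ℝ) (x : Euc d) : ℝ := Real.exp (p * w x) - Real.exp (p * g x)

/-- The integrand in the Díaz–Saa inequality. -/
def diazSaaForm (p : ℝ) (w g : Euc d → ℝ) (x : Euc d) : ℝ :=
  Real.exp (p * w x) * piconeForm p (gradient w x) (gradient g x) +
    Real.exp (p * g x) * piconeForm p (gradient g x) (gradient w x)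

theorem expGap_nonpos {p : ℝ} (hp : 0 < p) {w g : Euc d → ℝ} {x : Euc d} (h : w x ≤ g x) :
    expGap p w g x ≤ 0 :=
  sub_nonpos.2 (Real.exp_le_exp.2 (mul_le_mul_of_nonneg_left h hp.le))

theorem expGap_pos {p : ℝ} (hp : 0 < p) {w g : Euc d → ℝ} {x : Euc d} (h : g x < w x) :
    0 < expGap p w g x :=
  sub_pos.2 (Real.exp_lt_exp.2 (mul_lt_mul_of_pos_left h hp))

theorem diazSaaForm_nonneg {p : ℝ} (hp : 1 < p) (w g : Euc d → ℝ) (x : Euc d) :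
    0 ≤ diazSaaForm p w g x := by
  have h1 := piconeForm_nonneg hp (gradient w x) (gradient g x)
  have h2 := piconeForm_nonneg hp (gradient g x) (gradient w x)
  unfold diazSaaForm
  positivity

theorem gradient_eq_of_diazSaaForm_eq_zero {p : ℝ} (hp : 1 < p) {w g : Euc d → ℝ} {x : Euc d}
    (h : diazSaaForm p w g x = 0) : gradient w x = gradient g x := by
  have h1 := mul_nonneg (Real.exp_pos (p * w x)).le
    (piconeForm_nonneg hp (gradient w x) (gradient g x))
  have h2 := mul_nonneg (Real.exp_pos (p * g x)).le
    (piconeForm_nonneg hp (gradient g x) (gradient w x))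
  rw [diazSaaForm] at h
  have h3 : Real.exp (p * w x) * piconeForm p (gradient w x) (gradient g x) = 0 := by linarith
  exact eq_of_piconeForm_eq_zero hp ((mul_eq_zero.1 h3).resolve_left (Real.exp_pos _).ne')

theorem continuousOn_diazSaaForm {p : ℝ} (hp : 1 < p) {w g : Euc d → ℝ} {Ω : Set (Euc d)}
    (hΩ : IsOpen Ω) (hw : ContDiffOn ℝ 1 w Ω) (hg : ContDiffOn ℝ 1 g Ω) :
    ContinuousOn (diazSaaForm p w g) Ω := by
  have hwg := continuousOn_gradient hΩ hw
  have hgg := continuousOn_gradient hΩ hg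
  have h1 : ContinuousOn (fun x => Real.exp (p * w x)) Ω :=
    (continuousOn_const.mul hw.continuousOn).rexp
  have h2 : ContinuousOn (fun x => Real.exp (p * g x)) Ω :=
    (continuousOn_const.mul hg.continuousOn).rexp
  have h3 := continuousOn_piconeForm hp hwg hgg
  have h4 := continuousOn_piconeForm hp hgg hwg
  exact (h1.mul h3).add (h2.mul h4)

theorem contDiffOn_expGap (p : ℝ) {w g : Euc d → ℝ} {Ω : Set (Euc d)}
    (hw : ContDiffOn ℝ 1 w Ω) (hg : ContDiffOn ℝ 1 g Ω) : ContDiffOn ℝ 1 (expGap p w g) Ω :=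
  ((contDiffOn_const.mul hw).exp).sub ((contDiffOn_const.mul hg).exp)

theorem hasGradientAt_expGap (p : ℝ) {w g : Euc d → ℝ} {w' g' x : Euc d}
    (hw : HasGradientAt w w' x) (hg : HasGradientAt g g' x) :
    HasGradientAt (expGap p w g)
      ((Real.exp (p * w x) * p) • w' - (Real.exp (p * g x) * p) • g') x := by
  have hE : ∀ t : ℝ, HasDerivAt (fun t => Real.exp (p * t)) (Real.exp (p * t) * p) t := fun t => by
    simpa using ((hasDerivAt_id t).const_mul p).exp
  exact hasGradientAt_sub_real
    (hasGradientAt_comp_real (G := fun t => Real.exp (p * t)) (hE _) hw)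
    (hasGradientAt_comp_real (G := fun t => Real.exp (p * t)) (hE _) hg)

theorem LogSol.setIntegral_eq_zero {p : ℝ} {V L ψ : Euc d → ℝ} {Ω K : Set (Euc d)}
    (hL : LogSol p V Ω L) (hK : IsCompact K) (hKΩ : K ⊆ Ω) (hψ : ContDiff ℝ 1 ψ)
    (hψs : tsupport ψ ⊆ K) : ∫ x in K,
      (⟪pFlux p (gradient L x), gradient ψ x⟫ + (V x - (p - 1) * ‖gradient L x‖ ^ p) * ψ x) = 0 := by
  rw [setIntegral_eq_integral_of_forall_compl_eq_zero, hL.2 ψ hψ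
    (hK.of_isClosed_subset (isClosed_tsupport _) hψs) (hψs.trans hKΩ)]
  intro x hx
  have hx' : x ∉ tsupport ψ := fun h => hx (hψs h)
  rw [gradient_eq_zero_of_notMem_tsupport hx', image_eq_zero_of_notMem_tsupport hx']
  simp

theorem integrableOn_logSol_integrand {p : ℝ} (hp : 1 < p) {V L ψ : Euc d → ℝ}
    {Ω K : Set (Euc d)} (hΩ : IsOpen Ω) (hV : Measurable V) (hVb : BddOnCompacts V Ω)
    (hL : ContDiffOn ℝ 1 L Ω) (hK : IsCompact K) (hKΩ : K ⊆ Ω) (hψ : ContDiff ℝ 1 ψ) :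
    IntegrableOn (fun x => ⟪pFlux p (gradient L x), gradient ψ x⟫ +
      (V x - (p - 1) * ‖gradient L x‖ ^ p) * ψ x) K := by
  have hLg := (continuousOn_gradient hΩ hL).mono hKΩ
  have h1 : ContinuousOn (fun x => ⟪pFlux p (gradient L x), gradient ψ x⟫) K :=
    ((continuous_pFlux hp).comp_continuousOn hLg).inner (continuous_gradient hψ).continuousOn
  have h2 : ContinuousOn (fun x => (p - 1) * ‖gradient L x‖ ^ p * ψ x) K :=
    (continuousOn_const.mul (hLg.norm.rpow_const fun _ _ => Or.inr (by linarith))).mul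
      hψ.continuous.continuousOn
  refine ((h1.integrableOn_compact hK).add ((integrableOn_mul_of_bdd hV hK (hVb K hK hKΩ)
    hψ.continuous.continuousOn).sub (h2.integrableOn_compact hK))).congr_fun ?_ hK.measurableSet
  intro x _
  simp only [Pi.add_apply, Pi.sub_apply]
  ring

theorem LogSol.integral_diazSaaForm_le {p : ℝ} (hp : 1 < p) {V w g : Euc d → ℝ}
    {Ω K : Set (Euc d)} (hΩ : IsOpen Ω) (hV : Measurable V) (hVb : BddOnCompacts V Ω)
    (hw : LogSol p V Ω w) (hg : LogSol p V Ω g) (hK : IsCompact K) (hKΩ : K ⊆ Ω)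
    (hle : ∀ x ∈ Ω \ K, w x ≤ g x) {δ : ℝ} (hδ : 0 < δ) :
    ∫ x in K, smoothPosDeriv δ (expGap p w g x) * diazSaaForm p w g x ≤
      δ * ∫ x in K, (p - 1) * |‖gradient w x‖ ^ p - ‖gradient g x‖ ^ p| := by
  have hp0 : 0 < p := by linarith
  have hwg := continuousOn_gradient hΩ hw.1
  have hgg := continuousOn_gradient hΩ hg.1
  have hDc := contDiffOn_expGap p hw.1 hg.1
  have hQc : ContinuousOn (fun x => ‖gradient w x‖ ^ p - ‖gradient g x‖ ^ p) Ω :=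
    (hwg.norm.rpow_const fun _ _ => Or.inr hp0.le).sub
      (hgg.norm.rpow_const fun _ _ => Or.inr hp0.le)
  have hCi : IntegrableOn (fun x => (p - 1) * |‖gradient w x‖ ^ p - ‖gradient g x‖ ^ p|) K :=
    (((hQc.mono hKΩ).abs).integrableOn_compact hK).const_mul _
  obtain ⟨hψ, hψs⟩ := contDiff_indicator_of_eq_zero hΩ hK hKΩ
    ((contDiff_smoothPos hδ).comp_contDiffOn hDc) (fun x hx =>
      smoothPos_of_nonpos hδ (expGap_nonpos hp0 (hle x hx)))
  have hψK : ∀ x ∈ K, Ω.indicator (smoothPos δ ∘ expGap p w g) x = smoothPos δ (expGap p w g x) :=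
    fun x hx => indicator_of_mem (hKΩ hx) _
  have hψg : ∀ x ∈ K, gradient (Ω.indicator (smoothPos δ ∘ expGap p w g)) x =
      smoothPosDeriv δ (expGap p w g x) • ((Real.exp (p * w x) * p) • gradient w x -
        (Real.exp (p * g x) * p) • gradient g x) := by
    intro x hx
    have h1 := hasGradientAt_comp_real (hasDerivAt_smoothPos hδ (expGap p w g x))
      (hasGradientAt_expGap p (hw.1.hasGradientAt_of_isOpen hΩ (hKΩ hx))
        (hg.1.hasGradientAt_of_isOpen hΩ (hKΩ hx)))
    rw [← h1.gradient]
    refine Filter.EventuallyEq.gradient_eq ?_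
    filter_upwards [hΩ.mem_nhds (hKΩ hx)] with y hy
    exact indicator_of_mem hy _
  generalize Ω.indicator (smoothPos δ ∘ expGap p w g) = ψ at hψ hψs hψK hψg
  have hsub := integral_sub (integrableOn_logSol_integrand hp hΩ hV hVb hw.1 hK hKΩ hψ)
    (integrableOn_logSol_integrand hp hΩ hV hVb hg.1 hK hKΩ hψ)
  rw [hw.setIntegral_eq_zero hK hKΩ hψ hψs, hg.setIntegral_eq_zero hK hKΩ hψ hψs, sub_zero] at hsub
  have hid : ∀ x ∈ K, (⟪pFlux p (gradient w x), gradient ψ x⟫ +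
        (V x - (p - 1) * ‖gradient w x‖ ^ p) * ψ x) -
      (⟪pFlux p (gradient g x), gradient ψ x⟫ + (V x - (p - 1) * ‖gradient g x‖ ^ p) * ψ x) =
      smoothPosDeriv δ (expGap p w g x) * diazSaaForm p w g x +
        (p - 1) * (‖gradient w x‖ ^ p - ‖gradient g x‖ ^ p) *
          (smoothPosDeriv δ (expGap p w g x) * expGap p w g x - smoothPos δ (expGap p w g x)) := by
    intro x hx
    rw [hψg x hx, hψK x hx]
    simp only [diazSaaForm, piconeForm, real_inner_smul_right, inner_sub_right, inner_pFlux_self hp]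
    generalize smoothPos δ (expGap p w g x) = a
    generalize smoothPosDeriv δ (expGap p w g x) = b
    rw [expGap]
    ring
  have hEc : ContinuousOn (fun x => smoothPosDeriv δ (expGap p w g x) * diazSaaForm p w g x) Ω :=
    ((continuous_smoothPosDeriv hδ).comp_continuousOn hDc.continuousOn).mul
      (continuousOn_diazSaaForm hp hΩ hw.1 hg.1)
  have hrc : ContinuousOn (fun x => (p - 1) * (‖gradient w x‖ ^ p - ‖gradient g x‖ ^ p) *
      (smoothPosDeriv δ (expGap p w g x) * expGap p w g x - smoothPos δ (expGap p w g x))) Ω :=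
    (continuousOn_const.mul hQc).mul ((((continuous_smoothPosDeriv hδ).comp_continuousOn
      hDc.continuousOn).mul hDc.continuousOn).sub
      ((contDiff_smoothPos hδ).continuous.comp_continuousOn hDc.continuousOn))
  rw [setIntegral_congr_fun hK.measurableSet hid,
    integral_add ((hEc.mono hKΩ).integrableOn_compact hK)
      ((hrc.mono hKΩ).integrableOn_compact hK)] at hsub
  have hb : |∫ x in K, (p - 1) * (‖gradient w x‖ ^ p - ‖gradient g x‖ ^ p) *
      (smoothPosDeriv δ (expGap p w g x) * expGap p w g x - smoothPos δ (expGap p w g x))| ≤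
      δ * ∫ x in K, (p - 1) * |‖gradient w x‖ ^ p - ‖gradient g x‖ ^ p| := by
    rw [← integral_const_mul]
    rw [← Real.norm_eq_abs]
    refine norm_integral_le_of_norm_le (hCi.const_mul δ) (Eventually.of_forall fun x => ?_)
    rw [Real.norm_eq_abs, abs_mul, abs_mul, abs_of_pos (by linarith : 0 < p - 1), mul_comm]
    refine mul_le_mul_of_nonneg_right (abs_smoothPosDeriv_mul_sub_le hδ _) ?_
    exact mul_nonneg (by linarith) (abs_nonneg _)
  linarith [neg_le_of_abs_le hb]

/-- A comparison principle: two solutions ordered off a compact subset are ordered. -/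
theorem LogSol.le_of_le_off_compact {p : ℝ} (hp : 1 < p) {V w g : Euc d → ℝ} {Ω K : Set (Euc d)}
    (hΩ : IsOpen Ω) (hΩc : IsPreconnected Ω) (hV : Measurable V) (hVb : BddOnCompacts V Ω)
    (hw : LogSol p V Ω w) (hg : LogSol p V Ω g) (hK : IsCompact K) (hKΩ : K ⊆ Ω)
    (hle : ∀ x ∈ Ω \ K, w x ≤ g x) (hne : (Ω \ K).Nonempty) : ∀ x ∈ Ω, w x ≤ g x := by
  have hp0 : 0 < p := by linarith
  have hDc := contDiffOn_expGap p hw.1 hg.1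
  have hEc : ∀ δ : ℝ, 0 < δ → ContinuousOn (fun x => smoothPosDeriv δ (expGap p w g x) *
      diazSaaForm p w g x) Ω := fun δ hδ =>
    ((continuous_smoothPosDeriv hδ).comp_continuousOn hDc.continuousOn).mul
      (continuousOn_diazSaaForm hp hΩ hw.1 hg.1)
  have hE0 : ∀ x, 0 ≤ smoothPosDeriv 1 (expGap p w g x) * diazSaaForm p w g x := fun x =>
    mul_nonneg (smoothPosDeriv_nonneg _ _) (diazSaaForm_nonneg hp _ _ _)
  have hzero : ∫ x in K, smoothPosDeriv 1 (expGap p w g x) * diazSaaForm p w g x = 0 := by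
    refine le_antisymm ?_ (integral_nonneg hE0)
    have hlim : Tendsto (fun δ : ℝ => δ *
        ∫ x in K, (p - 1) * |‖gradient w x‖ ^ p - ‖gradient g x‖ ^ p|) (𝓝[>] 0) (𝓝 0) := by
      have h := (tendsto_id (α := ℝ) (x := 𝓝 0)).mul_const
        (∫ x in K, (p - 1) * |‖gradient w x‖ ^ p - ‖gradient g x‖ ^ p|)
      rw [zero_mul] at h
      exact h.mono_left nhdsWithin_le_nhds
    refine ge_of_tendsto hlim ?_
    filter_upwards [Ioc_mem_nhdsGT (zero_lt_one' ℝ)] with δ hδ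
    refine le_trans ?_ (hw.integral_diazSaaForm_le hp hΩ hV hVb hg hK hKΩ hle hδ.1)
    refine setIntegral_mono (((hEc 1 one_pos).mono hKΩ).integrableOn_compact hK)
      (((hEc δ hδ.1).mono hKΩ).integrableOn_compact hK) fun x => ?_
    exact mul_le_mul_of_nonneg_right (smoothPosDeriv_one_le hδ.1 hδ.2 _)
      (diazSaaForm_nonneg hp _ _ _)
  have hEq : EqOn (fun x => smoothPosDeriv 1 (expGap p w g x) * diazSaaForm p w g x) 0 Ω := by
    refine Measure.eqOn_open_of_ae_eq (μ := volume) ?_ hΩ (hEc 1 one_pos) continuousOn_const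
    have h1 := (setIntegral_eq_zero_iff_of_nonneg_ae (Eventually.of_forall hE0)
      (((hEc 1 one_pos).mono hKΩ).integrableOn_compact hK)).1 hzero
    have h1' := (ae_restrict_iff' hK.measurableSet).1 h1
    rw [Filter.EventuallyEq, ae_restrict_iff' hΩ.measurableSet]
    filter_upwards [h1'] with x hx hxΩ
    by_cases hxK : x ∈ K
    · exact hx hxK
    · rw [smoothPosDeriv_of_nonpos (expGap_nonpos hp0 (hle x ⟨hxΩ, hxK⟩)), zero_mul]; rfl
  have hMg : ∀ x ∈ Ω, HasGradientAt (fun x => max (w x - g x) 0 ^ 2) 0 x := by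
    intro x hx
    have h := hasGradientAt_comp_real (hasDerivAt_max_sq (w x - g x)) (hasGradientAt_sub_real
      (hw.1.hasGradientAt_of_isOpen hΩ hx) (hg.1.hasGradientAt_of_isOpen hΩ hx))
    convert h using 1
    rcases le_or_gt (w x) (g x) with hle' | hlt
    · rw [max_eq_right (by linarith), mul_zero, zero_smul]
    · rw [gradient_eq_of_diazSaaForm_eq_zero hp ((mul_eq_zero.1 (hEq hx)).resolve_left
        (smoothPosDeriv_pos (expGap_pos hp0 hlt)).ne'), sub_self, smul_zero]
  obtain ⟨x₀, hx₀⟩ := hne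
  intro x hx
  have h := hΩ.is_const_of_fderiv_eq_zero (𝕜 := ℝ) hΩc
    (fun y hy => (hMg y hy).differentiableAt.differentiableWithinAt) (fun y hy => by
      simpa using (hMg y hy).hasFDerivAt.fderiv) hx hx₀.1
  rw [max_eq_right (by linarith [hle x₀ hx₀] : w x₀ - g x₀ ≤ 0), zero_pow two_ne_zero,
    sq_eq_zero_iff] at h
  linarith [le_max_left (w x - g x) 0]

end Comparison

/-- `y` solves `y' = w t + F t (y t)` on `[a, b]` in integrated form, with `y b = c`. -/
def IntegralSol (w : ℝ → ℝ) (F : ℝ → ℝ → ℝ) (a b c : ℝ) (y : ℝ → ℝ) : Prop :=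
  ContinuousOn y (Icc a b) ∧ ∀ t ∈ Icc a b, y t = c + ∫ s in b..t, (w s + F s (y s))

theorem continuousOn_comp_uncurry {F : ℝ → ℝ → ℝ} {a b : ℝ}
    (hF : ContinuousOn (Function.uncurry F) (Icc a b ×ˢ univ)) {y : ℝ → ℝ}
    (hy : ContinuousOn y (Icc a b)) : ContinuousOn (fun s => F s (y s)) (Icc a b) :=
  hF.comp (continuousOn_id.prodMk hy) fun _ hs => ⟨hs, mem_univ _⟩

theorem intervalIntegrable_of_mem_Icc {w : ℝ → ℝ} {a b s t : ℝ}
    (hw : IntervalIntegrable w volume a b) (hs : s ∈ Icc a b) (ht : t ∈ Icc a b) :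
    IntervalIntegrable w volume s t := by
  have hab : a ≤ b := hs.1.trans hs.2
  exact hw.mono_set (uIcc_subset_uIcc (by rwa [uIcc_of_le hab]) (by rwa [uIcc_of_le hab]))

theorem continuousOn_primitive_right {w : ℝ → ℝ} {a b : ℝ} (hab : a ≤ b)
    (hw : IntervalIntegrable w volume a b) :
    ContinuousOn (fun t => ∫ s in b..t, w s) (Icc a b) := by
  have h := intervalIntegral.continuousOn_primitive_interval' hw
    (b₁ := a) (b₂ := b) (a := b) (by rw [uIcc_of_le hab]; exact right_mem_Icc.2 hab)
  rwa [uIcc_of_le hab] at h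

theorem hasDerivWithinAt_primitive_right {g : ℝ → ℝ} {a b t : ℝ} (hg : ContinuousOn g (Icc a b))
    (ht : t ∈ Icc a b) :
    HasDerivWithinAt (fun t => ∫ s in b..t, g s) (g t) (Icc a b) t := by
  have hab : a ≤ b := ht.1.trans ht.2
  have : Fact (t ∈ Icc a b) := ⟨ht⟩
  refine intervalIntegral.integral_hasDerivWithinAt_right
    (intervalIntegrable_of_mem_Icc (hg.intervalIntegrable_of_Icc hab) (right_mem_Icc.2 hab) ht)
    ?_ (hg t ht)
  exact hg.stronglyMeasurableAtFilter_nhdsWithin measurableSet_Icc t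

theorem IntegralSol.sub_primitive {w : ℝ → ℝ} {F : ℝ → ℝ → ℝ} {a b c : ℝ} {y : ℝ → ℝ}
    (hF : ContinuousOn (Function.uncurry F) (Icc a b ×ˢ univ))
    (hw : IntervalIntegrable w volume a b) (hy : IntegralSol w F a b c y) {t : ℝ}
    (ht : t ∈ Icc a b) :
    y t - (∫ s in b..t, w s) = c + ∫ s in b..t, F s (y s) := by
  have hab : a ≤ b := ht.1.trans ht.2
  rw [hy.2 t ht, intervalIntegral.integral_add
    (intervalIntegrable_of_mem_Icc hw (right_mem_Icc.2 hab) ht)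
    (intervalIntegrable_of_mem_Icc
      ((continuousOn_comp_uncurry hF hy.1).intervalIntegrable_of_Icc hab)
      (right_mem_Icc.2 hab) ht)]
  ring

theorem IntegralSol.hasDerivWithinAt {w : ℝ → ℝ} {F : ℝ → ℝ → ℝ} {a b c : ℝ} {y : ℝ → ℝ}
    (hF : ContinuousOn (Function.uncurry F) (Icc a b ×ˢ univ))
    (hw : IntervalIntegrable w volume a b) (hy : IntegralSol w F a b c y) {t : ℝ}
    (ht : t ∈ Icc a b) :
    HasDerivWithinAt (fun t => y t - ∫ s in b..t, w s) (F t (y t)) (Icc a b) t :=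
  ((hasDerivWithinAt_primitive_right (continuousOn_comp_uncurry hF hy.1) ht).const_add c).congr
    (fun _ hs => hy.sub_primitive hF hw hs) (hy.sub_primitive hF hw ht)

theorem IntegralSol.dist_le {w : ℝ → ℝ} {F : ℝ → ℝ → ℝ} {a b c₁ c₂ : ℝ} {y₁ y₂ : ℝ → ℝ}
    {K : NNReal} (hF : ContinuousOn (Function.uncurry F) (Icc a b ×ˢ univ))
    (hK : ∀ t ∈ Icc a b, LipschitzWith K (F t))
    (hw : IntervalIntegrable w volume a b) (h₁ : IntegralSol w F a b c₁ y₁)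
    (h₂ : IntegralSol w F a b c₂ y₂) {t : ℝ} (ht : t ∈ Icc a b) :
    |y₁ t - y₂ t| ≤ |c₁ - c₂| * Real.exp (K * (b - t)) := by
  have hab : a ≤ b := ht.1.trans ht.2
  set W : ℝ → ℝ := fun t => ∫ s in b..t, w s with hW
  have hneg : ∀ s, s ∈ Icc (-b) (-a) → -s ∈ Icc a b := fun s hs =>
    ⟨by linarith [hs.2], by linarith [hs.1]⟩
  have key : ∀ (c : ℝ) (y : ℝ → ℝ), IntegralSol w F a b c y →
      ContinuousOn (fun s => y (-s) - W (-s)) (Icc (-b) (-a)) ∧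
      ∀ s ∈ Ico (-b) (-a), HasDerivWithinAt (fun s => y (-s) - W (-s))
        ((fun s z => - F (-s) (z + W (-s))) s (y (-s) - W (-s))) (Ici s) s := by
    intro c y h
    have hd : ∀ s ∈ Icc (-b) (-a), HasDerivWithinAt (fun s => y (-s) - W (-s))
        (- F (-s) (y (-s))) (Icc (-b) (-a)) s := by
      intro s hs
      have := (h.hasDerivWithinAt hF hw (hneg s hs)).scomp s
        (hasDerivWithinAt_neg s (Icc (-b) (-a))) hneg
      simpa [Function.comp_def] using this
    refine ⟨fun s hs => (hd s hs).continuousWithinAt, fun s hs => ?_⟩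
    have h1 : HasDerivWithinAt _ _ (Ici s) s := (hd s ⟨hs.1, hs.2.le⟩).mono_of_mem_nhdsWithin
      (mem_of_superset (Icc_mem_nhdsGE hs.2) (Icc_subset_Icc_left hs.1))
    simpa using h1
  have h := dist_le_of_trajectories_ODE_of_mem (v := fun s z => - F (-s) (z + W (-s)))
    (s := fun _ => univ) (K := K) (δ := |c₁ - c₂|) (a := -b) (b := -a) ?_ (key c₁ y₁ h₁).1
    (key c₁ y₁ h₁).2 (fun _ _ => mem_univ _) (key c₂ y₂ h₂).1 (key c₂ y₂ h₂).2
    (fun _ _ => mem_univ _) ?_ (-t) ⟨by linarith [ht.2], by linarith [ht.1]⟩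
  · simp only [neg_neg, Real.dist_eq] at h
    convert h using 2 <;> ring_nf
  · intro s hs
    refine LipschitzWith.lipschitzOnWith (LipschitzWith.of_dist_le_mul fun x y => ?_)
    have := (hK (-s) (hneg s ⟨hs.1, hs.2.le⟩)).dist_le_mul (x + W (-s)) (y + W (-s))
    simpa using this
  · have hb := right_mem_Icc.2 hab
    rw [Real.dist_eq, neg_neg, h₁.2 b hb, h₂.2 b hb]
    simp

theorem IntegralSol.exists_sol {w : ℝ → ℝ} {F : ℝ → ℝ → ℝ} {a b : ℝ} {K Λ : NNReal}
    (hab : a ≤ b) (hF : ContinuousOn (Function.uncurry F) (Icc a b ×ˢ univ))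
    (hK : ∀ t ∈ Icc a b, LipschitzWith K (F t)) (hΛ : ∀ t ∈ Icc a b, ∀ x, |F t x| ≤ Λ)
    (hw : IntervalIntegrable w volume a b) (c : ℝ) : ∃ y, IntegralSol w F a b c y := by
  set W : ℝ → ℝ := fun t => ∫ s in b..t, w s with hW
  have hWc : ContinuousOn W (Icc a b) := continuousOn_primitive_right hab hw
  have hb := right_mem_Icc.2 hab
  have hPL : IsPicardLindelof (fun t z => F t (z + W t)) (⟨b, hb⟩ : Icc a b) c
      (Λ * (b - a).toNNReal) 0 Λ K := by
    refine ⟨fun t ht => ?_, fun x _ => ?_, fun t ht x _ => hΛ t ht _, ?_⟩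
    · refine LipschitzWith.lipschitzOnWith (LipschitzWith.of_dist_le_mul fun x y => ?_)
      have := (hK t ht).dist_le_mul (x + W t) (y + W t)
      simpa using this
    · exact continuousOn_comp_uncurry hF (continuousOn_const.add hWc)
    · simp [hab]
  obtain ⟨z, hz0, hz⟩ := hPL.exists_eq_forall_mem_Icc_hasDerivWithinAt₀
  have hzc : ContinuousOn z (Icc a b) := fun s hs => (hz s hs).continuousWithinAt
  have hyc : ContinuousOn (fun t => z t + W t) (Icc a b) := hzc.add hWc
  have hFc := continuousOn_comp_uncurry hF hyc
  refine ⟨fun t => z t + W t, hyc, fun t ht => ?_⟩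
  have h1 : ∫ s in b..t, F s (z s + W s) = z t - z b := by
    rw [intervalIntegral.integral_symm, intervalIntegral.integral_eq_sub_of_hasDerivAt_of_le ht.2
      (hzc.mono (Icc_subset_Icc_left ht.1))
      (fun s hs => (hz s ⟨ht.1.trans hs.1.le, hs.2.le⟩).hasDerivAt
        (Icc_mem_nhds (ht.1.trans_lt hs.1) hs.2))]
    · ring
    · exact intervalIntegrable_of_mem_Icc (hFc.intervalIntegrable_of_Icc hab) ht hb
  rw [intervalIntegral.integral_add (intervalIntegrable_of_mem_Icc hw hb ht)
    (intervalIntegrable_of_mem_Icc (hFc.intervalIntegrable_of_Icc hab) hb ht), h1]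
  have : z b = c := hz0
  rw [this]
  ring

theorem mul_eq_add_integral {f g f' g' : ℝ → ℝ} {a b : ℝ}
    (hf' : IntervalIntegrable f' volume a b) (hg' : IntervalIntegrable g' volume a b)
    (hf : ∀ t ∈ Icc a b, f t = f b + ∫ s in b..t, f' s)
    (hg : ∀ t ∈ Icc a b, g t = g b + ∫ s in b..t, g' s) {t : ℝ} (ht : t ∈ Icc a b) :
    f t * g t = f b * g b + ∫ s in b..t, (f' s * g s + f s * g' s) := by
  have hab : a ≤ b := ht.1.trans ht.2
  have hb := right_mem_Icc.2 hab
  have hbt : uIcc b t ⊆ Icc a b := by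
    rw [uIcc_comm, uIcc_of_le ht.2]; exact Icc_subset_Icc_left ht.1
  have hfi := intervalIntegrable_of_mem_Icc hf' hb ht
  have hgi := intervalIntegrable_of_mem_Icc hg' hb ht
  have hmem : b ∈ uIcc b t := left_mem_uIcc
  have hac : ∀ (h' : ℝ → ℝ), IntervalIntegrable h' volume b t → ∀ k : ℝ,
      AbsolutelyContinuousOnInterval (fun x => k + ∫ s in b..x, h' s) b t := fun h' hh k =>
    (LipschitzOnWith.absolutelyContinuousOnInterval (LipschitzWith.const k).lipschitzOnWith).fun_add
      (hh.absolutelyContinuousOnInterval_intervalIntegral hmem)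
  have h := (hac f' hfi (f b)).integral_deriv_mul_eq_sub (hac g' hgi (g b))
  rw [← hf t ht, ← hg t ht] at h
  simp only [intervalIntegral.integral_same, add_zero] at h
  have h2 : ∫ s in b..t, (f' s * g s + f s * g' s) =
      ∫ x in b..t, (deriv (fun x => f b + ∫ s in b..x, f' s) x * (g b + ∫ s in b..x, g' s) +
        (f b + ∫ s in b..x, f' s) * deriv (fun x => g b + ∫ s in b..x, g' s) x) := by
    refine intervalIntegral.integral_congr_ae ?_
    filter_upwards [hfi.ae_hasDerivAt_integral, hgi.ae_hasDerivAt_integral] with x h1 h2 hx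
    have hx' := uIoc_subset_uIcc hx
    rw [((h1 hx' b hmem).const_add _).deriv, ((h2 hx' b hmem).const_add _).deriv,
      ← hf x (hbt hx'), ← hg x (hbt hx')]
  rw [h2, h]
  ring

/-- The inverse of `t ↦ |t| ^ (p - 2) * t`. -/
def conjPow (p z : ℝ) : ℝ := |z| ^ (p / (p - 1) - 2) * z

theorem one_lt_conj {p : ℝ} (hp : 1 < p) : 1 < p / (p - 1) := by
  rw [one_lt_div (by linarith)]; linarith

theorem abs_conjPow {p : ℝ} (hp : 1 < p) (z : ℝ) : |conjPow p z| = |z| ^ (1 / (p - 1)) := by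
  have hp1 : p - 1 ≠ 0 := by linarith
  rcases eq_or_ne z 0 with rfl | hz
  · simp [conjPow, Real.zero_rpow (inv_ne_zero hp1)]
  · have hz' : 0 < |z| := abs_pos.2 hz
    rw [conjPow, abs_mul, abs_of_nonneg (by positivity)]
    nth_rewrite 2 [← Real.rpow_one |z|]
    rw [← Real.rpow_add hz']
    congr 1
    field_simp
    ring

theorem continuous_conjPow {p : ℝ} (hp : 1 < p) : Continuous (conjPow p) := by
  have hq := one_lt_conj hp
  have h : ContDiff ℝ 1 (fun x : ℝ => ‖x‖ ^ (p / (p - 1))) := contDiff_norm_rpow hq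
  have h2 := (h.continuous_deriv le_rfl).div_const (p / (p - 1))
  convert h2 using 1
  ext x
  simp only [Real.norm_eq_abs]
  rw [(hasDerivAt_abs_rpow x hq).deriv, conjPow, mul_assoc, mul_div_assoc,
    mul_div_cancel₀ _ (by linarith)]

theorem abs_conjPow_rpow {p : ℝ} (hp : 1 < p) (z : ℝ) :
    |conjPow p z| ^ p = |z| ^ (p / (p - 1)) := by
  rw [abs_conjPow hp, ← Real.rpow_mul (abs_nonneg z)]
  congr 1
  ring

theorem conjPow_mul_self {p : ℝ} (hp : 1 < p) (z : ℝ) :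
    conjPow p z * z = |z| ^ (p / (p - 1)) := by
  rcases eq_or_ne z 0 with rfl | hz
  · simp [conjPow, Real.zero_rpow (by linarith [one_lt_conj hp] : p / (p - 1) ≠ 0)]
  · have hz' : 0 < |z| := abs_pos.2 hz
    rw [conjPow, mul_assoc, ← sq, ← sq_abs, ← Real.rpow_natCast, ← Real.rpow_add hz']
    congr 1
    push_cast
    ring

theorem abs_conjPow_rpow_mul {p : ℝ} (hp : 1 < p) (z : ℝ) :
    |conjPow p z| ^ (p - 2) * conjPow p z = z := by
  have hp1 : p - 1 ≠ 0 := by linarith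
  rcases eq_or_ne z 0 with rfl | hz
  · simp [conjPow]
  · have hz' : 0 < |z| := abs_pos.2 hz
    rw [abs_conjPow hp, conjPow, ← Real.rpow_mul hz'.le, ← mul_assoc, ← Real.rpow_add hz']
    have : 1 / (p - 1) * (p - 2) + (p / (p - 1) - 2) = 0 := by
      field_simp
      ring
    rw [this, Real.rpow_zero, one_mul]

theorem abs_rpow_sub_abs_rpow_le {q A x y : ℝ} (hq : 1 < q) (hx : |x| ≤ A) (hy : |y| ≤ A) :
    |(|x| ^ q - |y| ^ q)| ≤ q * A ^ (q - 1) * |x - y| := by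
  have hA : 0 ≤ A := (abs_nonneg x).trans hx
  have h := (convex_Icc (-A) A).norm_image_sub_le_of_norm_hasDerivWithin_le
    (f := fun x : ℝ => |x| ^ q) (f' := fun x => q * |x| ^ (q - 2) * x) (C := q * A ^ (q - 1))
    (fun z _ => (hasDerivAt_abs_rpow z hq).hasDerivWithinAt) ?_ (abs_le.1 hy) (abs_le.1 hx)
  · simpa using h
  · intro z hz
    have hz' : |z| ≤ A := abs_le.2 hz
    rw [Real.norm_eq_abs, abs_mul, abs_mul, abs_of_pos (by linarith : 0 < q),
      abs_of_nonneg (by positivity : 0 ≤ |z| ^ (q - 2)), mul_assoc]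
    refine mul_le_mul_of_nonneg_left ?_ (by linarith)
    rcases eq_or_ne z 0 with rfl | hz0
    · simp; positivity
    · nth_rewrite 2 [← Real.rpow_one |z|]
      rw [← Real.rpow_add (abs_pos.2 hz0)]
      calc |z| ^ (q - 2 + 1) = |z| ^ (q - 1) := by congr 1; ring
        _ ≤ A ^ (q - 1) := Real.rpow_le_rpow (abs_nonneg _) hz' (by linarith)

/-- The nonlinear term of the Riccati equation for radial solutions, where `m` is the weight. -/
def riccatiTerm (p : ℝ) (m : ℝ → ℝ) (s y : ℝ) : ℝ := -((p - 1) * (m s * |y / m s| ^ (p / (p - 1))))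

/-- Truncation of a real number to `[-T, T]`. -/
def clampAt (T y : ℝ) : ℝ := max (-T) (min y T)

theorem abs_clampAt_le {T : ℝ} (hT : 0 ≤ T) (y : ℝ) : |clampAt T y| ≤ T :=
  abs_le.2 ⟨le_max_left _ _, max_le (by linarith) (min_le_right _ _)⟩

theorem clampAt_of_abs_le {T y : ℝ} (hy : |y| ≤ T) : clampAt T y = y := by
  rw [clampAt, min_eq_left (abs_le.1 hy).2, max_eq_right (abs_le.1 hy).1]

theorem abs_clampAt_sub_le (T x y : ℝ) : |clampAt T x - clampAt T y| ≤ |x - y| := by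
  have h := ((LipschitzWith.id (α := ℝ)).min_const T).const_max (-T)
  simpa [clampAt, Real.dist_eq] using h.dist_le_mul x y

theorem continuousOn_riccatiTerm_clampAt {p : ℝ} (hp : 1 < p) {m : ℝ → ℝ} {a b : ℝ}
    (hm : ContinuousOn m (Icc a b)) (hm0 : ∀ s ∈ Icc a b, 0 < m s) (T : ℝ) :
    ContinuousOn (Function.uncurry fun s y => riccatiTerm p m s (clampAt T y))
      (Icc a b ×ˢ univ) := by
  have hq := one_lt_conj hp
  have h1 : ContinuousOn (fun z : ℝ × ℝ => m z.1) (Icc a b ×ˢ univ) :=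
    hm.comp continuousOn_fst fun z hz => hz.1
  have h2 : ContinuousOn (fun z : ℝ × ℝ => clampAt T z.2) (Icc a b ×ˢ univ) := by
    unfold clampAt; fun_prop
  have h3 := (h2.div h1 fun z hz => (hm0 z.1 hz.1).ne').abs
  exact (continuousOn_const.mul (h1.mul (h3.rpow_const fun z _ => Or.inr (by linarith)))).neg

theorem exists_riccatiTerm_clampAt_bounds {p : ℝ} (hp : 1 < p) {m : ℝ → ℝ} {a b m₀ M : ℝ}
    (hm₀ : 0 < m₀) (hml : ∀ s ∈ Icc a b, m₀ ≤ m s) (hmu : ∀ s ∈ Icc a b, m s ≤ M) {T : ℝ}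
    (hT : 0 ≤ T) :
    ∃ K Λ : NNReal, (∀ t ∈ Icc a b, LipschitzWith K fun y => riccatiTerm p m t (clampAt T y)) ∧
      ∀ t ∈ Icc a b, ∀ y, |riccatiTerm p m t (clampAt T y)| ≤ Λ := by
  have hq := one_lt_conj hp
  set q := p / (p - 1) with hqd
  have hp1 : 0 < p - 1 := by linarith
  have hz : ∀ t ∈ Icc a b, ∀ y, |clampAt T y / m t| ≤ T / m₀ := fun t ht y => by
    have := hm₀.trans_le (hml t ht)
    rw [abs_div, abs_of_pos this]
    exact div_le_div₀ hT (abs_clampAt_le hT y) hm₀ (hml t ht)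
  refine ⟨((p - 1) * (q * (T / m₀) ^ (q - 1))).toNNReal,
    ((p - 1) * (M * (T / m₀) ^ q)).toNNReal, fun t ht => ?_, fun t ht y => ?_⟩
  · have hmt := hm₀.trans_le (hml t ht)
    refine LipschitzWith.of_dist_le_mul fun x y => ?_
    rw [Real.coe_toNNReal _ (by positivity), Real.dist_eq, Real.dist_eq]
    have h1 := abs_rpow_sub_abs_rpow_le hq (hz t ht x) (hz t ht y)
    have h2 : riccatiTerm p m t (clampAt T x) - riccatiTerm p m t (clampAt T y) =
        -((p - 1) * m t) * (|clampAt T x / m t| ^ q - |clampAt T y / m t| ^ q) := by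
      simp only [riccatiTerm]; ring
    rw [h2, abs_mul, abs_neg, abs_of_pos (by positivity)]
    rw [← sub_div, abs_div (_ - _), abs_of_pos hmt] at h1
    calc (p - 1) * m t * |(|clampAt T x / m t| ^ q - |clampAt T y / m t| ^ q)|
        ≤ (p - 1) * m t * (q * (T / m₀) ^ (q - 1) * (|clampAt T x - clampAt T y| / m t)) :=
          mul_le_mul_of_nonneg_left h1 (by positivity)
      _ = (p - 1) * (q * (T / m₀) ^ (q - 1)) * |clampAt T x - clampAt T y| := by
          field_simp
      _ ≤ _ := mul_le_mul_of_nonneg_left (abs_clampAt_sub_le T x y) (by positivity)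
  · have hmt := hm₀.trans_le (hml t ht)
    have hM : 0 ≤ M := hmt.le.trans (hmu t ht)
    rw [Real.coe_toNNReal _ (by positivity), riccatiTerm, abs_neg, abs_of_nonneg (by positivity)]
    gcongr
    · exact hmu t ht
    · exact hz t ht y

theorem IntegralSol.congr_field {w : ℝ → ℝ} {F F' : ℝ → ℝ → ℝ} {a b c : ℝ} {y : ℝ → ℝ}
    (h : IntegralSol w F a b c y) (hFF : ∀ s ∈ Icc a b, F s (y s) = F' s (y s)) :
    IntegralSol w F' a b c y := by
  refine ⟨h.1, fun t ht => ?_⟩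
  rw [h.2 t ht]
  congr 1
  refine intervalIntegral.integral_congr fun s hs => ?_
  rw [uIcc_comm, uIcc_of_le ht.2] at hs
  simp only [hFF s ⟨ht.1.trans hs.1, hs.2⟩]

theorem IntegralSol.mono {w : ℝ → ℝ} {F : ℝ → ℝ → ℝ} {a a' b c : ℝ} {y : ℝ → ℝ}
    (h : IntegralSol w F a b c y) (haa : a ≤ a') : IntegralSol w F a' b c y :=
  ⟨h.1.mono (Icc_subset_Icc_left haa), fun t ht => h.2 t ⟨haa.trans ht.1, ht.2⟩⟩

/-- Solutions on `[a, b]` of the Riccati equation for radial solutions, with weight `m`. -/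
def RiccatiSol (p : ℝ) (m w : ℝ → ℝ) (a b c : ℝ) (y : ℝ → ℝ) : Prop :=
  IntegralSol w (riccatiTerm p m) a b c y

theorem RiccatiSol.mono {p : ℝ} {m w : ℝ → ℝ} {a a' b c : ℝ} {y : ℝ → ℝ}
    (h : RiccatiSol p m w a b c y) (haa : a ≤ a') : RiccatiSol p m w a' b c y :=
  IntegralSol.mono h haa

theorem RiccatiSol.truncated {p : ℝ} {m w : ℝ → ℝ} {a b c T : ℝ} {y : ℝ → ℝ}
    (h : RiccatiSol p m w a b c y) (hT : ∀ s ∈ Icc a b, |y s| ≤ T) :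
    IntegralSol w (fun s y => riccatiTerm p m s (clampAt T y)) a b c y :=
  IntegralSol.congr_field h fun s hs => by rw [clampAt_of_abs_le (hT s hs)]

theorem IntegralSol.riccatiSol {p : ℝ} {m w : ℝ → ℝ} {a b c T : ℝ} {y : ℝ → ℝ}
    (h : IntegralSol w (fun s y => riccatiTerm p m s (clampAt T y)) a b c y)
    (hT : ∀ s ∈ Icc a b, |y s| ≤ T) : RiccatiSol p m w a b c y :=
  IntegralSol.congr_field h fun s hs => by rw [clampAt_of_abs_le (hT s hs)]

theorem exists_truncated_flow {p : ℝ} (hp : 1 < p) {m w : ℝ → ℝ} {a b : ℝ} (hab : a ≤ b)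
    (hm : ContinuousOn m (Icc a b)) (hm0 : ∀ s ∈ Icc a b, 0 < m s)
    (hw : IntervalIntegrable w volume a b) {T : ℝ} (hT : 0 ≤ T) :
    ∃ C : ℝ, 0 ≤ C ∧
      (∀ c, ∃ y, IntegralSol w (fun s y => riccatiTerm p m s (clampAt T y)) a b c y) ∧
      ∀ c₁ c₂ y₁ y₂, IntegralSol w (fun s y => riccatiTerm p m s (clampAt T y)) a b c₁ y₁ →
        IntegralSol w (fun s y => riccatiTerm p m s (clampAt T y)) a b c₂ y₂ →
        ∀ t ∈ Icc a b, |y₁ t - y₂ t| ≤ |c₁ - c₂| * C := by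
  obtain ⟨x₀, hx₀, hmin⟩ := isCompact_Icc.exists_isMinOn (nonempty_Icc.2 hab) hm
  obtain ⟨x₁, hx₁, hmax⟩ := isCompact_Icc.exists_isMaxOn (nonempty_Icc.2 hab) hm
  obtain ⟨K, Λ, hK, hΛ⟩ := exists_riccatiTerm_clampAt_bounds hp (hm0 x₀ hx₀)
    (fun s hs => hmin hs) (fun s hs => hmax hs) hT
  have hF := continuousOn_riccatiTerm_clampAt hp hm hm0 T
  refine ⟨Real.exp (K * (b - a)), (Real.exp_pos _).le,
    fun c => IntegralSol.exists_sol hab hF hK hΛ hw c, fun c₁ c₂ y₁ y₂ h₁ h₂ t ht => ?_⟩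
  refine (h₁.dist_le hF hK hw h₂ ht).trans ?_
  gcongr
  exact ht.1

theorem exists_abs_le_of_continuousOn {y : ℝ → ℝ} {a b : ℝ} (hy : ContinuousOn y (Icc a b)) :
    ∃ T, 0 ≤ T ∧ ∀ s ∈ Icc a b, |y s| ≤ T := by
  obtain ⟨T, hT⟩ := isCompact_Icc.exists_bound_of_continuousOn hy
  exact ⟨max T 0, le_max_right _ _, fun s hs => (hT s hs).trans (le_max_left _ _)⟩

theorem RiccatiSol.eqOn {p : ℝ} (hp : 1 < p) {m w : ℝ → ℝ} {a b c : ℝ} {y₁ y₂ : ℝ → ℝ}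
    (hm : ContinuousOn m (Icc a b)) (hm0 : ∀ s ∈ Icc a b, 0 < m s)
    (hw : IntervalIntegrable w volume a b) (h₁ : RiccatiSol p m w a b c y₁)
    (h₂ : RiccatiSol p m w a b c y₂) : EqOn y₁ y₂ (Icc a b) := by
  intro t ht
  obtain ⟨T₁, hT₁, hb₁⟩ := exists_abs_le_of_continuousOn h₁.1
  obtain ⟨T₂, -, hb₂⟩ := exists_abs_le_of_continuousOn h₂.1
  obtain ⟨C, -, -, hC⟩ := exists_truncated_flow hp (ht.1.trans ht.2) hm hm0 hw
    (hT₁.trans (le_max_left T₁ T₂))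
  have := hC c c y₁ y₂ (h₁.truncated fun s hs => (hb₁ s hs).trans (le_max_left _ _))
    (h₂.truncated fun s hs => (hb₂ s hs).trans (le_max_right _ _)) t ht
  simp only [sub_self, abs_zero, zero_mul] at this
  exact sub_eq_zero.1 (abs_eq_zero.1 (le_antisymm this (abs_nonneg _)))

/-- The increment of the logarithm of the radial solution attached to a Riccati solution `y`. -/
def logIncr (p : ℝ) (m : ℝ → ℝ) (b : ℝ) (y : ℝ → ℝ) (t : ℝ) : ℝ :=
  ∫ s in b..t, conjPow p (y s / m s)

theorem logIncr_congr {p : ℝ} {m : ℝ → ℝ} {a b t : ℝ} {y₁ y₂ : ℝ → ℝ} (h : EqOn y₁ y₂ (Icc a b))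
    (ht : t ∈ Icc a b) : logIncr p m b y₁ t = logIncr p m b y₂ t := by
  refine intervalIntegral.integral_congr fun s hs => ?_
  rw [uIcc_comm, uIcc_of_le ht.2] at hs
  simp only [h ⟨ht.1.trans hs.1, hs.2⟩]

theorem continuousOn_conjPow_div {p : ℝ} (hp : 1 < p) {m y : ℝ → ℝ} {a b : ℝ}
    (hm : ContinuousOn m (Icc a b)) (hm0 : ∀ s ∈ Icc a b, 0 < m s)
    (hy : ContinuousOn y (Icc a b)) : ContinuousOn (fun s => conjPow p (y s / m s)) (Icc a b) :=
  (continuous_conjPow hp).comp_continuousOn (hy.div hm fun s hs => (hm0 s hs).ne')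

/-- Continuous dependence of Riccati solutions on the data at the right endpoint. -/
theorem RiccatiSol.stable {p : ℝ} (hp : 1 < p) {m w : ℝ → ℝ} {a b c : ℝ} {y : ℝ → ℝ} (hab : a ≤ b)
    (hm : ContinuousOn m (Icc a b)) (hm0 : ∀ s ∈ Icc a b, 0 < m s)
    (hw : IntervalIntegrable w volume a b) (hy : RiccatiSol p m w a b c y) {O : Set ℝ}
    (hO : IsOpen O) (hyO : logIncr p m b y a ∈ O) :
    ∀ᶠ c' in 𝓝 c, ∃ y', RiccatiSol p m w a b c' y' ∧ logIncr p m b y' a ∈ O := by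
  obtain ⟨T, hT, hb⟩ := exists_abs_le_of_continuousOn hy.1
  obtain ⟨C, hC0, hex, hC⟩ := exists_truncated_flow hp hab hm hm0 hw (by linarith : 0 ≤ T + 1)
  choose Y hY using hex
  have hyT := hy.truncated (T := T + 1) fun s hs => (hb s hs).trans (by linarith)
  have hYy : ∀ c', ∀ t ∈ Icc a b, |Y c' t - y t| ≤ |c' - c| * C :=
    fun c' t ht => hC c' c _ _ (hY c') hyT t ht
  have hsmall : Tendsto (fun c' => |c' - c| * C) (𝓝 c) (𝓝 0) := by
    have h : Continuous fun c' => |c' - c| * C := by fun_prop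
    simpa using h.tendsto c
  have hev : ∀ᶠ c' in 𝓝 c, ∀ t ∈ Icc a b, |Y c' t| ≤ T + 1 := by
    filter_upwards [hsmall.eventually (gt_mem_nhds one_pos)] with c' hc' t ht
    have h1 := hYy c' t ht
    have h2 := abs_sub_abs_le_abs_sub (Y c' t) (y t)
    linarith [hb t ht]
  obtain ⟨x₀, hx₀, hmin⟩ := isCompact_Icc.exists_isMinOn (nonempty_Icc.2 hab) hm
  have hlim : Tendsto (fun c' => logIncr p m b (Y c') a) (𝓝 c) (𝓝 (logIncr p m b y a)) := by
    refine intervalIntegral.tendsto_integral_filter_of_dominated_convergence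
      (fun _ => ((T + 1) / m x₀) ^ (1 / (p - 1))) ?_ ?_ (by simp) ?_
    · refine Eventually.of_forall fun c' => ?_
      rw [uIoc_comm, uIoc_of_le hab]
      exact ((continuousOn_conjPow_div hp hm hm0 (hY c').1).mono
        Ioc_subset_Icc_self).aestronglyMeasurable measurableSet_Ioc
    · filter_upwards [hev] with c' hc'
      refine Eventually.of_forall fun s hs => ?_
      rw [uIoc_comm, uIoc_of_le hab] at hs
      have hs' := Ioc_subset_Icc_self hs
      have hx₀m := hm0 x₀ hx₀
      rw [Real.norm_eq_abs, abs_conjPow hp, abs_div, abs_of_pos (hm0 s hs')]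
      refine Real.rpow_le_rpow (div_nonneg (abs_nonneg _) (hm0 s hs').le)
        (div_le_div₀ (by linarith) (hc' s hs') hx₀m (hmin hs')) ?_
      exact (one_div_pos.2 (by linarith)).le
    · refine Eventually.of_forall fun s hs => ?_
      rw [uIoc_comm, uIoc_of_le hab] at hs
      have hs' := Ioc_subset_Icc_self hs
      have h1 : Tendsto (fun c' => Y c' s) (𝓝 c) (𝓝 (y s)) := by
        rw [tendsto_iff_dist_tendsto_zero]
        exact squeeze_zero (fun _ => dist_nonneg) (fun c' => hYy c' s hs') hsmall
      exact ((continuous_conjPow hp).tendsto _).comp (h1.div_const _)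
  filter_upwards [hev, hlim.eventually (hO.mem_nhds hyO)] with c' h1 h2
  exact ⟨Y c', (hY c').riccatiSol h1, h2⟩

/-- An a priori bound at the left endpoint implies existence. -/
theorem RiccatiSol.exists_of_bound {p : ℝ} (hp : 1 < p) {m w : ℝ → ℝ} {a b c N : ℝ} (hab : a ≤ b)
    (hm : ContinuousOn m (Icc a b)) (hm0 : ∀ s ∈ Icc a b, 0 < m s)
    (hw : IntervalIntegrable w volume a b)
    (hN : ∀ a' ∈ Icc a b, ∀ y, RiccatiSol p m w a' b c y → |y a'| ≤ N) :
    ∃ y, RiccatiSol p m w a b c y := by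
  have hN0 : 0 ≤ N := by
    refine (abs_nonneg _).trans (hN b (right_mem_Icc.2 hab) (fun _ => c) ⟨by simp, fun t ht => ?_⟩)
    rw [Icc_self, mem_singleton_iff] at ht
    simp [ht]
  obtain ⟨-, -, hex, -⟩ := exists_truncated_flow hp hab hm hm0 hw (by linarith : 0 ≤ N + 1)
  obtain ⟨y, hy⟩ := hex c
  refine ⟨y, hy.riccatiSol ?_⟩
  by_contra! hcon
  set S := Icc a b ∩ (fun s => |y s|) ⁻¹' Ici (N + 1) with hS
  have hSc : IsClosed S := hy.1.abs.preimage_isClosed_of_isClosed isClosed_Icc isClosed_Ici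
  have hSb : BddAbove S := ⟨b, fun s hs => hs.1.2⟩
  obtain ⟨s₀, hs₀, hs₀'⟩ := hcon
  have hne : S.Nonempty := ⟨s₀, hs₀, hs₀'.le⟩
  have hmem := hSc.csSup_mem hne hSb
  have h1 : RiccatiSol p m w (sSup S) b c y := by
    refine IntegralSol.riccatiSol (T := N + 1) (hy.mono hmem.1.1) fun s hs => ?_
    rcases hs.1.eq_or_lt with h | h
    · rw [← h]
      have hcont := hy.1 (sSup S) hmem.1
      by_contra! hgt
      have hmem' := hmem.1
      have hne_b : sSup S ≠ b := by
        intro hb'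
        have hc : RiccatiSol p m w b b c y := by
          refine ⟨by simp, fun t ht => ?_⟩
          rw [Icc_self, mem_singleton_iff] at ht
          rw [ht, hy.2 b (right_mem_Icc.2 hab)]
          simp
        have := hN b (right_mem_Icc.2 hab) y hc
        rw [hb'] at hgt
        linarith
      have hlt : sSup S < b := lt_of_le_of_ne hmem'.2 hne_b
      have hc2 : ContinuousWithinAt (fun s => |y s|) (Ioi (sSup S)) (sSup S) :=
        (hcont.abs.mono_of_mem_nhdsWithin
          (mem_of_superset (Icc_mem_nhdsGE hlt) (Icc_subset_Icc_left hmem'.1))).mono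
          Ioi_subset_Ici_self
      have hev := hc2.eventually (lt_mem_nhds hgt)
      obtain ⟨r, hr1, hr2⟩ := (hev.and (Ioo_mem_nhdsGT hlt)).exists
      have := le_csSup hSb (show r ∈ S from ⟨⟨hmem'.1.trans hr2.1.le, hr2.2.le⟩, hr1.le⟩)
      linarith [hr2.1]
    · by_contra! hgt
      have := le_csSup hSb (show s ∈ S from ⟨⟨hmem.1.1.trans hs.1, hs.2⟩, hgt.le⟩)
      linarith
  have h2 := hN _ hmem.1 y h1
  have h3 : N + 1 ≤ |y (sSup S)| := hmem.2
  linarith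

theorem continuousOn_logIncr {p : ℝ} (hp : 1 < p) {m y : ℝ → ℝ} {a b : ℝ} (hab : a ≤ b)
    (hm : ContinuousOn m (Icc a b)) (hm0 : ∀ s ∈ Icc a b, 0 < m s)
    (hy : ContinuousOn y (Icc a b)) : ContinuousOn (logIncr p m b y) (Icc a b) :=
  continuousOn_primitive_right hab
    ((continuousOn_conjPow_div hp hm hm0 hy).intervalIntegrable_of_Icc hab)

theorem hasDerivWithinAt_logIncr {p : ℝ} (hp : 1 < p) {m y : ℝ → ℝ} {a b t : ℝ}
    (hm : ContinuousOn m (Icc a b)) (hm0 : ∀ s ∈ Icc a b, 0 < m s)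
    (hy : ContinuousOn y (Icc a b)) (ht : t ∈ Icc a b) :
    HasDerivWithinAt (logIncr p m b y) (conjPow p (y t / m t)) (Icc a b) t :=
  hasDerivWithinAt_primitive_right (continuousOn_conjPow_div hp hm hm0 hy) ht

theorem eq_add_integral_of_hasDerivWithinAt {f f' : ℝ → ℝ} {a b t : ℝ}
    (hf : ∀ s ∈ Icc a b, HasDerivWithinAt f (f' s) (Icc a b) s)
    (hf' : IntervalIntegrable f' volume a b) (ht : t ∈ Icc a b) :
    f t = f b + ∫ s in b..t, f' s := by
  have hab : a ≤ b := ht.1.trans ht.2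
  have hfc : ContinuousOn f (Icc a b) := fun s hs => (hf s hs).continuousWithinAt
  rw [intervalIntegral.integral_symm, intervalIntegral.integral_eq_sub_of_hasDerivAt_of_le ht.2
    (hfc.mono (Icc_subset_Icc_left ht.1))
    (fun s hs => (hf s ⟨ht.1.trans hs.1.le, hs.2.le⟩).hasDerivAt
      (Icc_mem_nhds (ht.1.trans_lt hs.1) hs.2))
    (intervalIntegrable_of_mem_Icc hf' ht (right_mem_Icc.2 hab))]
  ring

theorem continuousOn_riccatiTerm {p : ℝ} (hp : 1 < p) {m y : ℝ → ℝ} {a b : ℝ}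
    (hm : ContinuousOn m (Icc a b)) (hm0 : ∀ s ∈ Icc a b, 0 < m s)
    (hy : ContinuousOn y (Icc a b)) : ContinuousOn (fun s => riccatiTerm p m s (y s)) (Icc a b) :=
  (continuousOn_const.mul (hm.mul (((hy.div hm fun s hs => (hm0 s hs).ne').abs).rpow_const
    fun _ _ => Or.inr (by linarith [one_lt_conj hp])))).neg

theorem RiccatiSol.intervalIntegrable {p : ℝ} (hp : 1 < p) {m w : ℝ → ℝ} {a b c : ℝ} {y : ℝ → ℝ}
    (hab : a ≤ b) (hm : ContinuousOn m (Icc a b)) (hm0 : ∀ s ∈ Icc a b, 0 < m s)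
    (hw : IntervalIntegrable w volume a b) (hy : RiccatiSol p m w a b c y) :
    IntervalIntegrable (fun s => w s + riccatiTerm p m s (y s)) volume a b :=
  hw.add ((continuousOn_riccatiTerm hp hm hm0 hy.1).intervalIntegrable_of_Icc hab)

theorem RiccatiSol.apply_right {p : ℝ} {m w : ℝ → ℝ} {a b c : ℝ} {y : ℝ → ℝ} (hab : a ≤ b)
    (hy : RiccatiSol p m w a b c y) : y b = c := by
  rw [hy.2 b (right_mem_Icc.2 hab)]; simp

/-- The linearised flux identity: `f ^ (p - 1) * y` has derivative `w * f ^ (p - 1)`. -/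
theorem RiccatiSol.flux_identity {p : ℝ} (hp : 1 < p) {m w : ℝ → ℝ} {a b c : ℝ} {y : ℝ → ℝ}
    (hm : ContinuousOn m (Icc a b)) (hm0 : ∀ s ∈ Icc a b, 0 < m s)
    (hw : IntervalIntegrable w volume a b) (hy : RiccatiSol p m w a b c y) {t : ℝ}
    (ht : t ∈ Icc a b) :
    Real.exp ((p - 1) * logIncr p m b y t) * y t =
      c + ∫ s in b..t, w s * Real.exp ((p - 1) * logIncr p m b y s) := by
  have hab : a ≤ b := ht.1.trans ht.2
  have hkc := continuousOn_conjPow_div hp hm hm0 hy.1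
  have hlc := continuousOn_logIncr hp hab hm hm0 hy.1
  have hd : ∀ s ∈ Icc a b, HasDerivWithinAt (fun s => Real.exp ((p - 1) * logIncr p m b y s))
      (Real.exp ((p - 1) * logIncr p m b y s) * ((p - 1) * conjPow p (y s / m s)))
      (Icc a b) s := fun s hs =>
    ((hasDerivWithinAt_logIncr hp hm hm0 hy.1 hs).const_mul (p - 1)).exp
  have hec : ContinuousOn (fun s => Real.exp ((p - 1) * logIncr p m b y s)) (Icc a b) :=
    fun s hs => (hd s hs).continuousWithinAt
  have hdi : IntervalIntegrable (fun s => Real.exp ((p - 1) * logIncr p m b y s) *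
      ((p - 1) * conjPow p (y s / m s))) volume a b :=
    (hec.mul (continuousOn_const.mul hkc)).intervalIntegrable_of_Icc hab
  have hyb := hy.apply_right hab
  have h := mul_eq_add_integral (g := y) hdi (hy.intervalIntegrable hp hab hm hm0 hw)
    (fun s hs => eq_add_integral_of_hasDerivWithinAt hd hdi hs)
    (fun s hs => by rw [hyb]; exact hy.2 s hs) ht
  rw [h, hyb]
  congr 1
  · simp [logIncr]
  · refine intervalIntegral.integral_congr fun s hs => ?_
    rw [uIcc_comm, uIcc_of_le ht.2] at hs
    have hms := hm0 s ⟨ht.1.trans hs.1, hs.2⟩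
    have h1 := conjPow_mul_self hp (y s / m s)
    have h2 : conjPow p (y s / m s) * y s = m s * |y s / m s| ^ (p / (p - 1)) := by
      rw [← h1]; field_simp
    simp only [riccatiTerm]
    linear_combination (Real.exp ((p - 1) * logIncr p m b y s) * (p - 1)) * h2

theorem abs_integral_mul_le {w g : ℝ → ℝ} {a b t E : ℝ} (hw : IntervalIntegrable w volume a b)
    (ht : t ∈ Icc a b) (hg : ∀ s ∈ Icc t b, |g s| ≤ E) (hE : 0 ≤ E) :
    |∫ s in b..t, w s * g s| ≤ (∫ s in a..b, |w s|) * E := by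
  have hab : a ≤ b := ht.1.trans ht.2
  rw [intervalIntegral.integral_symm, abs_neg]
  calc |∫ s in t..b, w s * g s| ≤ ∫ s in t..b, |w s| * E := by
        refine intervalIntegral.norm_integral_le_of_norm_le (f := fun s => w s * g s) ht.2 ?_ ?_
        · refine Eventually.of_forall fun s hs => ?_
          rw [Real.norm_eq_abs, abs_mul]
          exact mul_le_mul_of_nonneg_left (hg s (Ioc_subset_Icc_self hs)) (abs_nonneg _)
        · exact (intervalIntegrable_of_mem_Icc hw ht (right_mem_Icc.2 hab)).abs.mul_const E
    _ = (∫ s in t..b, |w s|) * E := intervalIntegral.integral_mul_const _ _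
    _ ≤ _ := by
        refine mul_le_mul_of_nonneg_right ?_ hE
        exact intervalIntegral.integral_mono_interval ht.1 ht.2 le_rfl
          (Eventually.of_forall fun s => abs_nonneg _) hw.abs

theorem RiccatiSol.abs_flux_sub_le {p : ℝ} (hp : 1 < p) {m w : ℝ → ℝ} {a b c M : ℝ} {y : ℝ → ℝ}
    (hm : ContinuousOn m (Icc a b)) (hm0 : ∀ s ∈ Icc a b, 0 < m s)
    (hw : IntervalIntegrable w volume a b) {t : ℝ} (ht : t ∈ Icc a b)
    (hy : RiccatiSol p m w t b c y) (hM : ∀ s ∈ Icc t b, logIncr p m b y s ≤ M) :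
    |Real.exp ((p - 1) * logIncr p m b y t) * y t - c| ≤
      (∫ s in a..b, |w s|) * Real.exp ((p - 1) * M) := by
  have hab : a ≤ b := ht.1.trans ht.2
  have hsub : Icc t b ⊆ Icc a b := Icc_subset_Icc_left ht.1
  have hp1 : 0 < p - 1 := by linarith
  rw [hy.flux_identity hp (hm.mono hsub) (fun s hs => hm0 s (hsub hs))
    (intervalIntegrable_of_mem_Icc hw ht (right_mem_Icc.2 hab)) (left_mem_Icc.2 ht.2),
    add_sub_cancel_left]
  refine abs_integral_mul_le hw ht (fun s hs => ?_) (Real.exp_pos _).le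
  rw [abs_of_pos (Real.exp_pos _)]
  exact Real.exp_le_exp.2 (mul_le_mul_of_nonneg_left (hM s hs) hp1.le)

theorem RiccatiSol.abs_apply_le {p : ℝ} (hp : 1 < p) {m w : ℝ → ℝ} {a b c M : ℝ} {y : ℝ → ℝ}
    (hm : ContinuousOn m (Icc a b)) (hm0 : ∀ s ∈ Icc a b, 0 < m s)
    (hw : IntervalIntegrable w volume a b) {t : ℝ} (ht : t ∈ Icc a b)
    (hy : RiccatiSol p m w t b c y) (hM : ∀ s ∈ Icc t b, logIncr p m b y s ≤ M)
    (hMt : -M ≤ logIncr p m b y t) :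
    |y t| ≤ Real.exp ((p - 1) * M) *
      (|c| + (∫ s in a..b, |w s|) * Real.exp ((p - 1) * M)) := by
  have hp1 : 0 < p - 1 := by linarith
  have h1 := hy.abs_flux_sub_le hp hm hm0 hw ht hM
  have h2 := abs_sub_abs_le_abs_sub (Real.exp ((p - 1) * logIncr p m b y t) * y t) c
  have h3 : y t = Real.exp (-((p - 1) * logIncr p m b y t)) *
      (Real.exp ((p - 1) * logIncr p m b y t) * y t) := by
    rw [← mul_assoc, ← Real.exp_add]; simp
  rw [h3, abs_mul, abs_of_pos (Real.exp_pos _)]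
  refine mul_le_mul (Real.exp_le_exp.2 ?_) (by linarith) (abs_nonneg _) (Real.exp_pos _).le
  nlinarith

theorem RiccatiSol.sub_le {p : ℝ} (hp : 1 < p) {m w : ℝ → ℝ} {a b c : ℝ} {y : ℝ → ℝ}
    (hm : ContinuousOn m (Icc a b)) (hm0 : ∀ s ∈ Icc a b, 0 < m s)
    (hw : IntervalIntegrable w volume a b) {t : ℝ} (ht : t ∈ Icc a b)
    (hy : RiccatiSol p m w t b c y) : c - (∫ s in a..b, |w s|) ≤ y t := by
  have hab : a ≤ b := ht.1.trans ht.2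
  have hsub : Icc t b ⊆ Icc a b := Icc_subset_Icc_left ht.1
  have hwt := intervalIntegrable_of_mem_Icc hw ht (right_mem_Icc.2 hab)
  have hF := continuousOn_riccatiTerm hp (hm.mono hsub) (fun s hs => hm0 s (hsub hs)) hy.1
  have h1 := abs_integral_mul_le (g := fun _ => 1) (E := 1) hw ht (by simp) zero_le_one
  simp only [mul_one] at h1
  have h2 : 0 ≤ ∫ s in b..t, riccatiTerm p m s (y s) := by
    rw [intervalIntegral.integral_symm, ← intervalIntegral.integral_neg]
    refine intervalIntegral.integral_nonneg ht.2 fun s hs => ?_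
    have := hm0 s (hsub hs)
    have hp1 : 0 < p - 1 := by linarith
    simp only [riccatiTerm, neg_neg]
    positivity
  rw [hy.2 t (left_mem_Icc.2 ht.2), intervalIntegral.integral_add hwt.symm
    (hF.intervalIntegrable_of_Icc ht.2).symm]
  linarith [(abs_le.1 h1).1]

theorem conjPow_neg (p z : ℝ) : conjPow p (-z) = -conjPow p z := by
  simp [conjPow]

theorem conjPow_of_nonneg {p : ℝ} (hp : 1 < p) {z : ℝ} (hz : 0 ≤ z) :
    conjPow p z = z ^ (1 / (p - 1)) := by
  rw [← abs_of_nonneg (show 0 ≤ conjPow p z by unfold conjPow; positivity), abs_conjPow hp,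
    abs_of_nonneg hz]

theorem le_conjPow_of_le {p : ℝ} (hp : 1 < p) {Q z : ℝ} (hQ : 0 ≤ Q) (hz : Q ^ (p - 1) ≤ z) :
    Q ≤ conjPow p z := by
  have hp1 : 0 < p - 1 := by linarith
  have h0 : 0 ≤ Q ^ (p - 1) := by positivity
  rw [conjPow_of_nonneg hp (h0.trans hz)]
  calc Q = (Q ^ (p - 1)) ^ (1 / (p - 1)) := by
        rw [← Real.rpow_mul hQ, mul_one_div_cancel hp1.ne', Real.rpow_one]
    _ ≤ _ := Real.rpow_le_rpow h0 hz (by positivity)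

theorem logIncr_le_of_le {p : ℝ} (hp : 1 < p) {m y : ℝ → ℝ} {a b Q : ℝ} (hab : a ≤ b)
    (hm : ContinuousOn m (Icc a b)) (hm0 : ∀ s ∈ Icc a b, 0 < m s)
    (hyc : ContinuousOn y (Icc a b)) (hQ : 0 ≤ Q)
    (hy : ∀ s ∈ Icc a b, Q ^ (p - 1) * m s ≤ y s) : logIncr p m b y a ≤ -((b - a) * Q) := by
  rw [logIncr, intervalIntegral.integral_symm, neg_le_neg_iff]
  have h := intervalIntegral.integral_mono_on hab (intervalIntegrable_const (c := Q))
    ((continuousOn_conjPow_div hp hm hm0 hyc).intervalIntegrable_of_Icc (μ := volume) hab)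
    fun s hs => le_conjPow_of_le hp hQ ((le_div_iff₀ (hm0 s hs)).2 (hy s hs))
  simpa using h

theorem logIncr_neg (p : ℝ) (m : ℝ → ℝ) (b : ℝ) (y : ℝ → ℝ) (t : ℝ) :
    logIncr p m b (fun s => -y s) t = -logIncr p m b y t := by
  simp [logIncr, neg_div, conjPow_neg]

theorem le_logIncr_of_le {p : ℝ} (hp : 1 < p) {m y : ℝ → ℝ} {a b Q : ℝ} (hab : a ≤ b)
    (hm : ContinuousOn m (Icc a b)) (hm0 : ∀ s ∈ Icc a b, 0 < m s)
    (hyc : ContinuousOn y (Icc a b)) (hQ : 0 ≤ Q)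
    (hy : ∀ s ∈ Icc a b, y s ≤ -(Q ^ (p - 1) * m s)) : (b - a) * Q ≤ logIncr p m b y a := by
  have h := logIncr_le_of_le hp hab hm hm0 hyc.neg hQ fun s hs => by
    have := hy s hs
    simp only [Pi.neg_apply]
    linarith
  have h2 := logIncr_neg p m b y a
  change logIncr p m b (fun s => -y s) a ≤ _ at h
  linarith

theorem RiccatiSol.exists_logIncr_gt {p : ℝ} (hp : 1 < p) {m w : ℝ → ℝ} {a b M : ℝ} (hab : a < b)
    (hm : ContinuousOn m (Icc a b)) (hm0 : ∀ s ∈ Icc a b, 0 < m s)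
    (hw : IntervalIntegrable w volume a b) (hM : 0 ≤ M) :
    ∃ c, ∃ t ∈ Icc a b, ∃ y, RiccatiSol p m w t b c y ∧ M < logIncr p m b y t := by
  by_contra! hcon
  obtain ⟨A, hA0, hA⟩ := exists_abs_le_of_continuousOn hm
  have hp1 : 0 < p - 1 := by linarith
  set B := ∫ s in a..b, |w s| with hB
  have hba : 0 < b - a := by linarith
  set Q := (M + 1) / (b - a) with hQ
  have hQ0 : 0 ≤ Q := by positivity
  set E := Real.exp ((p - 1) * M) with hE
  have hEpos : 0 < E := Real.exp_pos _
  set c := -(B * E + E * (Q ^ (p - 1) * A)) with hc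
  have hup : ∀ t ∈ Icc a b, ∀ y, RiccatiSol p m w t b c y → y t ≤ -(Q ^ (p - 1) * A) := by
    intro t ht y hy
    have h1 := (abs_le.1 (hy.abs_flux_sub_le hp hm hm0 hw ht (M := M) fun s hs =>
      hcon c s ⟨ht.1.trans hs.1, hs.2⟩ y (hy.mono hs.1))).2
    have h2 : Real.exp ((p - 1) * logIncr p m b y t) * y t ≤ -(E * (Q ^ (p - 1) * A)) := by
      linarith
    have h3 : Real.exp ((p - 1) * logIncr p m b y t) ≤ E :=
      Real.exp_le_exp.2 (mul_le_mul_of_nonneg_left (hcon c t ht y hy) hp1.le)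
    have h4 := Real.exp_pos ((p - 1) * logIncr p m b y t)
    have h5 : 0 ≤ Q ^ (p - 1) * A := by positivity
    by_contra! hlt
    nlinarith
  obtain ⟨y, hy⟩ := RiccatiSol.exists_of_bound (N := |c - B|) (c := c) hp hab.le hm hm0 hw
    (fun t ht y hy => by
      have h1 := hup t ht y hy
      have h2 := hy.sub_le hp hm hm0 hw ht
      have h5 : 0 ≤ Q ^ (p - 1) * A := by positivity
      rw [abs_of_nonpos (by linarith : y t ≤ 0)]
      linarith [neg_abs_le (c - B)])
  have h1 := le_logIncr_of_le hp hab.le hm hm0 hy.1 hQ0 fun s hs => by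
    have h2 := hup s hs y (hy.mono hs.1)
    have h3 : Q ^ (p - 1) * m s ≤ Q ^ (p - 1) * A :=
      mul_le_mul_of_nonneg_left ((le_abs_self _).trans (hA s hs)) (by positivity)
    linarith
  have h2 := hcon c a (left_mem_Icc.2 hab.le) y hy
  have h3 : (b - a) * Q = M + 1 := by rw [hQ]; field_simp
  linarith

theorem RiccatiSol.exists_logIncr_lt {p : ℝ} (hp : 1 < p) {m w : ℝ → ℝ} {a b M : ℝ} (hab : a < b)
    (hm : ContinuousOn m (Icc a b)) (hm0 : ∀ s ∈ Icc a b, 0 < m s)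
    (hw : IntervalIntegrable w volume a b) (hM : 0 ≤ M) :
    ∃ c, ∃ t ∈ Icc a b, ∃ y, RiccatiSol p m w t b c y ∧ logIncr p m b y t < -M := by
  by_contra! hcon
  obtain ⟨A, hA0, hA⟩ := exists_abs_le_of_continuousOn hm
  have hp1 : 0 < p - 1 := by linarith
  set B := ∫ s in a..b, |w s| with hB
  have hba : 0 < b - a := by linarith
  set Q := (M + 1) / (b - a) with hQ
  have hQ0 : 0 ≤ Q := by positivity
  set c := B + Q ^ (p - 1) * A with hc
  have hlow : ∀ t ∈ Icc a b, ∀ y, RiccatiSol p m w t b c y → Q ^ (p - 1) * A ≤ y t := by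
    intro t ht y hy
    have h2 := hy.sub_le hp hm hm0 hw ht
    linarith
  have hlow' : ∀ t ∈ Icc a b, ∀ y, RiccatiSol p m w t b c y → ∀ s ∈ Icc t b,
      Q ^ (p - 1) * m s ≤ y s := by
    intro t ht y hy s hs
    have hs' : s ∈ Icc a b := ⟨ht.1.trans hs.1, hs.2⟩
    have h2 := hlow s hs' y (hy.mono hs.1)
    have h3 : Q ^ (p - 1) * m s ≤ Q ^ (p - 1) * A :=
      mul_le_mul_of_nonneg_left ((le_abs_self _).trans (hA s hs')) (by positivity)
    linarith
  obtain ⟨y, hy⟩ := RiccatiSol.exists_of_bound (c := c) hp hab.le hm hm0 hw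
    (fun t ht y hy => by
      refine hy.abs_apply_le hp hm hm0 hw ht (M := M) (fun s hs => ?_) (hcon c t ht y hy)
      have hs' : s ∈ Icc a b := ⟨ht.1.trans hs.1, hs.2⟩
      have hsub : Icc s b ⊆ Icc a b := Icc_subset_Icc_left hs'.1
      have h1 := logIncr_le_of_le hp hs.2 (hm.mono hsub) (fun r hr => hm0 r (hsub hr))
        (hy.mono hs.1).1 hQ0 (hlow' s hs' y (hy.mono hs.1))
      have h2 : 0 ≤ (b - s) * Q := mul_nonneg (by linarith [hs.2]) hQ0
      linarith)
  have h1 := logIncr_le_of_le hp hab.le hm hm0 hy.1 hQ0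
    (hlow' a (left_mem_Icc.2 hab.le) y hy)
  have h2 := hcon c a (left_mem_Icc.2 hab.le) y hy
  have h3 : (b - a) * Q = M + 1 := by rw [hQ]; field_simp
  linarith

section Polar

variable {d : ℕ}

theorem integral_eq_zero_of_forall_radial (hd : 2 ≤ d) {f : Euc d → ℝ}
    (h : ∀ ω : Euc d, ‖ω‖ = 1 → ∫ r in Ioi (0 : ℝ), r ^ (d - 1) * f (r • ω) = 0) :
    ∫ x, f x = 0 := by
  by_cases hf : Integrable f
  swap
  · exact integral_undef hf
  have : Nontrivial (Euc d) := by
    have : Nonempty (Fin d) := ⟨⟨0, by omega⟩⟩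
    infer_instance
  have hfin : Module.finrank ℝ (Euc d) = d := finrank_euclideanSpace_fin
  have hmp := (volume : Measure (Euc d)).measurePreserving_homeomorphUnitSphereProd
  rw [hfin] at hmp
  set e := homeomorphUnitSphereProd (Euc d) with he
  have h1 : ∫ x, f x = ∫ x : ({(0)}ᶜ : Set (Euc d)), f x.1 ∂(volume.comap Subtype.val) := by
    rw [integral_subtype_comap (measurableSet_singleton _).compl f, restrict_compl_singleton]
  have hfi : Integrable (fun x : ({(0)}ᶜ : Set (Euc d)) => f x.1) (volume.comap Subtype.val) := by
    have h2 : IntegrableOn f ({(0)}ᶜ : Set (Euc d)) := hf.integrableOn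
    rwa [integrableOn_iff_comap_subtypeVal (measurableSet_singleton _).compl] at h2
  have hsymm : ∀ z, ((e.symm z : ({(0)}ᶜ : Set (Euc d))) : Euc d) = z.2.1 • z.1.1 := fun z => rfl
  have h3 : ∫ x : ({(0)}ᶜ : Set (Euc d)), f x.1 ∂(volume.comap Subtype.val) =
      ∫ z, f (z.2.1 • z.1.1) ∂((volume : Measure (Euc d)).toSphere.prod
        (.volumeIoiPow (d - 1))) := by
    rw [← hmp.integral_comp e.measurableEmbedding]
    refine integral_congr_ae (Eventually.of_forall fun x => ?_)
    simp only [← hsymm, Homeomorph.symm_apply_apply]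
  have hgi : Integrable (fun z : sphere (0 : Euc d) 1 × Ioi (0 : ℝ) => f (z.2.1 • z.1.1))
      ((volume : Measure (Euc d)).toSphere.prod (.volumeIoiPow (d - 1))) := by
    rw [← hmp.integrable_comp_emb e.measurableEmbedding]
    refine hfi.congr (Eventually.of_forall fun x => ?_)
    simp only [Function.comp_apply, ← hsymm, Homeomorph.symm_apply_apply]
  rw [h1, h3, integral_prod _ hgi]
  refine integral_eq_zero_of_ae (Eventually.of_forall fun ω => ?_)
  have h4 := h ω.1 (by simp)
  simp only [Measure.volumeIoiPow, ENNReal.ofReal, Pi.zero_apply]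
  rw [integral_withDensity_eq_integral_smul
    (measurable_subtype_coe.pow_const _).real_toNNReal,
    integral_subtype_comap measurableSet_Ioi
      fun r : ℝ => Real.toNNReal (r ^ (d - 1)) • f (r • ω.1)]
  refine Eq.trans ?_ h4
  refine setIntegral_congr_fun (measurableSet_Ioi (a := (0 : ℝ))) fun r hr => ?_
  simp only [NNReal.smul_def, Real.coe_toNNReal _ (pow_nonneg (mem_Ioi.1 hr).le _), smul_eq_mul]

theorem hasGradientAt_norm {x : Euc d} (hx : x ≠ 0) :
    HasGradientAt (fun x : Euc d => ‖x‖) (‖x‖⁻¹ • x) x := by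
  have hx' : 0 < ‖x‖ := norm_pos_iff.2 hx
  have h : HasGradientAt (fun x : Euc d => ‖x‖ ^ 2) ((2 : ℝ) • x) x := by
    rw [hasGradientAt_iff_hasFDerivAt]
    refine (hasStrictFDerivAt_norm_sq x).hasFDerivAt.congr_fderiv ?_
    ext v
    simp
  have h2 := hasGradientAt_comp_real (G := Real.sqrt) (Real.hasDerivAt_sqrt (by positivity)) h
  simp only [Real.sqrt_sq (norm_nonneg _)] at h2
  convert h2 using 1
  rw [smul_smul]
  congr 1
  field_simp

theorem pFlux_smul_unit {p : ℝ} (hp : 1 < p) {z : ℝ} {e : Euc d} (he : ‖e‖ = 1) :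
    pFlux p (conjPow p z • e) = z • e := by
  rw [pFlux, norm_smul, he, mul_one, Real.norm_eq_abs, smul_smul, abs_conjPow_rpow_mul hp]

/-- The open annulus of radii `a` and `b` centred at the origin. -/
def annulus (d : ℕ) (a b : ℝ) : Set (Euc d) := {x | a < ‖x‖ ∧ ‖x‖ < b}

theorem isOpen_annulus (a b : ℝ) : IsOpen (annulus d a b) :=
  (isOpen_lt continuous_const continuous_norm).inter (isOpen_lt continuous_norm continuous_const)

theorem hasDerivAt_radial {ψ : Euc d → ℝ} (hψ : ContDiff ℝ 1 ψ) (ω : Euc d) (r : ℝ) :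
    HasDerivAt (fun r : ℝ => ψ (r • ω)) ⟪ω, gradient ψ (r • ω)⟫ r := by
  have h1 := ((hasGradientAt_iff_hasFDerivAt.1 (hψ.hasGradientAt_one (r • ω)))).comp_hasDerivAt r
    ((hasDerivAt_id r).smul_const ω)
  simpa [Function.comp_def, real_inner_comm] using h1

theorem hasGradientAt_radial_sol {p : ℝ} (hp : 1 < p) {w : ℝ → ℝ} {a b c ℓ : ℝ} {y : ℝ → ℝ}
    (ha : 0 < a) (hy : RiccatiSol p (fun s => s ^ (d - 1)) w a b c y) {x : Euc d}
    (hx : x ∈ annulus d a b) :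
    HasGradientAt (fun x : Euc d => ℓ + logIncr p (fun s => s ^ (d - 1)) b y ‖x‖)
      (conjPow p (y ‖x‖ / ‖x‖ ^ (d - 1)) • (‖x‖⁻¹ • x)) x := by
  have hx0 : x ≠ 0 := norm_pos_iff.1 (ha.trans hx.1)
  have hd := (hasDerivWithinAt_logIncr hp (m := fun s => s ^ (d - 1)) (by fun_prop)
    (fun s hs => pow_pos (ha.trans_le hs.1) _) hy.1 ⟨hx.1.le, hx.2.le⟩).hasDerivAt
    (Icc_mem_nhds hx.1 hx.2)
  exact hasGradientAt_comp_real (G := fun t => ℓ + logIncr p (fun s => s ^ (d - 1)) b y t)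
    (hd.const_add ℓ) (hasGradientAt_norm hx0)

theorem contDiffOn_one_of_hasGradientAt {f : Euc d → ℝ} {g : Euc d → Euc d} {Ω : Set (Euc d)}
    (hΩ : IsOpen Ω) (hf : ∀ x ∈ Ω, HasGradientAt f (g x) x) (hg : ContinuousOn g Ω) :
    ContDiffOn ℝ 1 f Ω := by
  rw [show (1 : WithTop ℕ∞) = 0 + 1 from rfl, contDiffOn_succ_iff_fderiv_of_isOpen hΩ]
  refine ⟨fun x hx => (hf x hx).differentiableAt.differentiableWithinAt, by simp, ?_⟩
  rw [contDiffOn_zero]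
  refine ((InnerProductSpace.toDual ℝ (Euc d)).continuous.comp_continuousOn hg).congr
    fun x hx => ?_
  exact (hasGradientAt_iff_hasFDerivAt.1 (hf x hx)).fderiv

theorem RiccatiSol.logSol {p : ℝ} (hd : 2 ≤ d) (hp : 1 < p) {V : Euc d → ℝ} {v : ℝ → ℝ}
    {a b c ℓ : ℝ} {y : ℝ → ℝ} (ha : 0 < a) (hab : a ≤ b)
    (hV : ∀ x ∈ annulus d a b, V x = v ‖x‖)
    (hw : IntervalIntegrable (fun s => s ^ (d - 1) * v s) volume a b)
    (hy : RiccatiSol p (fun s => s ^ (d - 1)) (fun s => s ^ (d - 1) * v s) a b c y) :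
    LogSol p V (annulus d a b)
      (fun x => ℓ + logIncr p (fun s => s ^ (d - 1)) b y ‖x‖) := by
  set m : ℝ → ℝ := fun s => s ^ (d - 1) with hm
  have hmc : ContinuousOn m (Icc a b) := by fun_prop
  have hm0 : ∀ s ∈ Icc a b, 0 < m s := fun s hs => pow_pos (ha.trans_le hs.1) _
  have hgrad := fun (x : Euc d) (hx : x ∈ annulus d a b) =>
    hasGradientAt_radial_sol (ℓ := ℓ) hp ha hy hx
  refine ⟨contDiffOn_one_of_hasGradientAt (isOpen_annulus a b) hgrad ?_, ?_⟩
  · have h1 : ContinuousOn (fun x : Euc d => conjPow p (y ‖x‖ / ‖x‖ ^ (d - 1)))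
        (annulus d a b) :=
      (continuousOn_conjPow_div hp hmc hm0 hy.1).comp continuous_norm.continuousOn
        fun x hx => ⟨hx.1.le, hx.2.le⟩
    refine h1.smul (ContinuousOn.smul (ContinuousOn.inv₀ continuous_norm.continuousOn
      fun x hx => (ha.trans hx.1).ne') continuousOn_id)
  · intro ψ hψ hc hs
    refine integral_eq_zero_of_forall_radial hd fun ω hω => ?_
    set h : ℝ → ℝ := fun r => ψ (r • ω) with hh
    set h' : ℝ → ℝ := fun r => ⟪ω, gradient ψ (r • ω)⟫ with hh'
    have hder : ∀ r, HasDerivAt h (h' r) r := hasDerivAt_radial hψ ω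
    have hh'c : Continuous h' :=
      continuous_const.inner ((continuous_gradient hψ).comp (by fun_prop))
    have hout : ∀ r, 0 ≤ r → r ∉ Ioo a b → r • ω ∉ tsupport ψ := by
      intro r hr hrab hmem
      have := hs hmem
      rw [annulus, mem_ofPred_eq, norm_smul, hω, mul_one, Real.norm_of_nonneg hr] at this
      exact hrab this
    have hb0 : h b = 0 := image_eq_zero_of_notMem_tsupport (f := ψ)
      (hout b (ha.le.trans hab) fun h => lt_irrefl _ h.2)
    have ha0 : h a = 0 := image_eq_zero_of_notMem_tsupport (f := ψ)
      (hout a ha.le fun h => lt_irrefl _ h.1)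
    have hyb := hy.apply_right hab
    have hprod := mul_eq_add_integral (f := h) (g := y) (hh'c.intervalIntegrable a b)
      (hy.intervalIntegrable hp hab hmc hm0 hw)
      (fun t ht => eq_add_integral_of_hasDerivWithinAt (fun s _ => (hder s).hasDerivWithinAt)
        (hh'c.intervalIntegrable a b) ht)
      (fun t ht => by rw [hyb]; exact hy.2 t ht) (left_mem_Icc.2 hab)
    rw [ha0, hb0, zero_mul, zero_mul, zero_add, intervalIntegral.integral_symm,
      intervalIntegral.integral_of_le hab] at hprod
    have hint : ∫ s in Ioc a b, (h' s * y s + h s * (s ^ (d - 1) * v s +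
      riccatiTerm p m s (y s))) = 0 := by linarith
    refine Eq.trans ?_ hint
    rw [setIntegral_eq_of_subset_of_forall_sdiff_eq_zero (s := Ioo a b) (t := Ioi 0)
      measurableSet_Ioi (fun r hr => ha.trans hr.1) ?_,
      integral_Ioc_eq_integral_Ioo]
    · refine setIntegral_congr_fun measurableSet_Ioo fun r hr => ?_
      have hr0 : 0 < r := ha.trans hr.1
      have hnorm : ‖r • ω‖ = r := by rw [norm_smul, hω, mul_one, Real.norm_of_nonneg hr0.le]
      have hmem : r • ω ∈ annulus d a b := by
        rw [annulus, mem_ofPred_eq, hnorm]; exact hr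
      have hg := (hgrad _ hmem).gradient
      rw [hnorm, smul_smul r⁻¹ r, inv_mul_cancel₀ hr0.ne', one_smul] at hg
      have hmr := hm0 r ⟨hr.1.le, hr.2.le⟩
      have hmr' : (r ^ (d - 1) : ℝ) ≠ 0 := hmr.ne'
      rw [hg, pFlux_smul_unit hp hω, hV _ hmem, hnorm, norm_smul, hω, mul_one, Real.norm_eq_abs,
        abs_conjPow_rpow hp, real_inner_smul_left]
      simp only [riccatiTerm, hm, hh, hh']
      field_simp
      ring
    · intro r hr
      have hn := hout r (le_of_lt hr.1) hr.2
      rw [gradient_eq_zero_of_notMem_tsupport hn, image_eq_zero_of_notMem_tsupport hn]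
      simp

end Polar

section Compare

variable {d : ℕ}

theorem isPreconnected_annulus (hd : 2 ≤ d) {a b : ℝ} (ha : 0 ≤ a) :
    IsPreconnected (annulus d a b) := by
  have hrank : 1 < Module.rank ℝ (Euc d) := by
    rw [← Module.finrank_eq_rank, finrank_euclideanSpace_fin]
    exact_mod_cast hd
  have h := ((isPreconnected_sphere hrank (0 : Euc d) 1).prod
    (isPreconnected_Ioo (a := a) (b := b))).image (fun z : Euc d × ℝ => z.2 • z.1)
    (by fun_prop)
  convert h using 1
  ext x
  constructor
  · intro hx
    have hx0 : 0 < ‖x‖ := ha.trans_lt hx.1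
    refine ⟨(‖x‖⁻¹ • x, ‖x‖), ⟨?_, hx⟩, ?_⟩
    · simp [norm_smul, hx0.ne']
    · simp [smul_smul, hx0.ne']
  · rintro ⟨⟨ω, r⟩, ⟨hω, hr⟩, rfl⟩
    have hr0 : 0 ≤ r := ha.trans hr.1.le
    have : ‖ω‖ = 1 := by simpa using hω
    simpa [annulus, norm_smul, this, abs_of_nonneg hr0] using hr

theorem LogSol.congr {p : ℝ} {V L L' : Euc d → ℝ} {Ω : Set (Euc d)} (hΩ : IsOpen Ω)
    (h : LogSol p V Ω L) (he : EqOn L' L Ω) : LogSol p V Ω L' := by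
  refine ⟨h.1.congr he, fun ψ h1 h2 h3 => ?_⟩
  rw [← h.2 ψ h1 h2 h3]
  refine integral_congr_ae (Eventually.of_forall fun x => ?_)
  by_cases hx : x ∈ tsupport ψ
  · have hg : gradient L' x = gradient L x := by
      have : L' =ᶠ[𝓝 x] L := he.eventuallyEq_of_mem (hΩ.mem_nhds (h3 hx))
      rw [gradient, gradient, this.fderiv_eq]
    simp only [hg]
  · simp only [gradient_eq_zero_of_notMem_tsupport hx, image_eq_zero_of_notMem_tsupport hx,
      inner_zero_right, mul_zero]

theorem LogSol.add_const {p : ℝ} {V L : Euc d → ℝ} {Ω : Set (Euc d)}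
    (h : LogSol p V Ω L) (k : ℝ) : LogSol p V Ω (fun x => L x + k) := by
  refine ⟨h.1.add contDiffOn_const, fun ψ h1 h2 h3 => ?_⟩
  have hg : ∀ x, gradient (fun x => L x + k) x = gradient L x := fun x => by
    rw [gradient, gradient, fderiv_add_const]
  simpa only [hg] using h.2 ψ h1 h2 h3

theorem LogSol.le_of_boundary_gap (hd : 2 ≤ d) {p : ℝ} (hp : 1 < p) {V w g : Euc d → ℝ}
    {a b : ℝ} (ha : 0 < a) (hab : a < b) (hV : Measurable V)
    (hVb : BddOnCompacts V (annulus d a b)) (hw : LogSol p V (annulus d a b) w)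
    (hg : LogSol p V (annulus d a b) g) {D : ℝ → ℝ} (hD : ContinuousOn D (Icc a b))
    (hDa : 0 < D a) (hDb : 0 < D b) (hle : ∀ x ∈ annulus d a b, w x + D ‖x‖ ≤ g x) :
    ∀ x ∈ annulus d a b, w x ≤ g x := by
  have h1 : ∀ᶠ t in 𝓝[Icc a b] a, 0 < D t :=
    (hD a (left_mem_Icc.2 hab.le)).eventually (lt_mem_nhds hDa)
  have h2 : ∀ᶠ t in 𝓝[Icc a b] b, 0 < D t :=
    (hD b (right_mem_Icc.2 hab.le)).eventually (lt_mem_nhds hDb)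
  obtain ⟨δ₁, hδ₁, h1⟩ := Metric.eventually_nhds_iff.1 (eventually_nhdsWithin_iff.1 h1)
  obtain ⟨δ₂, hδ₂, h2⟩ := Metric.eventually_nhds_iff.1 (eventually_nhdsWithin_iff.1 h2)
  obtain ⟨δ, hδ, hδm⟩ : ∃ δ, 0 < δ ∧ δ < min (min δ₁ δ₂) (b - a) :=
    exists_between (lt_min (lt_min hδ₁ hδ₂) (sub_pos.2 hab))
  simp only [lt_min_iff] at hδm
  set S : Set (Euc d) := closedBall 0 (b - δ) ∩ {x | a + δ ≤ ‖x‖} with hS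
  have hSc : IsCompact S := (isCompact_closedBall _ _).inter_right
    (isClosed_le continuous_const continuous_norm)
  refine LogSol.le_of_le_off_compact hp (isOpen_annulus a b) (isPreconnected_annulus hd ha.le)
    hV hVb hw hg hSc ?_ ?_ ?_
  · rintro x ⟨h3, h4⟩
    have h3 : ‖x‖ ≤ b - δ := by simpa using h3
    have h4 : a + δ ≤ ‖x‖ := h4
    exact ⟨by linarith, by linarith⟩
  · rintro x ⟨hx, hxS⟩
    have hpos : 0 < D ‖x‖ := by
      by_cases h4 : a + δ ≤ ‖x‖
      · have h5 : b - δ < ‖x‖ := by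
          by_contra! h5
          exact hxS ⟨by simpa using h5, h4⟩
        refine h2 ?_ ⟨hx.1.le, hx.2.le⟩
        rw [Real.dist_eq, abs_lt]
        constructor <;> linarith [hx.2]
      · refine h1 ?_ ⟨hx.1.le, hx.2.le⟩
        rw [Real.dist_eq, abs_lt]
        constructor <;> linarith [hx.1]
    linarith [hle x hx]
  · have : Nontrivial (Euc d) := by
      have : Nonempty (Fin d) := ⟨⟨0, by omega⟩⟩
      infer_instance
    obtain ⟨x, hx⟩ := exists_norm_eq (Euc d) (c := a + δ / 2) (by linarith)
    refine ⟨x, ⟨by rw [hx]; linarith, by rw [hx]; linarith⟩, fun h => ?_⟩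
    have h4 : a + δ ≤ ‖x‖ := h.2
    linarith

theorem logSol_of_annuli {p : ℝ} {V L : Euc d → ℝ} {R : ℝ} (hR : 0 < R)
    (h : ∀ a ∈ Ioo 0 R, LogSol p V (annulus d a R) L) : LogSol p V (ball 0 R \ {0}) L := by
  constructor
  · intro x hx
    have hx0 : 0 < ‖x‖ := norm_pos_iff.2 hx.2
    have hxR : ‖x‖ < R := by simpa using hx.1
    have hmem : x ∈ annulus d (‖x‖ / 2) R := ⟨by linarith, hxR⟩
    exact ((h (‖x‖ / 2) ⟨by linarith, by linarith⟩).1.contDiffAt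
      ((isOpen_annulus _ _).mem_nhds hmem)).contDiffWithinAt
  · intro ψ h1 h2 h3
    obtain ⟨a, ha, hsub⟩ : ∃ a ∈ Ioo 0 R, ∀ x ∈ tsupport ψ, a < ‖x‖ := by
      rcases (tsupport ψ).eq_empty_or_nonempty with h0 | h0
      · exact ⟨R / 2, ⟨by linarith, by linarith⟩, by simp [h0]⟩
      · obtain ⟨x, hx, hmin⟩ := h2.isCompact.exists_isMinOn h0 continuous_norm.continuousOn
        have hx0 : 0 < ‖x‖ := norm_pos_iff.2 (h3 hx).2
        have hxR : ‖x‖ < R := by simpa using (h3 hx).1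
        refine ⟨‖x‖ / 2, ⟨by linarith, by linarith⟩, fun z hz => ?_⟩
        have : ‖x‖ ≤ ‖z‖ := hmin hz
        linarith
    exact (h a ha).2 ψ h1 h2 fun x hx => ⟨hsub x hx, by simpa using (h3 hx).1⟩

end Compare

section Shooting

variable {p R k : ℝ} {m w h : ℝ → ℝ}

theorem RiccatiSol.logIncr_eq_of_le (hp : 1 < p) (hm : ContinuousOn m (Ioi 0))
    (hm0 : ∀ s, 0 < s → 0 < m s) (hw : ∀ a ∈ Ioc 0 R, IntervalIntegrable w volume a R)
    {a a' c t : ℝ} {y y' : ℝ → ℝ} (ha : 0 < a) (haa : a ≤ a') (hy : RiccatiSol p m w a R c y)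
    (hy' : RiccatiSol p m w a' R c y') (ht : t ∈ Icc a' R) :
    logIncr p m R y' t = logIncr p m R y t := by
  have ha' := ha.trans_le haa
  exact logIncr_congr (RiccatiSol.eqOn hp (hm.mono fun s hs => ha'.trans_le hs.1)
    (fun s hs => hm0 s (ha'.trans_le hs.1)) (hw a' ⟨ha', ht.1.trans ht.2⟩) hy' (hy.mono haa)) ht

theorem RiccatiSol.isOpen_setOf_logIncr_mem (hp : 1 < p) (hm : ContinuousOn m (Ioi 0))
    (hm0 : ∀ s, 0 < s → 0 < m s) (hw : ∀ a ∈ Ioc 0 R, IntervalIntegrable w volume a R)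
    {O : ℝ → Set ℝ} (hO : ∀ a, IsOpen (O a)) :
    IsOpen {c | ∃ a ∈ Ioo 0 R, ∃ y, RiccatiSol p m w a R c y ∧ logIncr p m R y a ∈ O a} := by
  rw [isOpen_iff_mem_nhds]
  rintro c ⟨a, ha, y, hy, hya⟩
  filter_upwards [RiccatiSol.stable hp ha.2.le (hm.mono fun s hs => ha.1.trans_le hs.1)
    (fun s hs => hm0 s (ha.1.trans_le hs.1)) (hw a ⟨ha.1, ha.2.le⟩) hy (hO a) hya] with c' hc'
  exact ⟨a, ha, hc'⟩

theorem RiccatiSol.exists_forall_abs_sub_le (hp : 1 < p) (hR : 0 < R)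
    (hm : ContinuousOn m (Ioi 0)) (hm0 : ∀ s, 0 < s → 0 < m s)
    (hw : ∀ a ∈ Ioc 0 R, IntervalIntegrable w volume a R)
    (hh : ContinuousOn h (Ioc 0 R)) (hk : 0 < k)
    (hup : ∀ a ∈ Ioo 0 R, ∀ c y, RiccatiSol p m w a R c y → h a + k < logIncr p m R y a →
      ∀ t ∈ Ioo a R, h t - k ≤ logIncr p m R y t)
    (hlo : ∀ a ∈ Ioo 0 R, ∀ c y, RiccatiSol p m w a R c y → logIncr p m R y a < h a - k →
      ∀ t ∈ Ioo a R, logIncr p m R y t ≤ h t + k) :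
    ∃ c, ∀ a ∈ Ioo 0 R, ∀ y, RiccatiSol p m w a R c y → |logIncr p m R y a - h a| ≤ k := by
  set U := {c | ∃ a ∈ Ioo 0 R, ∃ y, RiccatiSol p m w a R c y ∧
    logIncr p m R y a ∈ Ioi (h a + k)} with hU
  set W := {c | ∃ a ∈ Ioo 0 R, ∃ y, RiccatiSol p m w a R c y ∧
    logIncr p m R y a ∈ Iio (h a - k)} with hW
  have hUo : IsOpen U := RiccatiSol.isOpen_setOf_logIncr_mem hp hm hm0 hw fun a => isOpen_Ioi
  have hWo : IsOpen W := RiccatiSol.isOpen_setOf_logIncr_mem hp hm hm0 hw fun a => isOpen_Iio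
  have hR2 : R / 2 < R := by linarith
  have hR0 : 0 < R / 2 := by linarith
  obtain ⟨B, hB0, hB⟩ := exists_abs_le_of_continuousOn
    (hh.mono fun s (hs : s ∈ Icc (R / 2) R) => ⟨hR0.trans_le hs.1, hs.2⟩)
  have hm' : ContinuousOn m (Icc (R / 2) R) := hm.mono fun s hs => hR0.trans_le hs.1
  have hm0' : ∀ s ∈ Icc (R / 2) R, 0 < m s := fun s hs => hm0 s (hR0.trans_le hs.1)
  have hRR : ∀ y, logIncr p m R y R = 0 := fun y => by simp [logIncr]
  have hUn : U.Nonempty := by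
    obtain ⟨c, t, ht, y, hy, hgt⟩ := RiccatiSol.exists_logIncr_gt (M := B + k) hp hR2 hm' hm0'
      (hw _ ⟨hR0, hR2.le⟩) (by linarith)
    refine ⟨c, t, ⟨hR0.trans_le ht.1, lt_of_le_of_ne ht.2 ?_⟩, y, hy, ?_⟩
    · rintro rfl
      rw [hRR] at hgt
      linarith
    · have := (abs_le.1 (hB t ht)).2
      exact lt_of_le_of_lt (by linarith) hgt
  have hWn : W.Nonempty := by
    obtain ⟨c, t, ht, y, hy, hgt⟩ := RiccatiSol.exists_logIncr_lt (M := B + k) hp hR2 hm' hm0'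
      (hw _ ⟨hR0, hR2.le⟩) (by linarith)
    refine ⟨c, t, ⟨hR0.trans_le ht.1, lt_of_le_of_ne ht.2 ?_⟩, y, hy, ?_⟩
    · rintro rfl
      rw [hRR] at hgt
      linarith
    · have := (abs_le.1 (hB t ht)).1
      exact lt_of_lt_of_le hgt (by linarith)
  have hdisj : ¬ (univ ∩ (U ∩ W)).Nonempty := by
    rintro ⟨c, -, ⟨a, ha, y, hy, hya⟩, ⟨a', ha', y', hy', hya'⟩⟩
    rw [mem_Ioi] at hya
    rw [mem_Iio] at hya'
    rcases lt_trichotomy a a' with haa | haa | haa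
    · have h1 := hup a ha c y hy hya a' ⟨haa, ha'.2⟩
      rw [RiccatiSol.logIncr_eq_of_le hp hm hm0 hw ha.1 haa.le hy hy' ⟨le_rfl, ha'.2.le⟩] at hya'
      linarith
    · subst haa
      rw [RiccatiSol.logIncr_eq_of_le hp hm hm0 hw ha.1 le_rfl hy hy' ⟨le_rfl, ha'.2.le⟩] at hya'
      linarith
    · have h1 := hlo a' ha' c y' hy' hya' a ⟨haa, ha.2⟩
      rw [RiccatiSol.logIncr_eq_of_le hp hm hm0 hw ha'.1 haa.le hy' hy ⟨le_rfl, ha.2.le⟩] at hya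
      linarith
  have hne : ∃ c, c ∉ U ∪ W := by
    by_contra! hall
    exact hdisj (isPreconnected_univ U W hUo hWo (fun c _ => hall c) (by simpa using hUn)
      (by simpa using hWn))
  obtain ⟨c, hc⟩ := hne
  refine ⟨c, fun a ha y hy => ?_⟩
  have h1 : ¬ h a + k < logIncr p m R y a := fun hlt => hc (Or.inl ⟨a, ha, y, hy, hlt⟩)
  have h2 : ¬ logIncr p m R y a < h a - k := fun hlt => hc (Or.inr ⟨a, ha, y, hy, hlt⟩)
  rw [abs_le]
  constructor <;> linarith

theorem RiccatiSol.exists_of_forall_abs_sub_le (hp : 1 < p)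
    (hm : ContinuousOn m (Ioi 0)) (hm0 : ∀ s, 0 < s → 0 < m s)
    (hw : ∀ a ∈ Ioc 0 R, IntervalIntegrable w volume a R)
    (hh : ContinuousOn h (Ioc 0 R)) (hk : 0 ≤ k) {c : ℝ}
    (hc : ∀ a ∈ Ioo 0 R, ∀ y, RiccatiSol p m w a R c y → |logIncr p m R y a - h a| ≤ k)
    {a : ℝ} (ha : a ∈ Ioo 0 R) : ∃ y, RiccatiSol p m w a R c y := by
  obtain ⟨B, hB0, hB⟩ := exists_abs_le_of_continuousOn
    (hh.mono fun s (hs : s ∈ Icc a R) => ⟨ha.1.trans_le hs.1, hs.2⟩)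
  have hm' : ContinuousOn m (Icc a R) := hm.mono fun s hs => ha.1.trans_le hs.1
  have hm0' : ∀ s ∈ Icc a R, 0 < m s := fun s hs => hm0 s (ha.1.trans_le hs.1)
  have key : ∀ s ∈ Icc a R, ∀ y, RiccatiSol p m w s R c y → |logIncr p m R y s| ≤ B + k := by
    intro s hs y hy
    rcases hs.2.lt_or_eq with hsR | rfl
    · have h1 := hc s ⟨ha.1.trans_le hs.1, hsR⟩ y hy
      have h2 := hB s hs
      calc |logIncr p m R y s| = |(logIncr p m R y s - h s) + h s| := by ring_nf
        _ ≤ k + B := (abs_add_le _ _).trans (add_le_add h1 h2)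
        _ = B + k := add_comm _ _
    · simp only [logIncr, intervalIntegral.integral_same, abs_zero]
      linarith
  refine RiccatiSol.exists_of_bound hp ha.2.le hm' hm0' (hw a ⟨ha.1, ha.2.le⟩) fun a' ha' y hy =>
    RiccatiSol.abs_apply_le (M := B + k) hp hm' hm0' (hw a ⟨ha.1, ha.2.le⟩) ha' hy (fun s hs => ?_) ?_
  · exact (abs_le.1 (key s ⟨ha'.1.trans hs.1, hs.2⟩ y (hy.mono hs.1))).2
  · exact (abs_le.1 (key a' ha' y hy)).1

end Shooting

section Final

variable {d : ℕ}

theorem annulus_subset_punctured_ball {a b R : ℝ} (ha : 0 ≤ a) (hb : b ≤ R) :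
    annulus d a b ⊆ ball 0 R \ {0} := fun x hx =>
  ⟨by simpa using hx.2.trans_le hb, norm_pos_iff.1 (ha.trans_lt hx.1)⟩

theorem intervalIntegrable_radial_weight {V : Euc d → ℝ} {a b R : ℝ} {e : Euc d} (he : ‖e‖ = 1)
    (hV : Measurable V) (hVb : BddOnCompacts V (ball 0 R \ {0})) (ha : 0 < a) (hab : a ≤ b)
    (hb : b < R) : IntervalIntegrable (fun s => s ^ (d - 1) * V (s • e)) volume a b := by
  have hnorm : ∀ s : ℝ, 0 ≤ s → ‖s • e‖ = s := fun s hs => by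
    rw [norm_smul, he, mul_one, Real.norm_of_nonneg hs]
  obtain ⟨M, hM⟩ := hVb ((fun s : ℝ => s • e) '' Icc a b) (isCompact_Icc.image (by fun_prop)) (by
    rintro _ ⟨s, hs, rfl⟩
    have hs0 : 0 < s := ha.trans_le hs.1
    have hn := hnorm s hs0.le
    exact ⟨by simpa only [mem_ball_zero_iff, hn] using hs.2.trans_lt hb,
      norm_pos_iff.1 (by rw [hn]; exact hs0)⟩)
  rw [intervalIntegrable_iff_integrableOn_Icc_of_le hab]
  refine Integrable.mono' (g := fun s => |s ^ (d - 1)| * M)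
    (Continuous.continuousOn (by fun_prop)).integrableOn_Icc
    (((measurable_id.pow_const _).mul
      (hV.comp (measurable_id.smul_const e))).aestronglyMeasurable) ?_
  filter_upwards [ae_restrict_mem measurableSet_Icc] with s hs
  rw [Real.norm_eq_abs, abs_mul]
  exact mul_le_mul_of_nonneg_left (hM _ ⟨s, hs, rfl⟩) (abs_nonneg _)

theorem exists_radial_logSol (hd : 2 ≤ d) {p : ℝ} (hp : 1 < p) {R : ℝ} (hR : 0 < R)
    {V : Euc d → ℝ} (hV : Measurable V) (hVb : BddOnCompacts V (ball 0 (2 * R) \ {0}))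
    (hVsym : ∀ x y, ‖x‖ = ‖y‖ → V x = V y) {L : Euc d → ℝ}
    (hL : LogSol p V (ball 0 (2 * R) \ {0}) L) {K : ℝ} (hK : 0 < K)
    (hLK : ∀ x y, 0 < ‖x‖ → ‖x‖ ≤ R → ‖x‖ = ‖y‖ → L x ≤ L y + K) :
    ∃ G : ℝ → ℝ, LogSol p V (ball 0 R \ {0}) (fun x => G ‖x‖) ∧
      ∀ x, 0 < ‖x‖ → ‖x‖ < R → |G ‖x‖ - L x| ≤ 2 * K + 1 := by
  have : Nontrivial (Euc d) := by
    have : Nonempty (Fin d) := ⟨⟨0, by omega⟩⟩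
    infer_instance
  obtain ⟨e, he⟩ := exists_norm_eq (Euc d) zero_le_one
  have hnorm : ∀ s : ℝ, 0 ≤ s → ‖s • e‖ = s := fun s hs => by
    rw [norm_smul, he, mul_one, Real.norm_of_nonneg hs]
  let m : ℝ → ℝ := fun s => s ^ (d - 1)
  let w : ℝ → ℝ := fun s => s ^ (d - 1) * V (s • e)
  let H : ℝ → ℝ := fun s => L (s • e)
  have hm : ContinuousOn m (Ioi 0) := by fun_prop
  have hm0 : ∀ s, 0 < s → 0 < m s := fun s hs => pow_pos hs _
  have hw : ∀ a ∈ Ioc 0 R, IntervalIntegrable w volume a R := fun a ha =>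
    intervalIntegrable_radial_weight he hV hVb ha.1 ha.2 (by linarith)
  have hH : ContinuousOn H (Ioc 0 R) := by
    refine hL.1.continuousOn.comp (Continuous.continuousOn (by fun_prop)) fun s hs => ?_
    have hn := hnorm s hs.1.le
    exact ⟨by rw [mem_ball_zero_iff, hn]; linarith [hs.2],
      norm_pos_iff.1 (by rw [hn]; exact hs.1)⟩
  have hLH : ∀ x, 0 < ‖x‖ → ‖x‖ ≤ R → L x ≤ H ‖x‖ + K := fun x h0 h1 =>
    hLK x _ h0 h1 (hnorm _ h0.le).symm
  have hHL : ∀ x, 0 < ‖x‖ → ‖x‖ ≤ R → H ‖x‖ ≤ L x + K := fun x h0 h1 =>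
    hLK _ x (by rwa [hnorm _ h0.le]) (by rwa [hnorm _ h0.le]) (hnorm _ h0.le)
  have hsol : ∀ a ∈ Ioo 0 R, ∀ c y, RiccatiSol p m w a R c y →
      LogSol p V (annulus d a R) (fun x => H R + logIncr p m R y ‖x‖) := fun a ha c y hy =>
    RiccatiSol.logSol (v := fun s => V (s • e)) hd hp ha.1 ha.2.le
      (fun x hx => hVsym _ _ (hnorm _ (norm_nonneg x)).symm) (hw a ⟨ha.1, ha.2.le⟩) hy
  have hsub : ∀ a ∈ Ioo 0 R, annulus d a R ⊆ ball 0 (2 * R) \ {0} := fun a ha =>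
    annulus_subset_punctured_ball ha.1.le (by linarith)
  have hVa : ∀ a ∈ Ioo 0 R, BddOnCompacts V (annulus d a R) := fun a ha K' h1 h2 =>
    hVb K' h1 (h2.trans (hsub a ha))
  have hHa : ∀ a ∈ Ioo 0 R, ContinuousOn H (Icc a R) := fun a ha =>
    hH.mono fun s hs => ⟨ha.1.trans_le hs.1, hs.2⟩
  have hya : ∀ a ∈ Ioo 0 R, ∀ c y, RiccatiSol p m w a R c y →
      ContinuousOn (logIncr p m R y) (Icc a R) := fun a ha c y hy =>
    continuousOn_logIncr hp ha.2.le (hm.mono fun s hs => ha.1.trans_le hs.1)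
      (fun s hs => hm0 s (ha.1.trans_le hs.1)) hy.1
  have hRR : ∀ y, logIncr p m R y R = 0 := fun y => by simp [logIncr]
  have hmem : ∀ a ∈ Ioo 0 R, ∀ t ∈ Ioo a R, t • e ∈ annulus d a R := fun a ha t ht => by
    rw [annulus, mem_ofPred_eq, hnorm _ (ha.1.trans ht.1).le]; exact ht
  obtain ⟨c, hc⟩ := RiccatiSol.exists_forall_abs_sub_le (h := fun s => H s - H R) (k := K + 1)
    hp hR hm hm0 hw (hH.sub continuousOn_const) (by linarith)
    (by
      intro a ha c y hy hgt t ht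
      have h1 := LogSol.le_of_boundary_gap hd hp ha.1 ha.2 hV (hVa a ha)
        ((hL.mono (hsub a ha)).add_const (-(K + 1 / 2))) (hsol a ha c y hy)
        (D := fun t => H R + logIncr p m R y t - H t + 1 / 2)
        (((continuousOn_const.add (hya a ha c y hy)).sub (hHa a ha)).add continuousOn_const)
        (by linarith) (by simp only [hRR]; linarith)
        (fun x hx => by linarith [hLH x (ha.1.trans hx.1) hx.2.le]) (t • e) (hmem a ha t ht)
      rw [hnorm _ (ha.1.trans ht.1).le] at h1
      change H t + _ ≤ _ at h1
      linarith)
    (by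
      intro a ha c y hy hlt t ht
      have h1 := LogSol.le_of_boundary_gap hd hp ha.1 ha.2 hV (hVa a ha)
        (hsol a ha c y hy) ((hL.mono (hsub a ha)).add_const (K + 1 / 2))
        (D := fun t => H t - (H R + logIncr p m R y t) + 1 / 2)
        (((hHa a ha).sub (continuousOn_const.add (hya a ha c y hy))).add continuousOn_const)
        (by linarith) (by simp only [hRR]; linarith)
        (fun x hx => by linarith [hHL x (ha.1.trans hx.1) hx.2.le]) (t • e) (hmem a ha t ht)
      rw [hnorm _ (ha.1.trans ht.1).le] at h1
      change _ ≤ H t + _ at h1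
      linarith)
  choose! Y hY using fun a (ha : a ∈ Ioo 0 R) => RiccatiSol.exists_of_forall_abs_sub_le hp hm hm0
    hw (hH.sub continuousOn_const) (by linarith : (0 : ℝ) ≤ K + 1) hc ha
  refine ⟨fun t => H R + logIncr p m R (Y t) t, logSol_of_annuli hR fun a ha => ?_, ?_⟩
  · refine (hsol a ha c _ (hY a ha)).congr (isOpen_annulus a R) fun x hx => ?_
    simp only
    rw [RiccatiSol.logIncr_eq_of_le hp hm hm0 hw ha.1 hx.1.le (hY a ha)
      (hY _ ⟨ha.1.trans hx.1, hx.2⟩) ⟨le_rfl, hx.2.le⟩]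
  · intro x hx0 hxR
    have h1 := abs_le.1 (hc _ ⟨hx0, hxR⟩ _ (hY _ ⟨hx0, hxR⟩))
    have h2 := hLH x hx0 hxR.le
    have h3 := hHL x hx0 hxR.le
    simp only at h1 ⊢
    rw [abs_le]
    constructor <;> linarith [h1.1, h1.2]

end Final

theorem stmt15 (d : ℕ) (hd : 2 ≤ d) (p : ℝ) (hp : 1 < p) (C₀ : ℝ) (hC₀ : 0 < C₀)
    (R : ℝ) (hR : 0 < R)
    (V : EuclideanSpace ℝ (Fin d) → ℝ) (hVmeas : Measurable V)
    (hVloc : ∀ K : Set (EuclideanSpace ℝ (Fin d)), IsCompact K →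
      K ⊆ ball (0 : EuclideanSpace ℝ (Fin d)) (2 * R) \ {0} → ∃ M : ℝ, ∀ x ∈ K, |V x| ≤ M)
    -- spherical symmetry of the potential
    (hVsym : ∀ x y : EuclideanSpace ℝ (Fin d), ‖x‖ = ‖y‖ → V x = V y)
    (hFuchs : ∀ᵐ x ∂(volume.restrict (ball (0 : EuclideanSpace ℝ (Fin d)) (2 * R) \ {0})),
      ‖x‖ ^ p * |V x| ≤ C₀)
    (u : EuclideanSpace ℝ (Fin d) → ℝ)
    (hu : IsPosWeakSol p V (ball (0 : EuclideanSpace ℝ (Fin d)) (2 * R) \ {0}) u) :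
    ∃ ut : EuclideanSpace ℝ (Fin d) → ℝ,
      IsPosWeakSol p V (ball (0 : EuclideanSpace ℝ (Fin d)) R \ {0}) ut ∧
      (∀ x y : EuclideanSpace ℝ (Fin d), ‖x‖ = ‖y‖ → ut x = ut y) ∧
      ∃ C : ℝ, 1 ≤ C ∧ ∃ ε : ℝ, 0 < ε ∧ ε < R ∧
        ∀ x : EuclideanSpace ℝ (Fin d), 0 < ‖x‖ → ‖x‖ < ε →
          C⁻¹ * ut x ≤ u x ∧ u x ≤ C * ut x := by
  have hopen : ∀ r : ℝ, IsOpen (ball (0 : Euc d) r \ {0}) := fun r =>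
    isOpen_ball.sdiff isClosed_singleton
  have hL := logSol_of_isPosWeakSol hp (hopen (2 * R)) hVmeas hVloc hu
  obtain ⟨K, hK, hharnack⟩ := exists_sphere_harnack_const hd hp hC₀.le
  obtain ⟨G, hG, hGL⟩ := exists_radial_logSol hd hp hR hVmeas hVloc hVsym hL hK
    (hharnack R V _ hVmeas hL hFuchs)
  refine ⟨fun x => Real.exp (G ‖x‖), isPosWeakSol_of_logSol hp (hopen R) hG,
    fun x y hxy => by simp only [hxy], Real.exp (2 * K + 1), Real.one_le_exp (by linarith),
    R / 2, by linarith, by linarith, fun x hx0 hxR => ?_⟩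
  have hpos : 0 < u x := hu.2.1 x ⟨by rw [mem_ball_zero_iff]; linarith, norm_pos_iff.1 hx0⟩
  have h1 := abs_le.1 (hGL x hx0 (by linarith))
  rw [← Real.exp_neg, ← Real.exp_add, ← Real.exp_add, ← Real.exp_log hpos]
  exact ⟨Real.exp_le_exp.2 (by linarith [h1.2]), Real.exp_le_exp.2 (by linarith [h1.1])⟩
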